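/- Let U be an open subset of C^n, f : U → C^k a holomorphic mapping, and Q : C^n × C^k → C^q a polynomial mapping such that Q(x, f(x)) = 0 for all x ∈ U. Then for every x₀ ∈ U there exist an open neighborhood U₀ ⊆ U of x₀ and a sequence (f^ν : U₀ → C^k) of Nash mappings converging uniformly on U₀ to f|_{U₀} such that Q(x, f^ν(x)) = 0 for all x ∈ U₀ and all ν ∈ ℕ. -/

import Mathlib

open Filter Topology

/-- A Nash function on an open set `U ⊆ ℂⁿ`: holomorphic on `U` and, at every point of `U`,
satisfying a nonzero polynomial equation `P(x, f(x)) = 0` on a neighborhood. -/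
def NashFn (n : ℕ) (U : Set (Fin n → ℂ)) (f : (Fin n → ℂ) → ℂ) : Prop :=
  DifferentiableOn ℂ f U ∧ ∀ x₀ ∈ U, ∃ V : Set (Fin n → ℂ), IsOpen V ∧ x₀ ∈ V ∧
    ∃ P : Polynomial (MvPolynomial (Fin n) ℂ), P ≠ 0 ∧
      ∀ x ∈ V ∩ U, Polynomial.eval₂ (MvPolynomial.eval x) (f x) P = 0

section Limits
variable {E : Type*} [NormedAddCommGroup E] [NormedSpace ℂ E]

/-- A uniform limit of holomorphic functions on an open set of a normed space is holomorphic. -/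
theorem TendstoUniformlyOn.differentiableOn_complex {F : ℕ → E → ℂ} {g : E → ℂ} {s : Set E}
    (hs : IsOpen s) (hF : ∀ k, DifferentiableOn ℂ (F k) s)
    (h : TendstoUniformlyOn F g atTop s) : DifferentiableOn ℂ g s := by
  intro a ha
  obtain ⟨r, hr, hrs⟩ := Metric.isOpen_iff.1 hs a ha
  have hr2 : 0 < r / 2 := by positivity
  have hsub : ∀ x ∈ Metric.ball a (r / 2), Metric.ball x (r / 2) ⊆ s := by
    intro x hx y hy
    refine hrs ?_
    rw [Metric.mem_ball] at *
    linarith [dist_triangle y x a]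
  have hdiffat : ∀ k, ∀ x ∈ Metric.ball a (r / 2), DifferentiableAt ℂ (F k) x := by
    intro k x hx
    exact (hF k).differentiableAt (hs.mem_nhds (hsub x hx (Metric.mem_ball_self hr2)))
  have hC : UniformCauchySeqOn (fun k => fderiv ℂ (F k)) atTop (Metric.ball a (r / 2)) := by
    have hF' := h.uniformCauchySeqOn
    rw [Metric.uniformCauchySeqOn_iff] at hF' ⊢
    intro ε hε
    obtain ⟨N, hN⟩ := hF' (ε * r / 8) (by positivity)
    refine ⟨N, fun k hk l hl x hx => ?_⟩
    have hd : DifferentiableOn ℂ (fun y => F k y - F l y) (Metric.ball x (r / 2)) :=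
      ((hF k).sub (hF l)).mono (hsub x hx)
    have hm : Set.MapsTo (fun y => F k y - F l y) (Metric.ball x (r / 2))
        (Metric.closedBall (F k x - F l x) (ε * r / 4)) := by
      intro y hy
      have h1 := hN k hk l hl y (hsub x hx hy)
      have h2 := hN k hk l hl x (hsub x hx (Metric.mem_ball_self hr2))
      rw [dist_eq_norm] at h1 h2
      rw [Metric.mem_closedBall, dist_eq_norm]
      refine (norm_sub_le _ _).trans ?_
      linarith
    have := Complex.norm_fderiv_le_div_of_mapsTo_ball hd hm hr2
    rw [fderiv_fun_sub (hdiffat k x hx) (hdiffat l x hx)] at this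
    rw [dist_eq_norm]
    refine this.trans_lt ?_
    rw [div_lt_iff₀ hr2]
    nlinarith [mul_pos hε hr]
  have hlim : ∀ x ∈ Metric.ball a (r / 2), ∃ L, Tendsto (fun k => fderiv ℂ (F k) x) atTop (𝓝 L) :=
    fun x hx => cauchySeq_tendsto_of_complete (hC.cauchySeq hx)
  choose! g' hg' using hlim
  have hu := hC.tendstoUniformlyOn_of_tendsto hg'
  exact (hasFDerivAt_of_tendstoUniformlyOn Metric.isOpen_ball hu
    (fun k x hx => (hdiffat k x hx).hasFDerivAt)
    (fun x hx => h.tendsto_at (hsub x hx (Metric.mem_ball_self hr2)))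
    (Metric.mem_ball_self hr2)).differentiableAt.differentiableWithinAt

/-- The restriction of a function to the complex line through `a` and `b`. -/
theorem DifferentiableOn.comp_lineMap {f : E → ℂ} {s : Set E} (hf : DifferentiableOn ℂ f s)
    (a b : E) : DifferentiableOn ℂ (fun z : ℂ => f (a + z • (b - a)))
      ((fun z : ℂ => a + z • (b - a)) ⁻¹' s) := by
  refine hf.comp ?_ (fun z hz => hz)
  fun_prop

theorem eqOn_zero_of_eventuallyEq_zero_of_convex {f : E → ℂ} {s : Set E} (hs : IsOpen s)
    (hc : Convex ℝ s) (hf : DifferentiableOn ℂ f s) {a : E} (ha : a ∈ s) (h0 : f =ᶠ[𝓝 a] 0) :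
    ∀ x ∈ s, f x = 0 := by
  intro b hb
  set φ : ℂ → E := fun z => a + z • (b - a) with hφ
  have hφc : Continuous φ := by fun_prop
  have hconv : Convex ℝ (φ ⁻¹' s) := by
    intro z hz w hw p q hp hq hpq
    have := hc hz hw hp hq hpq
    simp only [Set.mem_preimage, hφ] at this ⊢
    convert this using 1
    have : (p : ℂ) + q = 1 := by exact_mod_cast hpq
    simp only [Complex.real_smul, smul_add, add_smul, mul_smul]
    rw [← Complex.coe_smul p a, ← Complex.coe_smul q a, ← Complex.coe_smul p, ← Complex.coe_smul q]
    rw [add_add_add_comm, ← add_smul, this, one_smul]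
  have han := (hf.comp_lineMap a b).analyticOnNhd (hs.preimage hφc)
  have h0' : (fun z => f (φ z)) =ᶠ[𝓝 0] 0 := by
    have : Tendsto φ (𝓝 0) (𝓝 a) := by
      have := hφc.tendsto 0
      simpa [hφ] using this
    exact this.eventually h0
  have := han.eqOn_zero_of_preconnected_of_eventuallyEq_zero hconv.isPreconnected
    (z₀ := 0) (by simpa [hφ] using ha) h0' (x := 1) (by simpa [hφ] using hb)
  simpa [hφ] using this

theorem eqOn_zero_or_eqOn_zero_of_mul {f g : E → ℂ} {s : Set E} (hs : IsOpen s)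
    (hc : Convex ℝ s) (hf : DifferentiableOn ℂ f s) (hg : DifferentiableOn ℂ g s)
    (h : ∀ x ∈ s, f x * g x = 0) : (∀ x ∈ s, f x = 0) ∨ (∀ x ∈ s, g x = 0) := by
  by_cases hf0 : ∀ x ∈ s, f x = 0
  · exact .inl hf0
  right
  push Not at hf0
  obtain ⟨a, ha, hfa⟩ := hf0
  refine eqOn_zero_of_eventuallyEq_zero_of_convex hs hc hg ha ?_
  have hcont := (hf.differentiableAt (hs.mem_nhds ha)).continuousAt
  filter_upwards [hcont.eventually_ne hfa, hs.mem_nhds ha] with x hx hxs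
  exact (mul_eq_zero.1 (h x hxs)).resolve_left hx

end Limits

section HolLim
variable {V W : Type*} [NormedAddCommGroup V] [NormedSpace ℂ V]
  [NormedAddCommGroup W] [NormedSpace ℂ W]

/-- Polynomial functions on a complex normed space. -/
noncomputable def polyFun (V : Type*) [NormedAddCommGroup V] [NormedSpace ℂ V] :
    Subalgebra ℂ C(V, ℂ) :=
  Algebra.adjoin ℂ (Set.range fun l : V →L[ℂ] ℂ => (⟨l, l.continuous⟩ : C(V, ℂ)))

theorem clm_mem_polyFun (l : V →L[ℂ] ℂ) : (⟨l, l.continuous⟩ : C(V, ℂ)) ∈ polyFun V :=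
  Algebra.subset_adjoin ⟨l, rfl⟩

theorem differentiable_of_mem_polyFun {P : C(V, ℂ)} (hP : P ∈ polyFun V) :
    Differentiable ℂ P := by
  induction hP using Algebra.adjoin_induction with
  | mem x hx => obtain ⟨l, rfl⟩ := hx; exact l.differentiable
  | algebraMap r => exact differentiable_const r
  | add x y _ _ hx hy => exact hx.add hy
  | mul x y _ _ hx hy => exact hx.mul hy

theorem comp_clm_mem_polyFun {P : C(W, ℂ)} (hP : P ∈ polyFun W) (l : V →L[ℂ] W) :
    P.comp ⟨l, l.continuous⟩ ∈ polyFun V := by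
  induction hP using Algebra.adjoin_induction with
  | mem x hx => obtain ⟨m, rfl⟩ := hx; exact clm_mem_polyFun (m.comp l)
  | algebraMap r => exact (polyFun V).algebraMap_mem r
  | add x y _ _ hx hy => exact add_mem hx hy
  | mul x y _ _ hx hy => exact mul_mem hx hy

/-- Uniform limits of polynomial functions on a set. -/
def HolLim (K : Set V) (g : V → ℂ) : Prop :=
  ∀ ε > 0, ∃ P ∈ polyFun V, ∀ x ∈ K, ‖g x - P x‖ ≤ ε

/-- The closed subalgebra of uniform limits of polynomial functions on a compact set. -/
noncomputable def holAlg (K : Set V) [CompactSpace K] : Subalgebra ℂ C(K, ℂ) :=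
  ((polyFun V).map (ContinuousMap.compRightAlgHom ℂ ℂ
    (⟨Subtype.val, continuous_subtype_val⟩ : C(K, V)))).topologicalClosure

theorem mem_holAlg_iff {K : Set V} [CompactSpace K] {h : C(K, ℂ)} :
    h ∈ holAlg K ↔ ∀ ε > 0, ∃ P ∈ polyFun V, ∀ x : K, ‖h x - P x‖ ≤ ε := by
  rw [holAlg, ← SetLike.mem_coe, Subalgebra.topologicalClosure_coe, Metric.mem_closure_iff]
  constructor
  · intro H ε hε
    obtain ⟨_, ⟨P, hP, rfl⟩, hd⟩ := H ε hε
    refine ⟨P, hP, fun x => ?_⟩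
    have := (ContinuousMap.dist_apply_le_dist (f := h) (g := _) x).trans hd.le
    rwa [dist_eq_norm] at this
  · intro H ε hε
    obtain ⟨P, hP, hd⟩ := H (ε / 2) (by positivity)
    refine ⟨_, ⟨P, hP, rfl⟩, ?_⟩
    refine lt_of_le_of_lt ((ContinuousMap.dist_le (by positivity)).2 (fun x => ?_))
      (half_lt_self hε)
    rw [dist_eq_norm]
    exact hd x

theorem isClosed_holAlg (K : Set V) [CompactSpace K] : IsClosed (holAlg K : Set C(K, ℂ)) :=
  Subalgebra.isClosed_topologicalClosure _

instance (K : Set V) [CompactSpace K] : CompleteSpace (holAlg K) :=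
  (isClosed_holAlg K).completeSpace_coe

theorem polyFun_restrict_mem_holAlg {K : Set V} [CompactSpace K] {P : C(V, ℂ)}
    (hP : P ∈ polyFun V) : P.restrict K ∈ holAlg K :=
  mem_holAlg_iff.2 fun ε hε => ⟨P, hP, fun x => by simpa using hε.le⟩

theorem holAlg_induction {K : Set V} [CompactSpace K] {p : C(K, ℂ) → Prop}
    (hclm : ∀ l : V →L[ℂ] ℂ, p ⟨fun x => l x, by fun_prop⟩)
    (hconst : ∀ c : ℂ, p (algebraMap ℂ _ c))
    (hadd : ∀ f g, p f → p g → p (f + g)) (hmul : ∀ f g, p f → p g → p (f * g))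
    (hcl : IsClosed {f | p f}) {h : C(K, ℂ)} (hh : h ∈ holAlg K) : p h := by
  refine closure_minimal ?_ hcl (show h ∈ closure _ from hh)
  rintro _ ⟨P, hP, rfl⟩
  change p _
  induction hP using Algebra.adjoin_induction with
  | mem x hx => obtain ⟨l, rfl⟩ := hx; exact hclm l
  | algebraMap r => exact hconst r
  | add x y _ _ hx hy => rw [map_add]; exact hadd _ _ hx hy
  | mul x y _ _ hx hy => rw [map_mul]; exact hmul _ _ hx hy

theorem HolLim.congr {K : Set V} {f g : V → ℂ} (hf : HolLim K f) (h : ∀ x ∈ K, f x = g x) :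
    HolLim K g := by
  intro ε hε
  obtain ⟨P, hP, hd⟩ := hf ε hε
  exact ⟨P, hP, fun x hx => h x hx ▸ hd x hx⟩

theorem HolLim.mono {K K' : Set V} {g : V → ℂ} (h : HolLim K g) (hK : K' ⊆ K) : HolLim K' g :=
  fun ε hε => let ⟨P, hP, hd⟩ := h ε hε; ⟨P, hP, fun x hx => hd x (hK hx)⟩

theorem HolLim.of_approx {K : Set V} {g : V → ℂ}
    (h : ∀ ε > 0, ∃ f, HolLim K f ∧ ∀ x ∈ K, ‖g x - f x‖ ≤ ε) : HolLim K g := by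
  intro ε hε
  obtain ⟨f, hf, hd⟩ := h (ε / 2) (by positivity)
  obtain ⟨P, hP, hd'⟩ := hf (ε / 2) (by positivity)
  refine ⟨P, hP, fun x hx => ?_⟩
  have := norm_add_le (g x - f x) (f x - P x)
  rw [sub_add_sub_cancel] at this
  linarith [hd x hx, hd' x hx]

theorem holLim_of_mem_polyFun {K : Set V} {P : C(V, ℂ)} (hP : P ∈ polyFun V) : HolLim K P :=
  fun ε hε => ⟨P, hP, fun x _ => by simpa using hε.le⟩

theorem holLim_const (K : Set V) (c : ℂ) : HolLim K (fun _ => c) :=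
  holLim_of_mem_polyFun ((polyFun V).algebraMap_mem c)

theorem holLim_clm (K : Set V) (l : V →L[ℂ] ℂ) : HolLim K l :=
  holLim_of_mem_polyFun (clm_mem_polyFun l)

theorem HolLim.comp_clm {K : Set V} {K' : Set W} {g : W → ℂ} (h : HolLim K' g) (l : V →L[ℂ] W)
    (hl : Set.MapsTo l K K') : HolLim K (fun x => g (l x)) := by
  intro ε hε
  obtain ⟨P, hP, hd⟩ := h ε hε
  exact ⟨_, comp_clm_mem_polyFun hP l, fun x hx => hd _ (hl hx)⟩

theorem HolLim.continuousOn {K : Set V} {g : V → ℂ} (h : HolLim K g) : ContinuousOn g K := by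
  choose P hP hd using fun n : ℕ => h (1 / ((n : ℝ) + 1)) (by positivity)
  refine TendstoUniformlyOn.continuousOn (F := fun n x => P n x) (p := atTop) ?_
    (Frequently.of_forall fun n => (P n).continuous.continuousOn)
  rw [Metric.tendstoUniformlyOn_iff]
  intro ε hε
  have := (tendsto_one_div_add_atTop_nhds_zero_nat (𝕜 := ℝ)).eventually_lt_const hε
  filter_upwards [this] with n hn x hx
  rw [dist_eq_norm]
  exact (hd n x hx).trans_lt hn

theorem HolLim.differentiableOn {K s : Set V} {g : V → ℂ} (h : HolLim K g) (hs : IsOpen s)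
    (hsK : s ⊆ K) : DifferentiableOn ℂ g s := by
  choose P hP hd using fun n : ℕ => h (1 / ((n : ℝ) + 1)) (by positivity)
  refine TendstoUniformlyOn.differentiableOn_complex (F := fun n x => P n x) hs
    (fun n => (differentiable_of_mem_polyFun (hP n)).differentiableOn) ?_
  rw [Metric.tendstoUniformlyOn_iff]
  intro ε hε
  have := (tendsto_one_div_add_atTop_nhds_zero_nat (𝕜 := ℝ)).eventually_lt_const hε
  filter_upwards [this] with n hn x hx
  rw [dist_eq_norm]
  exact (hd n x (hsK hx)).trans_lt hn

theorem holLim_iff_exists_mem_holAlg {K : Set V} [CompactSpace K] {g : V → ℂ} :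
    HolLim K g ↔ ∃ h ∈ holAlg K, ∀ x : K, h x = g x := by
  constructor
  · intro h
    refine ⟨⟨fun x => g x, h.continuousOn.domRestrict⟩, mem_holAlg_iff.2 fun ε hε => ?_,
      fun x => rfl⟩
    obtain ⟨P, hP, hd⟩ := h ε hε
    exact ⟨P, hP, fun x => hd x x.2⟩
  · rintro ⟨h, hh, he⟩ ε hε
    obtain ⟨P, hP, hd⟩ := mem_holAlg_iff.1 hh ε hε
    exact ⟨P, hP, fun x hx => he ⟨x, hx⟩ ▸ hd ⟨x, hx⟩⟩

theorem HolLim.add {K : Set V} {f g : V → ℂ} (hf : HolLim K f) (hg : HolLim K g) :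
    HolLim K (fun x => f x + g x) := by
  intro ε hε
  obtain ⟨P, hP, hd⟩ := hf (ε / 2) (by positivity)
  obtain ⟨Q, hQ, hd'⟩ := hg (ε / 2) (by positivity)
  refine ⟨P + Q, add_mem hP hQ, fun x hx => ?_⟩
  have := norm_add_le (f x - P x) (g x - Q x)
  rw [sub_add_sub_comm] at this
  rw [ContinuousMap.add_apply]
  linarith [hd x hx, hd' x hx]

theorem HolLim.mul {K : Set V} (hK : IsCompact K) {f g : V → ℂ} (hf : HolLim K f)
    (hg : HolLim K g) : HolLim K (fun x => f x * g x) := by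
  have := isCompact_iff_compactSpace.1 hK
  rw [holLim_iff_exists_mem_holAlg] at *
  obtain ⟨h, hh, he⟩ := hf
  obtain ⟨h', hh', he'⟩ := hg
  exact ⟨h * h', mul_mem hh hh', fun x => by simp [he, he']⟩

theorem HolLim.const_mul {K : Set V} {f : V → ℂ} (hf : HolLim K f) (c : ℂ) :
    HolLim K (fun x => c * f x) := by
  intro ε hε
  obtain ⟨P, hP, hd⟩ := hf (ε / (‖c‖ + 1)) (by positivity)
  refine ⟨c • P, Subalgebra.smul_mem _ hP c, fun x hx => ?_⟩
  rw [ContinuousMap.smul_apply, smul_eq_mul, ← mul_sub, norm_mul]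
  calc ‖c‖ * ‖f x - P x‖ ≤ (‖c‖ + 1) * (ε / (‖c‖ + 1)) := by
        gcongr
        · linarith
        · exact hd x hx
    _ = ε := by field_simp

theorem HolLim.sum {K : Set V} {ι : Type*} (s : Finset ι) {f : ι → V → ℂ}
    (hf : ∀ i ∈ s, HolLim K (f i)) : HolLim K (fun x => ∑ i ∈ s, f i x) := by
  classical
  induction s using Finset.induction_on with
  | empty => simpa using holLim_const K 0
  | insert a s ha ih =>
    simp only [Finset.sum_insert ha]
    exact (hf a (by simp)).add (ih fun i hi => hf i (by simp [hi]))

theorem HolLim.pow {K : Set V} (hK : IsCompact K) {f : V → ℂ} (hf : HolLim K f) (n : ℕ) :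
    HolLim K (fun x => f x ^ n) := by
  induction n with
  | zero => simpa using holLim_const K 1
  | succ n ih => simpa only [pow_succ] using ih.mul hK hf

end HolLim

section Approximation
variable {V : Type*} [NormedAddCommGroup V] [NormedSpace ℂ V]

/-- Families of bounded holomorphic functions on a disc whose members depend on the parameter as
uniform limits of polynomials. -/
structure PolyFamily (K : Set V) (r M : ℝ) (f : V → ℂ → ℂ) : Prop where
  holLim : ∀ t ∈ Metric.ball (0 : ℂ) r, HolLim K (fun x => f x t)
  diff : ∀ x ∈ K, DifferentiableOn ℂ (f x) (Metric.ball 0 r)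
  bound : ∀ x ∈ K, ∀ t ∈ Metric.ball (0 : ℂ) r, ‖f x t‖ ≤ M

theorem norm_dslope_le_of_norm_le {f : ℂ → ℂ} {r M : ℝ} (hr : 0 < r)
    (hf : DifferentiableOn ℂ f (Metric.ball 0 r)) (hM : ∀ t ∈ Metric.ball (0 : ℂ) r, ‖f t‖ ≤ M)
    {t : ℂ} (ht : t ∈ Metric.ball (0 : ℂ) r) : ‖dslope f 0 t‖ ≤ 2 * M / r := by
  refine Complex.norm_dslope_le_div_of_mapsTo_ball hf (fun s hs => ?_) ht
  rw [Metric.mem_closedBall, dist_eq_norm]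
  refine (norm_sub_le _ _).trans ?_
  linarith [hM s hs, hM 0 (Metric.mem_ball_self hr)]

theorem PolyFamily.dslope {K : Set V} {r M : ℝ} {f : V → ℂ → ℂ} (hr : 0 < r)
    (h : PolyFamily K r M f) : PolyFamily K r (2 * M / r) (fun x t => dslope (f x) 0 t) := by
  have hd : ∀ x ∈ K, DifferentiableOn ℂ (_root_.dslope (f x) 0) (Metric.ball 0 r) := fun x hx =>
    (Complex.differentiableOn_dslope (Metric.ball_mem_nhds _ hr)).2 (h.diff x hx)
  have hb : ∀ x ∈ K, ∀ t ∈ Metric.ball (0 : ℂ) r, ‖_root_.dslope (f x) 0 t‖ ≤ 2 * M / r :=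
    fun x hx t ht => norm_dslope_le_of_norm_le hr (h.diff x hx) (h.bound x hx) ht
  have hne : ∀ t ∈ Metric.ball (0 : ℂ) r, t ≠ 0 → HolLim K (fun x => _root_.dslope (f x) 0 t) := by
    intro t ht ht0
    refine (((h.holLim t ht).add
      ((h.holLim 0 (Metric.mem_ball_self hr)).const_mul (-1))).const_mul t⁻¹).congr ?_
    intro x hx
    rw [dslope_of_ne _ ht0, slope_def_module, smul_eq_mul, sub_zero]
    ring
  refine ⟨fun t ht => ?_, hd, hb⟩
  by_cases ht0 : t = 0
  · subst ht0
    refine HolLim.of_approx fun ε hε => ?_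
    obtain ⟨C, hC0, hC⟩ : ∃ C : ℝ, 0 < C ∧ 2 * (2 * M / r) / r ≤ C :=
      ⟨max 1 _, by positivity, le_max_right _ _⟩
    set δ : ℝ := min (r / 2) (ε / C) with hδ
    have hδ0 : 0 < δ := by positivity
    have hδr : (δ : ℂ) ∈ Metric.ball (0 : ℂ) r := by
      rw [mem_ball_zero_iff, Complex.norm_real, Real.norm_of_nonneg hδ0.le]
      have := min_le_left (r / 2) (ε / C)
      linarith
    refine ⟨_, hne δ hδr (by exact_mod_cast hδ0.ne'), fun x hx => ?_⟩
    rw [norm_sub_rev, ← sub_smul_dslope (_root_.dslope (f x) 0), sub_zero, norm_smul,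
      Complex.norm_real, Real.norm_of_nonneg hδ0.le]
    calc δ * _ ≤ (ε / C) * C := by
          gcongr
          · exact min_le_right _ _
          · exact (norm_dslope_le_of_norm_le hr (hd x hx) (hb x hx) hδr).trans hC
      _ = ε := by field_simp
  · exact hne t ht ht0

theorem PolyFamily.iterate_dslope {K : Set V} {r M : ℝ} {f : V → ℂ → ℂ} (hr : 0 < r)
    (h : PolyFamily K r M f) (n : ℕ) :
    PolyFamily K r (M * (2 / r) ^ n) (fun x => (fun g : ℂ → ℂ => _root_.dslope g 0)^[n] (f x)) := by
  induction n with
  | zero => simpa using h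
  | succ n ih =>
    simp only [Function.iterate_succ_apply']
    have := ih.dslope hr
    rwa [show 2 * (M * (2 / r) ^ n) / r = M * (2 / r) ^ (n + 1) by rw [pow_succ]; ring] at this

theorem eq_sum_iterate_dslope (f : ℂ → ℂ) (n : ℕ) (t : ℂ) :
    f t = ∑ m ∈ Finset.range n, t ^ m * ((fun g : ℂ → ℂ => dslope g 0)^[m] f) 0 +
      t ^ n * ((fun g : ℂ → ℂ => dslope g 0)^[n] f) t := by
  induction n with
  | zero => simp
  | succ n ih =>
    rw [Finset.sum_range_succ, Function.iterate_succ_apply', pow_succ, mul_assoc, add_assoc,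
      ← mul_add]
    have := sub_smul_dslope ((fun g : ℂ → ℂ => dslope g 0)^[n] f) 0 t
    rw [sub_zero, smul_eq_mul] at this
    rw [this, add_sub_cancel]
    exact ih

theorem PolyFamily.holLim_uncurry {K : Set V} (hK : IsCompact K) {r M : ℝ} {f : V → ℂ → ℂ}
    (hr : 0 < r) (h : PolyFamily K r M f) :
    HolLim (K ×ˢ Metric.closedBall (0 : ℂ) (r / 4)) (fun p : V × ℂ => f p.1 p.2) := by
  have hK' : IsCompact (K ×ˢ Metric.closedBall (0 : ℂ) (r / 4)) :=
    hK.prod (isCompact_closedBall _ _)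
  refine HolLim.of_approx fun ε hε => ?_
  obtain ⟨N, hN⟩ : ∃ N : ℕ, M * (1 / 2) ^ N ≤ ε := by
    have : Tendsto (fun N : ℕ => M * (1 / 2 : ℝ) ^ N) atTop (𝓝 (M * 0)) :=
      (tendsto_pow_atTop_nhds_zero_of_lt_one (by norm_num) (by norm_num)).const_mul M
    rw [mul_zero] at this
    exact (this.eventually_le_const hε).exists
  refine ⟨fun p => ∑ m ∈ Finset.range N, p.2 ^ m *
    ((fun g : ℂ → ℂ => _root_.dslope g 0)^[m] (f p.1)) 0, HolLim.sum _ fun m _ => ?_, ?_⟩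
  · refine HolLim.mul hK' ((holLim_clm _ (ContinuousLinearMap.snd ℂ V ℂ)).pow hK' m) ?_
    exact ((h.iterate_dslope hr m).holLim 0 (Metric.mem_ball_self hr)).comp_clm
      (ContinuousLinearMap.fst ℂ V ℂ) (fun p hp => hp.1)
  · rintro ⟨x, t⟩ ⟨hx, ht⟩
    have ht' : ‖t‖ ≤ r / 4 := by simpa using ht
    have htr : t ∈ Metric.ball (0 : ℂ) r := by
      rw [mem_ball_zero_iff]; linarith
    simp only
    rw [eq_sum_iterate_dslope (f x) N t, add_sub_cancel_left, norm_mul, norm_pow]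
    calc _ ≤ (r / 4) ^ N * (M * (2 / r) ^ N) := by
          gcongr
          exact (h.iterate_dslope hr N).bound x hx t htr
      _ = M * (1 / 2) ^ N := by
          rw [mul_left_comm, ← mul_pow]
          congr 2
          field_simp
          norm_num
      _ ≤ ε := hN

/-- Functions holomorphic on a ball are uniform limits of polynomials on a smaller ball. -/
def HasPolyApprox (V : Type*) [NormedAddCommGroup V] [NormedSpace ℂ V] : Prop :=
  ∀ R > 0, ∃ ρ > 0, ∀ f : V → ℂ, DifferentiableOn ℂ f (Metric.ball 0 R) →
    HolLim (Metric.closedBall 0 ρ) f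

theorem HasPolyApprox.of_equiv {W : Type*} [NormedAddCommGroup W] [NormedSpace ℂ W]
    (e : V ≃L[ℂ] W) (h : HasPolyApprox V) : HasPolyApprox W := by
  intro R hR
  obtain ⟨R', hR', hsub⟩ := Metric.mem_nhds_iff.1
    ((e.continuous.tendsto 0).eventually (by rw [map_zero]; exact Metric.ball_mem_nhds _ hR))
  obtain ⟨ρ, hρ, H⟩ := h R' hR'
  obtain ⟨ρ', hρ', hsub'⟩ := Metric.nhds_basis_closedBall.mem_iff.1
    ((e.symm.continuous.tendsto 0).eventually
      (by rw [map_zero]; exact Metric.closedBall_mem_nhds _ hρ))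
  refine ⟨ρ', hρ', fun f hf => ?_⟩
  have := (H (fun x => f (e x)) (hf.comp e.differentiable.differentiableOn hsub)).comp_clm
    (e.symm : W →L[ℂ] V) hsub'
  simpa using this

theorem HasPolyApprox.prod [ProperSpace V] (h : HasPolyApprox V) : HasPolyApprox (V × ℂ) := by
  intro R hR
  obtain ⟨ρ₁, hρ₁, H⟩ := h R hR
  set ρ := min ρ₁ (R / 2) with hρ
  have hρ0 : 0 < ρ := by positivity
  have hρR : ρ ≤ R / 2 := min_le_right _ _
  refine ⟨min ρ (R / 8), by positivity, fun f hf => ?_⟩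
  have hsub : ∀ x ∈ Metric.closedBall (0 : V) ρ, ∀ t ∈ Metric.closedBall (0 : ℂ) (R / 2),
      (x, t) ∈ Metric.ball (0 : V × ℂ) R := by
    intro x hx t ht
    rw [mem_closedBall_zero_iff] at hx ht
    rw [mem_ball_zero_iff, Prod.norm_def]
    exact max_lt (by simp only; linarith) (by simp only; linarith)
  have hK : IsCompact (Metric.closedBall (0 : V) ρ ×ˢ Metric.closedBall (0 : ℂ) (R / 2)) :=
    (isCompact_closedBall _ _).prod (isCompact_closedBall _ _)
  obtain ⟨M, hM⟩ := hK.exists_bound_of_continuousOn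
    (hf.continuousOn.mono fun p hp => hsub p.1 hp.1 p.2 hp.2)
  have hM0 : 0 ≤ M := (norm_nonneg _).trans
    (hM 0 ⟨Metric.mem_closedBall_self hρ0.le, Metric.mem_closedBall_self (by positivity)⟩)
  have hfam : PolyFamily (Metric.closedBall (0 : V) ρ) (R / 2) M (fun x t => f (x, t)) := by
    refine ⟨fun t ht => ?_, fun x hx => ?_, fun x hx t ht =>
      hM (x, t) ⟨hx, Metric.ball_subset_closedBall ht⟩⟩
    · refine (H _ (hf.comp (by fun_prop) fun x hx => ?_)).mono
        (Metric.closedBall_subset_closedBall (min_le_left _ _))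
      rw [mem_ball_zero_iff] at *
      rw [Prod.norm_def]
      exact max_lt hx (by simp only; linarith)
    · exact hf.comp (by fun_prop) fun t ht => hsub x hx t (Metric.ball_subset_closedBall ht)
  refine (hfam.holLim_uncurry (isCompact_closedBall _ _) (by positivity)).mono ?_
  rintro ⟨x, t⟩ hp
  rw [mem_closedBall_zero_iff, Prod.norm_def] at hp
  have h1 := (le_max_left _ _).trans hp
  have h2 := (le_max_right _ _).trans hp
  refine ⟨mem_closedBall_zero_iff.2 (h1.trans (min_le_left _ _)), mem_closedBall_zero_iff.2 ?_⟩
  have := h2.trans (min_le_right _ _)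
  simp only at this
  linarith

theorem hasPolyApprox_pi (n : ℕ) : HasPolyApprox (Fin n → ℂ) := by
  induction n with
  | zero =>
    exact fun R hR => ⟨R, hR, fun f hf => (holLim_const _ (f 0)).congr
      fun x _ => by rw [Subsingleton.elim x 0]⟩
  | succ n ih =>
    exact ih.prod.of_equiv (ContinuousLinearEquiv.ofFinrankEq (by simp))

theorem hasPolyApprox (V : Type*) [NormedAddCommGroup V] [NormedSpace ℂ V]
    [FiniteDimensional ℂ V] : HasPolyApprox V :=
  (hasPolyApprox_pi (Module.finrank ℂ V)).of_equiv (ContinuousLinearEquiv.ofFinrankEq (by simp))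

end Approximation

section Division
variable {E : Type*} [NormedAddCommGroup E] [NormedSpace ℂ E] [ProperSpace E]

/-- The closed polydisc of radii `ρ` and `r` in `E × ℂ`. -/
def polydisc (E : Type*) [NormedAddCommGroup E] (ρ r : ℝ) : Set (E × ℂ) :=
  Metric.closedBall 0 ρ ×ˢ Metric.closedBall 0 r

omit [NormedSpace ℂ E] in
theorem isCompact_polydisc (ρ r : ℝ) : IsCompact (polydisc E ρ r) :=
  (isCompact_closedBall _ _).prod (isCompact_closedBall _ _)

instance (ρ r : ℝ) : CompactSpace (polydisc E ρ r) :=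
  isCompact_iff_compactSpace.1 (isCompact_polydisc ρ r)

variable {ρ r : ℝ}

theorem holAlg_norm_le (hr : 0 < r) {h : C(polydisc E ρ r, ℂ)} (hh : h ∈ holAlg (polydisc E ρ r))
    {C : ℝ} (hC0 : 0 ≤ C) (hC : ∀ z : polydisc E ρ r, ‖z.1.2‖ = r → ‖h z‖ ≤ C) : ‖h‖ ≤ C := by
  refine le_of_forall_pos_le_add fun ε hε => ?_
  obtain ⟨P, hP, hd⟩ := mem_holAlg_iff.1 hh (ε / 2) (by positivity)
  refine (ContinuousMap.norm_le _ (by positivity)).2 ?_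
  rintro ⟨⟨x, t⟩, hx, ht⟩
  have hPd := differentiable_of_mem_polyFun hP
  have key : ‖P (x, t)‖ ≤ C + ε / 2 := by
    refine Complex.norm_le_of_forall_mem_frontier_norm_le (f := fun s : ℂ => P (x, s))
      (U := Metric.ball 0 r) Metric.isBounded_ball ?_ ?_ ?_
    · exact (hPd.comp (by fun_prop)).diffContOnCl
    · intro s hs
      rw [frontier_ball _ hr.ne', mem_sphere_zero_iff_norm] at hs
      have hz : (x, s) ∈ polydisc E ρ r := ⟨hx, mem_closedBall_zero_iff.2 hs.le⟩
      have h1 := hC ⟨(x, s), hz⟩ hs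
      have h2 := hd ⟨(x, s), hz⟩
      have := norm_sub_norm_le (P (x, s)) (h ⟨(x, s), hz⟩)
      rw [norm_sub_rev] at this
      simp only at *
      linarith
    · rw [closure_ball _ hr.ne']
      exact ht
  have h2 := hd ⟨(x, t), hx, ht⟩
  have := norm_sub_norm_le (h ⟨(x, t), hx, ht⟩) (P (x, t))
  simp only at *
  linarith

/-- The last coordinate on a polydisc. -/
def sndMap (E : Type*) [NormedAddCommGroup E] (ρ r : ℝ) : C(polydisc E ρ r, ℂ) :=
  ⟨fun z => z.1.2, by fun_prop⟩

theorem sndMap_mem : sndMap E ρ r ∈ holAlg (polydisc E ρ r) :=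
  polyFun_restrict_mem_holAlg (clm_mem_polyFun (ContinuousLinearMap.snd ℂ E ℂ))

omit [NormedSpace ℂ E] [ProperSpace E] in
theorem zero_section_mem (z : polydisc E ρ r) : (z.1.1, (0 : ℂ)) ∈ polydisc E ρ r := by
  refine ⟨z.2.1, ?_⟩
  have := z.2.2
  rw [mem_closedBall_zero_iff] at this ⊢
  simpa using (norm_nonneg _).trans this

/-- The projection of a polydisc on the hyperplane where the last coordinate vanishes. -/
def zeroSection (E : Type*) [NormedAddCommGroup E] [NormedSpace ℂ E] [ProperSpace E] (ρ r : ℝ) :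
    C(polydisc E ρ r, polydisc E ρ r) :=
  ⟨fun z => ⟨(z.1.1, 0), zero_section_mem z⟩, by fun_prop⟩

theorem comp_zeroSection_mem {h : C(polydisc E ρ r, ℂ)} (hh : h ∈ holAlg (polydisc E ρ r)) :
    h.comp (zeroSection E ρ r) ∈ holAlg (polydisc E ρ r) := by
  refine mem_holAlg_iff.2 fun ε hε => ?_
  obtain ⟨P, hP, hd⟩ := mem_holAlg_iff.1 hh ε hε
  refine ⟨_, comp_clm_mem_polyFun hP
    ((ContinuousLinearMap.fst ℂ E ℂ).prod (0 : E × ℂ →L[ℂ] ℂ)), fun z => ?_⟩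
  exact hd (zeroSection E ρ r z)

theorem norm_le_norm_sndMap_mul (hr : 0 < r) {g : C(polydisc E ρ r, ℂ)}
    (hg : g ∈ holAlg (polydisc E ρ r)) : ‖g‖ ≤ r⁻¹ * ‖sndMap E ρ r * g‖ := by
  refine holAlg_norm_le hr hg (by positivity) fun z hz => ?_
  have := (sndMap E ρ r * g).norm_coe_le_norm z
  rw [ContinuousMap.mul_apply, norm_mul] at this
  change ‖z.1.2‖ * _ ≤ _ at this
  rw [hz] at this
  rw [inv_mul_eq_div, le_div_iff₀ hr]
  linarith

theorem exists_sndMap_mul (hr : 0 < r) {h : C(polydisc E ρ r, ℂ)}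
    (hh : h ∈ holAlg (polydisc E ρ r)) : ∃ g ∈ holAlg (polydisc E ρ r),
      h - h.comp (zeroSection E ρ r) = sndMap E ρ r * g := by
  have hcl : IsClosed (Set.range fun g : holAlg (polydisc E ρ r) =>
      sndMap E ρ r * (g : C(polydisc E ρ r, ℂ))) := by
    refine AntilipschitzWith.isClosed_range (K := ⟨r⁻¹, by positivity⟩) ?_ ?_
    · refine AntilipschitzWith.of_le_mul_dist fun g g' => ?_
      rw [dist_eq_norm, dist_eq_norm, ← mul_sub]
      exact norm_le_norm_sndMap_mul hr (g - g').2
    · exact ((LinearMap.mulLeft ℂ (sndMap E ρ r)).mkContinuous ‖sndMap E ρ r‖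
        (fun x => norm_mul_le _ _)).uniformContinuous.comp uniformContinuous_subtype_val
  have key : h ∈ holAlg (polydisc E ρ r) ∧ h - h.comp (zeroSection E ρ r) ∈
      Set.range fun g : holAlg (polydisc E ρ r) => sndMap E ρ r * (g : C(polydisc E ρ r, ℂ)) := by
    refine holAlg_induction (p := fun h => h ∈ holAlg (polydisc E ρ r) ∧
      h - h.comp (zeroSection E ρ r) ∈
      Set.range fun g : holAlg (polydisc E ρ r) => sndMap E ρ r * (g : C(polydisc E ρ r, ℂ)))
      ?_ ?_ ?_ ?_ ?_ hh
    · intro l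
      refine ⟨polyFun_restrict_mem_holAlg (clm_mem_polyFun l), algebraMap ℂ _ (l (0, 1)), ?_⟩
      ext z
      change z.1.2 * l (0, 1) = l z.1 - l (z.1.1, 0)
      rw [← map_sub, ← smul_eq_mul, ← map_smul]
      congr 1
      ext <;> simp
    · intro c
      refine ⟨Subalgebra.algebraMap_mem _ c, 0, ?_⟩
      ext z
      simp
    · rintro f g ⟨hf, f', hf'⟩ ⟨hg, g', hg'⟩
      refine ⟨add_mem hf hg, f' + g', ?_⟩
      simp only at hf' hg' ⊢
      rw [Subalgebra.coe_add, mul_add, hf', hg', ContinuousMap.add_comp]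
      ring
    · rintro f g ⟨hf, f', hf'⟩ ⟨hg, g', hg'⟩
      refine ⟨mul_mem hf hg, f' * ⟨g, hg⟩ + ⟨_, comp_zeroSection_mem hf⟩ * g', ?_⟩
      simp only [Subalgebra.coe_add, Subalgebra.coe_mul] at hf' hg' ⊢
      rw [mul_add, ← mul_assoc, hf', mul_left_comm, hg', ContinuousMap.mul_comp]
      ring
    · refine (isClosed_holAlg _).inter (hcl.preimage ?_)
      exact continuous_id.sub (ContinuousMap.continuous_precomp _)
  obtain ⟨g, hg⟩ := key.2
  exact ⟨g, g.2, hg.symm⟩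

/-- The operator `h ↦ (h(x, t) - h(x, 0)) / t`. -/
theorem exists_shift (E : Type*) [NormedAddCommGroup E] [NormedSpace ℂ E] [ProperSpace E]
    (ρ : ℝ) {r : ℝ} (hr : 0 < r) :
    ∃ Θ : holAlg (polydisc E ρ r) →L[ℂ] holAlg (polydisc E ρ r), ‖Θ‖ ≤ 2 / r ∧
      (∀ h : holAlg (polydisc E ρ r), (h : C(polydisc E ρ r, ℂ)) =
        sndMap E ρ r * (Θ h : C(polydisc E ρ r, ℂ)) +
          (h : C(polydisc E ρ r, ℂ)).comp (zeroSection E ρ r)) ∧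
      ∀ h : holAlg (polydisc E ρ r), Θ (⟨_, sndMap_mem⟩ * h) = h := by
  choose g hg hgeq using fun h : holAlg (polydisc E ρ r) => exists_sndMap_mul hr h.2
  have huniq : ∀ a b : holAlg (polydisc E ρ r), sndMap E ρ r * (a : C(_, ℂ)) =
      sndMap E ρ r * (b : C(_, ℂ)) → a = b := by
    intro a b hab
    have := norm_le_norm_sndMap_mul hr (a - b).2
    rw [Subalgebra.coe_sub, mul_sub, hab, sub_self, norm_zero, mul_zero] at this
    exact Subtype.ext (sub_eq_zero.1 (norm_le_zero_iff.1 this))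
  let Θ₀ : holAlg (polydisc E ρ r) →ₗ[ℂ] holAlg (polydisc E ρ r) :=
    { toFun := fun h => ⟨g h, hg h⟩
      map_add' := fun a b => huniq _ _ (by
        change _ * g (a + b) = _ * (g a + g b)
        rw [mul_add, ← hgeq, ← hgeq, ← hgeq, Subalgebra.coe_add, ContinuousMap.add_comp]
        ring)
      map_smul' := fun c a => huniq _ _ (by
        change _ * g (c • a) = _ * (c • g a)
        rw [mul_smul_comm, ← hgeq, ← hgeq, Subalgebra.coe_smul, ContinuousMap.smul_comp,
          smul_sub]) }
  refine ⟨Θ₀.mkContinuous (2 / r) fun h => ?_, LinearMap.mkContinuous_norm_le _ (by positivity) _,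
    fun h => ?_, fun h => ?_⟩
  · have h1 := norm_le_norm_sndMap_mul hr (hg h)
    rw [← hgeq] at h1
    have h2 : ‖(h : C(polydisc E ρ r, ℂ)).comp (zeroSection E ρ r)‖ ≤
        ‖(h : C(polydisc E ρ r, ℂ))‖ :=
      (ContinuousMap.norm_le _ (norm_nonneg _)).2 fun z =>
        (h : C(polydisc E ρ r, ℂ)).norm_coe_le_norm _
    have h3 := norm_sub_le (h : C(polydisc E ρ r, ℂ))
      ((h : C(polydisc E ρ r, ℂ)).comp (zeroSection E ρ r))
    change ‖g h‖ ≤ 2 / r * ‖(h : C(polydisc E ρ r, ℂ))‖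
    refine h1.trans ?_
    rw [div_mul_eq_mul_div, inv_mul_eq_div]
    gcongr
    linarith
  · change _ = _ * g h + _
    rw [← hgeq]
    ring
  · refine huniq _ _ ?_
    change _ * g _ = _
    rw [← hgeq]
    ext z
    simp [sndMap, zeroSection]

theorem shift_iterate {Θ : holAlg (polydisc E ρ r) →L[ℂ] holAlg (polydisc E ρ r)}
    (hΘ : ∀ h : holAlg (polydisc E ρ r), (h : C(polydisc E ρ r, ℂ)) =
        sndMap E ρ r * (Θ h : C(polydisc E ρ r, ℂ)) +
          (h : C(polydisc E ρ r, ℂ)).comp (zeroSection E ρ r)) (N : ℕ)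
    (h : holAlg (polydisc E ρ r)) : (h : C(polydisc E ρ r, ℂ)) =
      sndMap E ρ r ^ N * ((Θ ^ N) h : C(polydisc E ρ r, ℂ)) +
      ∑ m ∈ Finset.range N, sndMap E ρ r ^ m *
        (((Θ ^ m) h : holAlg (polydisc E ρ r)) : C(polydisc E ρ r, ℂ)).comp (zeroSection E ρ r) := by
  induction N with
  | zero => simp
  | succ N ih =>
    rw [Finset.sum_range_succ]
    nth_rewrite 1 [ih]
    nth_rewrite 1 [hΘ ((Θ ^ N) h)]
    rw [pow_succ' Θ, mul_apply_eq_comp]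
    ring

omit [ProperSpace E] in
theorem exists_add_eq_of_norm_lt_one [CompleteSpace E] {T : E →L[ℂ] E} (hT : ‖T‖ < 1) (y : E) :
    ∃ x, x + T x = y := by
  have hunit : IsUnit (1 - (-T)) := isUnit_one_sub_of_norm_lt_one (by rwa [norm_neg])
  obtain ⟨S, hS⟩ := hunit.exists_right_inv
  refine ⟨S y, ?_⟩
  have := DFunLike.congr_fun hS y
  simpa using this

theorem exists_division (ρ : ℝ) (hr : 0 < r) (N : ℕ) {κ : ℝ} (hκ : κ < 1)
    {D : C(polydisc E ρ r, ℂ)} (hD : D ∈ holAlg (polydisc E ρ r))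
    (hDκ : ‖D - sndMap E ρ r ^ N‖ * (2 / r) ^ N ≤ κ) {g : C(polydisc E ρ r, ℂ)}
    (hg : g ∈ holAlg (polydisc E ρ r)) :
    ∃ q ∈ holAlg (polydisc E ρ r), ∃ c : ℕ → C(polydisc E ρ r, ℂ),
      (∀ s, c s ∈ holAlg (polydisc E ρ r)) ∧
      g = q * D + ∑ m ∈ Finset.range N, sndMap E ρ r ^ m * (c m).comp (zeroSection E ρ r) ∧
      (g = sndMap E ρ r ^ N → ‖q - 1‖ ≤ κ / (1 - κ)) := by
  obtain ⟨Θ, hΘn, hΘ, hΘt⟩ := exists_shift E ρ hr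
  let t : holAlg (polydisc E ρ r) := ⟨_, sndMap_mem⟩
  let D' : holAlg (polydisc E ρ r) := ⟨D, hD⟩
  let g' : holAlg (polydisc E ρ r) := ⟨g, hg⟩
  have hΘN : ∀ (n : ℕ) (h : holAlg (polydisc E ρ r)), (Θ ^ n) (t ^ n * h) = h := by
    intro n
    induction n with
    | zero => simp
    | succ n ih =>
      intro h
      rw [pow_succ Θ, mul_apply_eq_comp, pow_succ', mul_assoc, hΘt, ih]
  let T : holAlg (polydisc E ρ r) →L[ℂ] holAlg (polydisc E ρ r) :=
    (Θ ^ N).comp (ContinuousLinearMap.mul ℂ (holAlg (polydisc E ρ r)) (D' - t ^ N))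
  have hT : ‖T‖ ≤ κ := by
    refine (ContinuousLinearMap.opNorm_comp_le _ _).trans (le_trans ?_ hDκ)
    rw [mul_comm]
    gcongr
    · exact ContinuousLinearMap.opNorm_mul_apply_le ℂ (holAlg (polydisc E ρ r)) _
    · rcases N.eq_zero_or_pos with rfl | hN
      · rw [pow_zero, pow_zero]; exact ContinuousLinearMap.norm_id_le
      · exact (norm_pow_le' _ hN).trans (by gcongr)
  have hκ0 : 0 ≤ κ := (norm_nonneg T).trans hT
  obtain ⟨q, hqT⟩ := exists_add_eq_of_norm_lt_one (hT.trans_lt hκ) ((Θ ^ N) g')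
  have hqD : (Θ ^ N) (D' * q) = q + T q := by
    change _ = q + (Θ ^ N) ((D' - t ^ N) * q)
    nth_rewrite 2 [← hΘN N q]
    rw [← map_add]
    congr 1
    ring
  have hz : (Θ ^ N) (g' - q * D') = 0 := by
    rw [map_sub, mul_comm q, hqD, hqT, sub_self]
  refine ⟨q, q.2, fun m => ((Θ ^ m) (g' - q * D') : holAlg (polydisc E ρ r)),
    fun s => Subtype.prop _, ?_, ?_⟩
  · have := shift_iterate hΘ N (g' - q * D')
    rw [hz] at this
    simp only [Subalgebra.coe_zero, mul_zero, zero_add] at this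
    rw [← this]
    simp [g', D']
  · intro hgt
    have h1 : (Θ ^ N) g' = 1 := by
      have := hΘN N 1
      rw [mul_one] at this
      rw [← this]
      congr 1
      exact Subtype.ext hgt
    have h2 : q - 1 = - T q := by rw [← h1, ← hqT]; abel
    have h3 : ‖q - 1‖ ≤ κ * ‖q‖ := by
      rw [h2, norm_neg]
      exact (T.le_opNorm q).trans (by gcongr)
    have h4 : ‖q‖ ≤ 1 + ‖q - 1‖ := by
      have h5 := norm_add_le (1 : holAlg (polydisc E ρ r)) (q - 1)
      rw [add_sub_cancel] at h5
      have h6 : ‖(1 : holAlg (polydisc E ρ r))‖ ≤ 1 := by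
        change ‖(1 : C(polydisc E ρ r, ℂ))‖ ≤ 1
        exact (ContinuousMap.norm_le _ zero_le_one).2 fun z => by simp
      linarith
    change ‖q - 1‖ ≤ _
    rw [le_div_iff₀ (by linarith)]
    nlinarith

end Division

section Uniqueness

theorem Polynomial.dvd_of_eq_mul_on_ball {r : ℝ} {h : ℂ → ℂ}
    (hh : ContinuousOn h (Metric.ball 0 r)) (n : ℕ) :
    ∀ (S W : Polynomial ℂ), W.natDegree = n → W ≠ 0 → (∀ t, W.eval t = 0 → ‖t‖ < r) →
    (∀ t ∈ Metric.ball (0 : ℂ) r, S.eval t = W.eval t * h t) → W ∣ S := by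
  induction n with
  | zero =>
    intro S W hn hW _ _
    rw [Polynomial.eq_C_of_natDegree_eq_zero hn] at hW ⊢
    refine (Polynomial.isUnit_C.2 (isUnit_iff_ne_zero.2 fun h0 => hW ?_)).dvd
    rw [h0, Polynomial.C_0]
  | succ n ih =>
    intro S W hn hW hroot heq
    obtain ⟨α, hα⟩ := IsAlgClosed.exists_root W (by
      rw [Polynomial.degree_eq_natDegree hW, hn]
      exact_mod_cast Nat.succ_ne_zero n)
    have hαr := hroot α hα
    have hαb : α ∈ Metric.ball (0 : ℂ) r := mem_ball_zero_iff.2 hαr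
    obtain ⟨W', rfl⟩ := Polynomial.dvd_iff_isRoot.2 hα
    have hSα : S.IsRoot α := by
      have h1 := heq α hαb
      rwa [hα.eq_zero, zero_mul] at h1
    obtain ⟨S', rfl⟩ := Polynomial.dvd_iff_isRoot.2 hSα
    have hW' : W' ≠ 0 := right_ne_zero_of_mul hW
    refine mul_dvd_mul_left _ (ih S' W' ?_ hW' (fun t ht => hroot t (by simp [ht])) ?_)
    · rw [Polynomial.natDegree_mul (Polynomial.X_sub_C_ne_zero α) hW',
        Polynomial.natDegree_X_sub_C] at hn
      omega
    · have hne : ∀ t ∈ Metric.ball (0 : ℂ) r, t ≠ α → S'.eval t = W'.eval t * h t := by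
        intro t ht htα
        have := heq t ht
        simp only [Polynomial.eval_mul, Polynomial.eval_sub, Polynomial.eval_X,
          Polynomial.eval_C, mul_assoc] at this
        exact mul_left_cancel₀ (sub_ne_zero.2 htα) this
      intro t ht
      by_cases htα : t = α
      · subst htα
        have hnhds := Metric.isOpen_ball.mem_nhds ht
        have h1 : Tendsto (fun s => S'.eval s) (𝓝[≠] t) (𝓝 (S'.eval t)) :=
          S'.continuous.continuousAt.tendsto.mono_left nhdsWithin_le_nhds
        have h2 : Tendsto (fun s => W'.eval s * h s) (𝓝[≠] t) (𝓝 (W'.eval t * h t)) :=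
          ((W'.continuous.continuousAt.mul (hh.continuousAt hnhds)).tendsto).mono_left
            nhdsWithin_le_nhds
        refine tendsto_nhds_unique h1 (h2.congr' ?_)
        filter_upwards [self_mem_nhdsWithin, nhdsWithin_le_nhds hnhds] with s hs hsb
        exact (hne s hsb hs).symm
      · exact hne t ht htα

/-- The monic polynomial of degree `p` with lower coefficients `a`. -/
noncomputable def monicPoly {R : Type*} [CommRing R] {p : ℕ} (a : Fin p → R) : Polynomial R :=
  Polynomial.X ^ p + ∑ s, Polynomial.C (a s) * Polynomial.X ^ (s : ℕ)

theorem degree_lower_lt {R : Type*} [CommRing R] {p : ℕ} (a : Fin p → R) :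
    (∑ s, Polynomial.C (a s) * Polynomial.X ^ (s : ℕ)).degree < (p : WithBot ℕ) :=
  Polynomial.degree_sum_fin_lt a

theorem monic_monicPoly {R : Type*} [CommRing R] {p : ℕ} (a : Fin p → R) :
    (monicPoly a).Monic := Polynomial.monic_X_pow_add (degree_lower_lt a)

theorem natDegree_monicPoly {R : Type*} [CommRing R] [Nontrivial R] {p : ℕ} (a : Fin p → R) :
    (monicPoly a).natDegree = p := by
  rw [monicPoly, Polynomial.natDegree_add_eq_left_of_degree_lt, Polynomial.natDegree_X_pow]
  rw [Polynomial.degree_X_pow]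
  exact degree_lower_lt a

theorem eval_monicPoly {p : ℕ} (a : Fin p → ℂ) (t : ℂ) :
    (monicPoly a).eval t = t ^ p + ∑ s, a s * t ^ (s : ℕ) := by
  simp [monicPoly, Polynomial.eval_finsetSum]

/-- Uniqueness in the Weierstrass division theorem. -/
theorem eq_zero_of_sum_eq_monicPoly_pow_mul {p N : ℕ} {a : Fin p → ℂ} {r : ℝ}
    (hroot : ∀ t, t ^ p + ∑ s, a s * t ^ (s : ℕ) = 0 → ‖t‖ < r) {h : ℂ → ℂ}
    (hh : ContinuousOn h (Metric.ball 0 r)) {c : Fin (N * p) → ℂ}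
    (heq : ∀ t ∈ Metric.ball (0 : ℂ) r,
      ∑ s, c s * t ^ (s : ℕ) = (t ^ p + ∑ s, a s * t ^ (s : ℕ)) ^ N * h t) : c = 0 := by
  set S : Polynomial ℂ := ∑ s, Polynomial.C (c s) * Polynomial.X ^ (s : ℕ) with hS
  have hm := (monic_monicPoly a).pow N
  have hdvd : monicPoly a ^ N ∣ S := by
    refine Polynomial.dvd_of_eq_mul_on_ball hh _ _ _ rfl hm.ne_zero ?_ ?_
    · intro t ht
      rw [Polynomial.eval_pow] at ht
      have := eq_zero_of_pow_eq_zero ht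
      rw [eval_monicPoly] at this
      exact hroot t this
    · intro t ht
      rw [Polynomial.eval_pow, eval_monicPoly, ← heq t ht, hS]
      simp [Polynomial.eval_finsetSum]
  have hS0 : S = 0 := by
    refine Polynomial.eq_zero_of_dvd_of_degree_lt hdvd ?_
    rw [Polynomial.degree_eq_natDegree hm.ne_zero, (monic_monicPoly a).natDegree_pow,
      natDegree_monicPoly]
    exact degree_lower_lt c
  funext s
  have := congrArg (fun P => P.coeff (s : ℕ)) hS0
  simpa [hS, Polynomial.finsetSum_coeff, Polynomial.coeff_C_mul, Polynomial.coeff_X_pow,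
    Fin.val_inj, Finset.sum_ite_eq] using this

theorem norm_lt_of_monic_eq_zero {p : ℕ} {a : Fin p → ℂ} {r δ : ℝ} (hr : 0 < r) (hδ : δ < 1)
    (h : ∀ t : ℂ, ‖t‖ = r → ‖∑ s, a s * t ^ (s : ℕ)‖ ≤ δ * r ^ p) {t : ℂ}
    (ht : t ^ p + ∑ s, a s * t ^ (s : ℕ) = 0) : ‖t‖ < r := by
  by_contra! hrt
  have ht0 : t ≠ 0 := norm_pos_iff.1 (hr.trans_le hrt)
  have hF : ∀ y : ℂ, y ≠ 0 → ∑ s, a s * y ^ (p - (s : ℕ)) =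
      y ^ p * ∑ s, a s * y⁻¹ ^ (s : ℕ) := by
    intro y hy
    rw [Finset.mul_sum]
    refine Finset.sum_congr rfl fun s _ => ?_
    rw [pow_sub₀ y hy s.2.le, inv_pow]
    ring
  have key : ‖∑ s, a s * t⁻¹ ^ (p - (s : ℕ))‖ ≤ δ := by
    refine Complex.norm_le_of_forall_mem_frontier_norm_le
      (f := fun y : ℂ => ∑ s, a s * y ^ (p - (s : ℕ))) (U := Metric.ball 0 r⁻¹)
      Metric.isBounded_ball ?_ ?_ ?_
    · exact Differentiable.diffContOnCl (by fun_prop)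
    · intro y hy
      rw [frontier_ball _ (inv_pos.2 hr).ne', mem_sphere_zero_iff_norm] at hy
      have hy0 : y ≠ 0 := norm_pos_iff.1 (hy ▸ inv_pos.2 hr)
      rw [hF y hy0, norm_mul, norm_pow, hy]
      have := h y⁻¹ (by rw [norm_inv, hy, inv_inv])
      calc _ ≤ r⁻¹ ^ p * (δ * r ^ p) := by gcongr
        _ = δ := by rw [inv_pow]; field_simp
    · rw [closure_ball _ (inv_pos.2 hr).ne', mem_closedBall_zero_iff, norm_inv]
      gcongr
  rw [hF _ (inv_ne_zero ht0), inv_inv, eq_neg_of_add_eq_zero_right ht, mul_neg, ← mul_pow,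
    inv_mul_cancel₀ ht0, one_pow, norm_neg, norm_one] at key
  linarith

end Uniqueness

section Weierstrass
variable {E : Type*} [NormedAddCommGroup E] [NormedSpace ℂ E] [ProperSpace E]

omit [ProperSpace E] in
theorem DifferentiableOn.div_complex {f g : E → ℂ} {s : Set E} (hf : DifferentiableOn ℂ f s)
    (hg : DifferentiableOn ℂ g s) (h0 : ∀ x ∈ s, g x ≠ 0) :
    DifferentiableOn ℂ (fun x => f x / g x) s := by
  simp only [div_eq_mul_inv]
  exact hf.fun_mul (hg.fun_inv h0)

/-- The division theorem on a polydisc for functions which are uniform limits of polynomials. -/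
theorem HolLim.exists_division {ρ r : ℝ} (hr : 0 < r) (N : ℕ) {κ : ℝ} (hκ0 : 0 ≤ κ)
    (hκ : κ < 1) {D g : E × ℂ → ℂ} (hD : HolLim (polydisc E ρ r) D)
    (hDκ : ∀ z ∈ polydisc E ρ r, ‖D z - z.2 ^ N‖ ≤ κ * (r / 2) ^ N)
    (hg : HolLim (polydisc E ρ r) g) :
    ∃ q : E × ℂ → ℂ, HolLim (polydisc E ρ r) q ∧ ∃ c : Fin N → E → ℂ,
      (∀ s, DifferentiableOn ℂ (c s) (Metric.ball 0 ρ)) ∧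
      (∀ z ∈ polydisc E ρ r, g z = q z * D z + ∑ s, c s z.1 * z.2 ^ (s : ℕ)) ∧
      ((∀ z, g z = z.2 ^ N) → ∀ z ∈ polydisc E ρ r, ‖q z - 1‖ ≤ κ / (1 - κ)) := by
  classical
  obtain ⟨D', hD', hDe⟩ := holLim_iff_exists_mem_holAlg.1 hD
  obtain ⟨g', hg', hge⟩ := holLim_iff_exists_mem_holAlg.1 hg
  have hext : ∀ h ∈ holAlg (polydisc E ρ r), ∃ f : E × ℂ → ℂ, HolLim (polydisc E ρ r) f ∧
      ∀ z : polydisc E ρ r, h z = f z := by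
    intro h hh
    have he : ∀ z : polydisc E ρ r, h z =
        (fun z : E × ℂ => if hz : z ∈ polydisc E ρ r then h ⟨z, hz⟩ else 0) z := by
      intro z
      simp
    exact ⟨fun z => if hz : z ∈ polydisc E ρ r then h ⟨z, hz⟩ else 0,
      holLim_iff_exists_mem_holAlg.2 ⟨h, hh, he⟩, he⟩
  have hDn : ‖D' - sndMap E ρ r ^ N‖ * (2 / r) ^ N ≤ κ := by
    have : ‖D' - sndMap E ρ r ^ N‖ ≤ κ * (r / 2) ^ N :=
      (ContinuousMap.norm_le _ (by positivity)).2 fun z => by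
        have := hDκ z z.2
        rw [← hDe] at this
        exact this
    calc _ ≤ κ * (r / 2) ^ N * (2 / r) ^ N := by gcongr
      _ = κ := by
        rw [mul_assoc, ← mul_pow, div_mul_div_cancel₀ two_ne_zero, div_self hr.ne', one_pow,
          mul_one]
  obtain ⟨q, hq, c, hc, heq, hq1⟩ := _root_.exists_division ρ hr N hκ hD' hDn hg'
  obtain ⟨q', hq', hqe⟩ := hext q hq
  choose c' hc' hce using fun s => hext (c s) (hc s)
  refine ⟨q', hq', fun s x => c' s (x, 0), fun s => ?_, fun z hz => ?_, fun hgN z hz => ?_⟩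
  · refine ((hc' s).differentiableOn (s := Metric.ball 0 ρ ×ˢ Metric.ball 0 r)
      (Metric.isOpen_ball.prod Metric.isOpen_ball) (Set.prod_mono Metric.ball_subset_closedBall
        Metric.ball_subset_closedBall)).comp (by fun_prop) ?_
    exact fun x hx => ⟨hx, Metric.mem_ball_self hr⟩
  · have := DFunLike.congr_fun heq ⟨z, hz⟩
    rw [hge] at this
    simp only at this
    rw [this, ContinuousMap.add_apply, ContinuousMap.mul_apply, hqe, hDe,
      ContinuousMap.sum_apply, Finset.sum_range]
    congr 1
    refine Finset.sum_congr rfl fun s _ => ?_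
    rw [ContinuousMap.mul_apply, mul_comm]
    congr 1
    exact hce s _
  · have h1 : g' = sndMap E ρ r ^ N := by
      ext z
      rw [hge, hgN]
      rfl
    have h2 := (q - 1).norm_coe_le_norm ⟨z, hz⟩
    rw [ContinuousMap.sub_apply, hqe, ContinuousMap.one_apply] at h2
    exact h2.trans (hq1 h1)

omit [NormedSpace ℂ E] [ProperSpace E] in
theorem eventually_forall_norm_le {R r ε : ℝ} (hrR : r < R) (hR : 0 < R) (hε : 0 < ε)
    {F : E × ℂ → ℂ} (hF : ContinuousOn F (Metric.ball 0 R))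
    (h0 : ∀ t ∈ Metric.closedBall (0 : ℂ) r, F (0, t) = 0) :
    ∀ᶠ x in 𝓝 (0 : E), ∀ t ∈ Metric.closedBall (0 : ℂ) r, ‖F (x, t)‖ ≤ ε := by
  refine (isCompact_closedBall (0 : ℂ) r).eventually_forall_of_forall_eventually
    (P := fun x t => ‖F (x, t)‖ ≤ ε) fun t ht => ?_
  have hmem : ((0 : E), t) ∈ Metric.ball (0 : E × ℂ) R := by
    rw [mem_ball_zero_iff, Prod.norm_def]
    rw [mem_closedBall_zero_iff] at ht
    exact max_lt (by simpa using hR) (ht.trans_lt hrR)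
  have hc := (hF.continuousAt (Metric.isOpen_ball.mem_nhds hmem)).norm.tendsto
  rw [h0 t ht, norm_zero] at hc
  exact hc.eventually_le_const hε

/-- The Weierstrass preparation theorem, together with the division theorem by the square of the
Weierstrass polynomial. -/
theorem weierstrass_preparation [FiniteDimensional ℂ E] {R : ℝ} (hR : 0 < R) {d : E × ℂ → ℂ}
    (hd : DifferentiableOn ℂ d (Metric.ball 0 R)) (h0 : ¬ ∀ᶠ t in 𝓝 (0 : ℂ), d (0, t) = 0) :
    ∃ (p : ℕ) (a : Fin p → E → ℂ) (e : E × ℂ → ℂ) (ρ r : ℝ), 0 < ρ ∧ 0 < r ∧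
      Metric.ball 0 ρ ×ˢ Metric.ball 0 r ⊆ Metric.ball (0 : E × ℂ) R ∧
      (∀ s, DifferentiableOn ℂ (a s) (Metric.ball 0 ρ)) ∧
      DifferentiableOn ℂ e (Metric.ball 0 ρ ×ˢ Metric.ball 0 r) ∧
      (∀ z ∈ Metric.ball (0 : E) ρ ×ˢ Metric.ball (0 : ℂ) r, e z ≠ 0 ∧
        d z = (z.2 ^ p + ∑ s, a s z.1 * z.2 ^ (s : ℕ)) * e z) ∧
      (∀ x ∈ Metric.ball (0 : E) ρ, ∀ t : ℂ, t ^ p + ∑ s, a s x * t ^ (s : ℕ) = 0 → ‖t‖ < r) ∧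
      ∀ g : E × ℂ → ℂ, DifferentiableOn ℂ g (Metric.ball 0 R) →
        ∃ (v : Fin (2 * p) → E → ℂ) (H : E × ℂ → ℂ),
          (∀ s, DifferentiableOn ℂ (v s) (Metric.ball 0 ρ)) ∧
          DifferentiableOn ℂ H (Metric.ball 0 ρ ×ˢ Metric.ball 0 r) ∧
          ∀ z ∈ Metric.ball (0 : E) ρ ×ˢ Metric.ball (0 : ℂ) r,
            g z = (z.2 ^ p + ∑ s, a s z.1 * z.2 ^ (s : ℕ)) ^ 2 * H z +
              ∑ s, v s z.1 * z.2 ^ (s : ℕ) := by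
  have hsec : ∀ t ∈ Metric.ball (0 : ℂ) R, ((0 : E), t) ∈ Metric.ball (0 : E × ℂ) R := by
    intro t ht
    rw [mem_ball_zero_iff] at *
    rw [Prod.norm_def]
    exact max_lt (by simpa using hR) ht
  have hd0 : DifferentiableOn ℂ (fun t : ℂ => d (0, t)) (Metric.ball 0 R) :=
    hd.comp (by fun_prop) hsec
  have han : AnalyticAt ℂ (fun t : ℂ => d (0, t)) 0 :=
    hd0.analyticAt (Metric.ball_mem_nhds _ hR)
  obtain ⟨p, u, hua, hu0, hueq⟩ := han.exists_eventuallyEq_pow_smul_nonzero_iff.2 h0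
  obtain ⟨R₁, hR₁, hu⟩ := Metric.eventually_nhds_iff_ball.1
    (hua.eventually_analyticAt.and ((hua.continuousAt.eventually_ne hu0).and hueq))
  set R₂ := min R R₁ with hR₂
  have hR₂0 : 0 < R₂ := by positivity
  have hudiff : DifferentiableOn ℂ (fun z : E × ℂ => u z.2) (Metric.ball 0 R₂) := by
    intro z hz
    have hz2 : z.2 ∈ Metric.ball (0 : ℂ) R₁ := by
      rw [mem_ball_zero_iff] at *
      exact (norm_snd_le z).trans_lt (hz.trans_le (min_le_right _ _))
    exact ((hu _ hz2).1.differentiableAt.comp z differentiableAt_snd).differentiableWithinAt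
  have hune : ∀ z ∈ Metric.ball (0 : E × ℂ) R₂, u z.2 ≠ 0 := by
    intro z hz
    refine (hu z.2 ?_).2.1
    rw [mem_ball_zero_iff] at *
    exact (norm_snd_le z).trans_lt (hz.trans_le (min_le_right _ _))
  have hsubR : Metric.ball (0 : E × ℂ) R₂ ⊆ Metric.ball 0 R :=
    Metric.ball_subset_ball (min_le_left _ _)
  set d₁ : E × ℂ → ℂ := fun z => d z / u z.2 with hd₁
  have hd₁diff : DifferentiableOn ℂ d₁ (Metric.ball 0 R₂) := (hd.mono hsubR).div_complex hudiff hune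
  obtain ⟨ρ₀, hρ₀, hpoly⟩ := hasPolyApprox (E × ℂ) R₂ hR₂0
  set r := min ρ₀ (R₂ / 2) with hr
  have hr0 : 0 < r := by positivity
  have hrR₂ : r < R₂ := (min_le_right _ _).trans_lt (by linarith)
  have hd₁0 : ∀ t ∈ Metric.closedBall (0 : ℂ) r, d₁ (0, t) = t ^ p := by
    intro t ht
    have htR : t ∈ Metric.ball (0 : ℂ) R₁ := by
      rw [mem_closedBall_zero_iff] at ht
      exact mem_ball_zero_iff.2 (ht.trans_lt (hrR₂.trans_le (min_le_right _ _)))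
    have h1 := hu t htR
    rw [hd₁]
    simp only
    rw [h1.2.2, sub_zero, smul_eq_mul, mul_div_assoc, div_self h1.2.1, mul_one]
  have hev : ∀ N : ℕ, ∀ᶠ x in 𝓝 (0 : E), ∀ t ∈ Metric.closedBall (0 : ℂ) r,
      ‖d₁ (x, t) ^ N - (t ^ p) ^ N‖ ≤ 1 / 8 * (r / 2) ^ (N * p) := fun N =>
    eventually_forall_norm_le (F := fun z => d₁ z ^ N - (z.2 ^ p) ^ N) hrR₂ hR₂0 (by positivity)
      (by have := hd₁diff.continuousOn; fun_prop)
      (fun t ht => by simp only; rw [hd₁0 t ht, sub_self])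
  obtain ⟨ρ₁, hρ₁, hclose⟩ := Metric.nhds_basis_closedBall.eventually_iff.1 ((hev 1).and (hev 2))
  set ρ := min ρ₁ r with hρ
  have hρ0 : 0 < ρ := by positivity
  have hKsub : polydisc E ρ r ⊆ Metric.closedBall 0 ρ₀ := by
    rintro ⟨x, t⟩ ⟨hx, ht⟩
    rw [mem_closedBall_zero_iff] at *
    rw [Prod.norm_def]
    exact max_le (hx.trans ((min_le_right _ _).trans (min_le_left _ _)))
      (ht.trans (min_le_left _ _))
  have hBK : Metric.ball (0 : E) ρ ×ˢ Metric.ball (0 : ℂ) r ⊆ polydisc E ρ r :=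
    Set.prod_mono Metric.ball_subset_closedBall Metric.ball_subset_closedBall
  have hBopen : IsOpen (Metric.ball (0 : E) ρ ×ˢ Metric.ball (0 : ℂ) r) :=
    Metric.isOpen_ball.prod Metric.isOpen_ball
  have hKR₂ : polydisc E ρ r ⊆ Metric.ball 0 R₂ := by
    rintro ⟨x, t⟩ ⟨hx, ht⟩
    rw [mem_closedBall_zero_iff] at hx ht
    rw [mem_ball_zero_iff, Prod.norm_def]
    exact max_lt ((hx.trans (min_le_right _ _)).trans_lt hrR₂) (ht.trans_lt hrR₂)
  have hholK : ∀ f : E × ℂ → ℂ, DifferentiableOn ℂ f (Metric.ball 0 R₂) →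
      HolLim (polydisc E ρ r) f := fun f hf => (hpoly f hf).mono hKsub
  have hcl1 : ∀ z ∈ polydisc E ρ r, ‖d₁ z - z.2 ^ p‖ ≤ 1 / 8 * (r / 2) ^ p := by
    rintro ⟨x, t⟩ ⟨hx, ht⟩
    simpa using (hclose (Metric.closedBall_subset_closedBall (min_le_left _ _) hx)).1 t ht
  have hcl2 : ∀ z ∈ polydisc E ρ r, ‖d₁ z ^ 2 - z.2 ^ (2 * p)‖ ≤ 1 / 8 * (r / 2) ^ (2 * p) := by
    rintro ⟨x, t⟩ ⟨hx, ht⟩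
    rw [mul_comm 2 p, pow_mul, mul_comm p 2]
    exact (hclose (Metric.closedBall_subset_closedBall (min_le_left _ _) hx)).2 t ht
  obtain ⟨q₀, hq₀, c₀, hc₀, heq₀, hq₀1⟩ := HolLim.exists_division hr0 p (κ := 1 / 8)
    (by norm_num) (by norm_num) (hholK d₁ hd₁diff) hcl1 (hholK (fun z => z.2 ^ p) (by fun_prop))
  have hq₀1 : ∀ z ∈ polydisc E ρ r, ‖q₀ z - 1‖ ≤ 1 / 7 := by
    intro z hz
    exact (hq₀1 (fun _ => rfl) z hz).trans (by norm_num)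
  have hq₀ne : ∀ z ∈ polydisc E ρ r, q₀ z ≠ 0 := by
    intro z hz h
    have := hq₀1 z hz
    rw [h, zero_sub, norm_neg, norm_one] at this
    norm_num at this
  have hW : ∀ z ∈ polydisc E ρ r,
      z.2 ^ p + ∑ s, -c₀ s z.1 * z.2 ^ (s : ℕ) = q₀ z * d₁ z := by
    intro z hz
    rw [heq₀ z hz]
    simp only [neg_mul, Finset.sum_neg_distrib]
    ring
  have hq₀diff := hq₀.differentiableOn hBopen hBK
  refine ⟨p, fun s x => -c₀ s x, fun z => u z.2 / q₀ z, ρ, r, hρ0, hr0,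
    (hBK.trans hKR₂).trans hsubR, fun s => (hc₀ s).neg,
    (hudiff.mono (hBK.trans hKR₂)).div_complex hq₀diff (fun z hz => hq₀ne z (hBK hz)),
    fun z hz => ⟨div_ne_zero (hune z (hKR₂ (hBK hz))) (hq₀ne z (hBK hz)), ?_⟩,
    fun x hx t ht => ?_, fun g hg => ?_⟩
  · rw [hW z (hBK hz), hd₁]
    have h1 := hune z (hKR₂ (hBK hz))
    have h2 := hq₀ne z (hBK hz)
    field_simp
  · refine norm_lt_of_monic_eq_zero hr0 (δ := 2 / 7) (by norm_num) (fun s hs => ?_) ht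
    have hz : (x, s) ∈ polydisc E ρ r :=
      ⟨Metric.ball_subset_closedBall hx, mem_closedBall_zero_iff.2 hs.le⟩
    have h1 := hW _ hz
    have h2 := hcl1 _ hz
    have h3 := hq₀1 _ hz
    simp only at h1 h2
    have h4 : ∑ i, -c₀ i x * s ^ (i : ℕ) = (q₀ (x, s) - 1) * d₁ (x, s) +
        (d₁ (x, s) - s ^ p) := by
      linear_combination h1
    have h5 : (r / 2) ^ p ≤ r ^ p := by gcongr; linarith
    have h6 : ‖d₁ (x, s)‖ ≤ 9 / 8 * r ^ p := by
      have := norm_add_le (d₁ (x, s) - s ^ p) (s ^ p)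
      rw [sub_add_cancel, norm_pow s, hs] at this
      linarith
    rw [h4]
    calc _ ≤ ‖q₀ (x, s) - 1‖ * ‖d₁ (x, s)‖ + ‖d₁ (x, s) - s ^ p‖ :=
          (norm_add_le _ _).trans (by rw [norm_mul])
      _ ≤ 1 / 7 * (9 / 8 * r ^ p) + 1 / 8 * r ^ p := by
          gcongr
          linarith
      _ = 2 / 7 * r ^ p := by ring
  · obtain ⟨q, hq, c, hc, heq, -⟩ := HolLim.exists_division hr0 (2 * p) (κ := 1 / 8)
      (by norm_num) (by norm_num) (hholK (fun z => d₁ z ^ 2) (hd₁diff.pow 2)) hcl2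
      (hholK g (hg.mono hsubR))
    refine ⟨c, fun z => q z / q₀ z ^ 2, hc,
      (hq.differentiableOn hBopen hBK).div_complex (hq₀diff.pow 2)
      (fun z hz => pow_ne_zero 2 (hq₀ne z (hBK hz))), fun z hz => ?_⟩
    rw [heq z (hBK hz), hW z (hBK hz)]
    have h2 := hq₀ne z (hBK hz)
    field_simp

end Weierstrass

/-- The small root `w` of `c + w + b₀ w² + b₁ w³ + ⋯ = 0` depends holomorphically on the
coefficients. -/
theorem exists_small_root (N : ℕ) (b₀ : Fin N → ℂ) :
    ∃ η > 0, ∃ φ : ℂ × (Fin N → ℂ) → ℂ, DifferentiableOn ℂ φ (Metric.ball (0, b₀) η) ∧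
      ∀ z ∈ Metric.ball ((0 : ℂ), b₀) η,
        z.1 + φ z + φ z ^ 2 * ∑ i, z.2 i * φ z ^ (i : ℕ) = 0 ∧ ‖φ z‖ ≤ 2 * ‖z.1‖ := by
  set G : (ℂ × (Fin N → ℂ)) × ℂ → ℂ := fun y =>
    y.1.1 + y.2 + y.2 ^ 2 * ∑ i, y.1.2 i * y.2 ^ (i : ℕ) with hG
  have hGc : ContDiff ℂ 1 G := by
    rw [hG]
    fun_prop
  have hGat : ContDiffAt ℂ 1 G ((0, b₀), 0) := hGc.contDiffAt
  have hG0 : G ((0, b₀), 0) = 0 := by simp [hG]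
  have hinr : fderiv ℂ G ((0, b₀), 0) ∘L .inr ℂ (ℂ × (Fin N → ℂ)) ℂ =
      ContinuousLinearMap.id ℂ ℂ := by
    have h1 : HasFDerivAt (fun w : ℂ => G ((0, b₀), w))
        (fderiv ℂ G ((0, b₀), 0) ∘L .inr ℂ (ℂ × (Fin N → ℂ)) ℂ) 0 :=
      ((hGc.differentiable (by norm_num)) _).hasFDerivAt.comp 0 (hasFDerivAt_prodMk_right _ _)
    have h2 : HasDerivAt (fun w : ℂ => G ((0, b₀), w)) 1 0 := by
      have hS : DifferentiableAt ℂ (fun w : ℂ => ∑ i, b₀ i * w ^ (i : ℕ)) 0 := by fun_prop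
      have := ((hasDerivAt_id' (0 : ℂ)).const_add 0).fun_add
        (((hasDerivAt_id' (0 : ℂ)).fun_pow 2).fun_mul hS.hasDerivAt)
      simpa [hG] using this
    have h3 := h1.unique h2.hasFDerivAt
    rw [h3]
    ext
    simp
  have hinv : (fderiv ℂ G ((0, b₀), 0) ∘L .inr ℂ (ℂ × (Fin N → ℂ)) ℂ).IsInvertible := by
    rw [hinr]
    exact ContinuousLinearMap.isInvertible_equiv (f := ContinuousLinearEquiv.refl ℂ ℂ)
  set φ := hGat.implicitFunction one_ne_zero hinv with hφ
  have hφ0 : φ (0, b₀) = 0 := hGat.implicitFunction_apply_self one_ne_zero hinv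
  have hφc : ContDiffAt ℂ 1 φ (0, b₀) := hGat.contDiffAt_implicitFunction one_ne_zero hinv
  have hφeq := hGat.eventually_apply_implicitFunction one_ne_zero hinv
  have hφd : ∀ᶠ z in 𝓝 ((0 : ℂ), b₀), DifferentiableAt ℂ φ z := by
    filter_upwards [hφc.eventually (by simp)] with z hz
    exact hz.differentiableAt (by norm_num)
  have hsmall : ∀ᶠ z in 𝓝 ((0 : ℂ), b₀), ‖φ z * ∑ i, z.2 i * φ z ^ (i : ℕ)‖ ≤ 1 / 2 := by
    have hc : ContinuousAt (fun z : ℂ × (Fin N → ℂ) => ‖φ z * ∑ i, z.2 i * φ z ^ (i : ℕ)‖)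
        (0, b₀) := by
      have := hφc.continuousAt
      fun_prop
    have := hc.tendsto
    simp only [hφ0, zero_mul, norm_zero] at this
    exact this.eventually_le_const (by norm_num)
  obtain ⟨η, hη, hb⟩ := Metric.eventually_nhds_iff_ball.1 (hφd.and (hφeq.and hsmall))
  refine ⟨η, hη, φ, fun z hz => (hb z hz).1.differentiableWithinAt, fun z hz => ?_⟩
  have heq : z.1 + φ z + φ z ^ 2 * ∑ i, z.2 i * φ z ^ (i : ℕ) = 0 := by
    have := (hb z hz).2.1
    rwa [hG0] at this
  refine ⟨heq, ?_⟩
  have hs := (hb z hz).2.2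
  have h1 : φ z = -z.1 - φ z * (φ z * ∑ i, z.2 i * φ z ^ (i : ℕ)) := by
    linear_combination heq
  have h2 : ‖φ z‖ ≤ ‖z.1‖ + ‖φ z‖ * (1 / 2) := by
    calc ‖φ z‖ = ‖-z.1 - φ z * (φ z * ∑ i, z.2 i * φ z ^ (i : ℕ))‖ := by rw [← h1]
      _ ≤ ‖z.1‖ + ‖φ z‖ * (1 / 2) := by
        refine (norm_sub_le _ _).trans ?_
        rw [norm_neg, norm_mul]
        gcongr
  linarith

theorem IsAlgebraic.exists_aeval_derivative_ne_zero {S H : Type*} [CommRing S] [IsAddTorsionFree S]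
    [CommRing H] [Algebra S H] (hinj : Function.Injective (algebraMap S H)) {x : H}
    (hx : IsAlgebraic S x) : ∃ p : Polynomial S, p ≠ 0 ∧ Polynomial.aeval x p = 0 ∧
      Polynomial.aeval x (Polynomial.derivative p) ≠ 0 := by
  classical
  have hex : ∃ d : ℕ, ∃ p : Polynomial S, p ≠ 0 ∧ Polynomial.aeval x p = 0 ∧ p.natDegree = d := by
    obtain ⟨p, hp, hpx⟩ := hx
    exact ⟨_, p, hp, hpx, rfl⟩
  obtain ⟨p, hp, hpx, hpd⟩ := Nat.find_spec hex
  refine ⟨p, hp, hpx, fun h => ?_⟩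
  by_cases hd : p.natDegree = 0
  · rw [Polynomial.eq_C_of_natDegree_eq_zero hd, Polynomial.aeval_C] at hpx
    have h0 := hinj (hpx.trans (map_zero _).symm)
    apply hp
    rw [Polynomial.eq_C_of_natDegree_eq_zero hd, h0, map_zero]
  · have h1 : Polynomial.derivative p ≠ 0 := fun h0 => hd (Polynomial.derivative_eq_zero.1 h0)
    have h2 := Nat.find_min' hex ⟨_, h1, h, rfl⟩
    have h3 := Polynomial.natDegree_derivative_lt hd
    omega

theorem IsAlgebraic.exists_X_pow_mul_annihilates {S A : Type*} [CommRing S]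
    [CommRing A] [Algebra S A] {a : A} (ha : IsAlgebraic S a) :
    ∃ (e : ℕ) (u : Polynomial S), u.coeff 0 ≠ 0 ∧ a ^ e * Polynomial.aeval a u = 0 := by
  obtain ⟨B, hB, hBa⟩ := ha
  obtain ⟨u, hu, hu0⟩ := Polynomial.exists_eq_pow_rootMultiplicity_mul_and_not_dvd B hB 0
  rw [map_zero, sub_zero] at hu hu0
  refine ⟨B.rootMultiplicity 0, u, fun h => hu0 (Polynomial.X_dvd_iff.2 h), ?_⟩
  rw [hu] at hBa
  simpa using hBa

theorem AlgebraicIndependent.exists_eval₂_derivative_ne_zero {τ H : Type*} [CommRing H]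
    [Algebra ℂ H] {x : τ → H} (hx : AlgebraicIndependent ℂ x) {a : H}
    (ha : IsAlgebraic (Algebra.adjoin ℂ (Set.range x)) a) :
    ∃ p : Polynomial (MvPolynomial τ ℂ), p ≠ 0 ∧
      Polynomial.eval₂ (MvPolynomial.aeval (R := ℂ) x).toRingHom a p = 0 ∧
      Polynomial.eval₂ (MvPolynomial.aeval (R := ℂ) x).toRingHom a (Polynomial.derivative p) ≠ 0 := by
  let : Algebra (MvPolynomial τ ℂ) H := (MvPolynomial.aeval (R := ℂ) x).toRingHom.toAlgebra
  have ha' : IsAlgebraic (MvPolynomial τ ℂ) a := by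
    refine ha.ringHom_of_comp_eq (B := H) hx.aevalEquiv.symm (RingHom.id H)
      hx.aevalEquiv.symm.injective ?_
    ext z
    obtain ⟨s, rfl⟩ := hx.aevalEquiv.surjective z
    simp only [RingHom.comp_apply, RingHom.coe_coe, AlgEquiv.symm_apply_apply, RingHom.id_apply]
    exact (hx.algebraMap_aevalEquiv s).symm
  exact ha'.exists_aeval_derivative_ne_zero hx

theorem exists_annihilating_polynomial {S I : Type*} [CommRing S] [IsDomain S] [Algebra ℂ S]
    (p : I → Polynomial S) (hp0 : ∀ i, p i ≠ 0) (Q : MvPolynomial I ℂ) :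
    ∃ (e : ℕ) (u : Polynomial S), u.coeff 0 ≠ 0 ∧ ∀ (σ : S →ₐ[ℂ] ℂ) (y : I → ℂ),
      (∀ i, Polynomial.eval₂ σ.toRingHom (y i) (p i) = 0) →
        MvPolynomial.eval y Q ^ e *
          Polynomial.eval₂ σ.toRingHom (MvPolynomial.eval y Q) u = 0 := by
  let K : Ideal (MvPolynomial I S) := Ideal.span (Set.range fun i =>
    Polynomial.aeval (MvPolynomial.X i : MvPolynomial I S) (p i))
  have hX : ∀ i, IsAlgebraic S (Ideal.Quotient.mk K (MvPolynomial.X i)) := by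
    intro i
    refine ⟨p i, hp0 i, ?_⟩
    have h : Polynomial.aeval (Ideal.Quotient.mkₐ S K (MvPolynomial.X i)) (p i) = 0 := by
      rw [Polynomial.aeval_algHom_apply]
      exact Ideal.Quotient.eq_zero_iff_mem.2 (Ideal.subset_span ⟨i, rfl⟩)
    exact h
  have hQ : Ideal.Quotient.mk K (MvPolynomial.map (algebraMap ℂ S) Q) ∈
      Subalgebra.algebraicClosure S (MvPolynomial I S ⧸ K) := by
    induction Q using MvPolynomial.induction_on with
    | C c =>
      rw [MvPolynomial.map_C]
      exact (Subalgebra.algebraicClosure S (MvPolynomial I S ⧸ K)).algebraMap_mem (algebraMap ℂ S c)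
    | add q₁ q₂ h₁ h₂ =>
      rw [map_add, map_add]
      exact add_mem h₁ h₂
    | mul_X q i h =>
      rw [map_mul, map_mul, MvPolynomial.map_X]
      exact mul_mem h ((Subalgebra.mem_algebraicClosure S _).2 (hX i))
  obtain ⟨e, u, hu, hz⟩ :=
    ((Subalgebra.mem_algebraicClosure S _).1 hQ).exists_X_pow_mul_annihilates
  refine ⟨e, u, hu, fun σ y hy => ?_⟩
  let Φ : MvPolynomial I S →+* ℂ := MvPolynomial.eval₂Hom σ.toRingHom y
  have hK' : K ≤ RingHom.ker Φ := by
    refine Ideal.span_le.2 ?_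
    rintro _ ⟨i, rfl⟩
    have h := hy i
    change Φ (Polynomial.aeval _ (p i)) = 0
    rw [Polynomial.aeval_def, Polynomial.hom_eval₂, ← h]
    congr 1
    · ext s
      simp [Φ]
    · simp [Φ]
  have hK : ∀ a ∈ K, Φ a = 0 := fun a ha => hK' ha
  have hev := congrArg (Ideal.Quotient.lift K Φ hK) hz
  rw [map_mul, map_pow, map_zero, Polynomial.aeval_def, Polynomial.hom_eval₂] at hev
  have h1 : (Ideal.Quotient.lift K Φ hK) (Ideal.Quotient.mk K
      (MvPolynomial.map (algebraMap ℂ S) Q)) = MvPolynomial.eval y Q := by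
    rw [Ideal.Quotient.lift_mk]
    simp only [Φ, MvPolynomial.coe_eval₂Hom, MvPolynomial.eval₂_map]
    rw [MvPolynomial.eval, MvPolynomial.coe_eval₂Hom]
    congr 1
    ext r
    simp
  have h2 : (Ideal.Quotient.lift K Φ hK).comp (algebraMap S (MvPolynomial I S ⧸ K)) =
      σ.toRingHom := by
    ext s
    change Φ (MvPolynomial.C s) = _
    simp [Φ]
  rwa [h1, h2] at hev

/-- Equations with invertible derivative for a point `w` of an affine space over a domain, which
cut out, away from the zeros of `u (0)`, the generic component through `w`. -/
theorem exists_generic_equations {H I : Type*} [CommRing H] [IsDomain H] [Algebra ℂ H] [Finite I]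
    (w : I → H) (J : Set I) (hJ : AlgebraicIndepOn ℂ w J) :
    ∃ P : I → Polynomial (MvPolynomial I ℂ),
      (∀ i ∈ J, P i = Polynomial.X - Polynomial.C (MvPolynomial.X i)) ∧
      (∀ i, Polynomial.eval₂ (MvPolynomial.aeval w).toRingHom (w i) (P i) = 0) ∧
      (∀ i, Polynomial.eval₂ (MvPolynomial.aeval w).toRingHom (w i)
        (Polynomial.derivative (P i)) ≠ 0) ∧
      ∀ Q : MvPolynomial I ℂ, ∃ (e : ℕ) (u : Polynomial (MvPolynomial I ℂ)),
        MvPolynomial.aeval w (u.coeff 0) ≠ 0 ∧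
        ∀ T y : I → ℂ, (∀ i, Polynomial.eval₂ (MvPolynomial.eval T) (y i) (P i) = 0) →
          MvPolynomial.eval y Q ^ e *
            Polynomial.eval₂ (MvPolynomial.eval T) (MvPolynomial.eval y Q) u = 0 := by
  classical
  obtain ⟨τ, hJτ, hτ, hmax⟩ := Finite.exists_le_maximal (p := AlgebraicIndepOn ℂ w) hJ
  let φ : MvPolynomial τ ℂ →+* MvPolynomial I ℂ :=
    (MvPolynomial.rename (Subtype.val : τ → I)).toRingHom
  let ψ : MvPolynomial τ ℂ →+* H := (MvPolynomial.aeval (R := ℂ) (fun i : τ => w i)).toRingHom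
  have hψ : Function.Injective ψ := hτ
  have hψφ : (MvPolynomial.aeval w).toRingHom.comp φ = ψ := by
    apply MvPolynomial.ringHom_ext
    · intro r
      simp [φ, ψ]
    · intro i
      simp [φ, ψ]
  have hp : ∀ i, ∃ p : Polynomial (MvPolynomial τ ℂ), p ≠ 0 ∧ Polynomial.eval₂ ψ (w i) p = 0 ∧
      Polynomial.eval₂ ψ (w i) (Polynomial.derivative p) ≠ 0 ∧
      (i ∈ J → p.map φ = Polynomial.X - Polynomial.C (MvPolynomial.X i)) := by
    intro i
    by_cases hi : i ∈ τ
    · refine ⟨Polynomial.X - Polynomial.C (MvPolynomial.X ⟨i, hi⟩),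
        Polynomial.X_sub_C_ne_zero _, ?_, ?_, fun _ => ?_⟩
      · simp [ψ]
      · simp
      · simp [φ]
    · have halg : IsAlgebraic (Algebra.adjoin ℂ (w '' τ)) (w i) := by
        by_contra htr
        exact hi (hmax ((AlgebraicIndepOn.insert_iff hi).2 ⟨hτ, htr⟩) (Set.subset_insert _ _)
          (Set.mem_insert _ _))
      rw [Set.image_eq_range] at halg
      obtain ⟨p, h0, h1, h2⟩ := AlgebraicIndependent.exists_eval₂_derivative_ne_zero hτ halg
      exact ⟨p, h0, h1, h2, fun h => absurd (hJτ h) hi⟩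
  choose p hp0 hp1 hp2 hp3 using hp
  have key : ∀ i (r : Polynomial (MvPolynomial τ ℂ)),
      Polynomial.eval₂ (MvPolynomial.aeval w).toRingHom (w i)
      (r.map φ) = Polynomial.eval₂ ψ (w i) r := by
    intro i r
    rw [Polynomial.eval₂_map, hψφ]
  refine ⟨fun i => (p i).map φ, hp3, fun i => (key i _).trans (hp1 i), fun i => ?_, fun Q => ?_⟩
  · rw [Polynomial.derivative_map, key]
    exact hp2 i
  · obtain ⟨e, u, hu, h⟩ := exists_annihilating_polynomial p hp0 Q
    refine ⟨e, u.map φ, ?_, fun T y hy => ?_⟩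
    · rw [Polynomial.coeff_map]
      have : (MvPolynomial.aeval w).toRingHom.comp φ (u.coeff 0) ≠ 0 := by
        rw [hψφ]
        exact fun h => hu (hψ (h.trans (map_zero _).symm))
      exact this
    · have hσ : (MvPolynomial.aeval (R := ℂ) fun i : τ => T i).toRingHom =
          (MvPolynomial.eval T).comp φ := by
        apply MvPolynomial.ringHom_ext
        · intro r
          simp [φ]
        · intro i
          change MvPolynomial.aeval (fun i : τ => T i) (MvPolynomial.X i : MvPolynomial τ ℂ) =
            MvPolynomial.eval T (MvPolynomial.rename _ (MvPolynomial.X i))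
          simp
      have := h (MvPolynomial.aeval (R := ℂ) fun i : τ => T i) y fun i => by
        rw [hσ, ← Polynomial.eval₂_map]
        exact hy i
      rw [hσ, ← Polynomial.eval₂_map] at this
      exact this

theorem MvPolynomial.differentiable_eval {σ : Type*} [Finite σ] (p : MvPolynomial σ ℂ) :
    Differentiable ℂ fun x : σ → ℂ => MvPolynomial.eval x p := by
  have := Fintype.ofFinite σ
  induction p using MvPolynomial.induction_on with
  | C c => simp
  | add p q hp hq => simpa using hp.fun_add hq
  | mul_X p i hp =>
    simp only [map_mul, MvPolynomial.eval_X]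
    exact hp.fun_mul (differentiable_apply i)

theorem MvPolynomial.eq_zero_of_eval_eq_zero_on_open {σ : Type*} [Finite σ] {p : MvPolynomial σ ℂ}
    {Ω : Set (σ → ℂ)} (hΩ : IsOpen Ω) (hne : Ω.Nonempty)
    (h : ∀ x ∈ Ω, MvPolynomial.eval x p = 0) : p = 0 := by
  have := Fintype.ofFinite σ
  obtain ⟨a, ha⟩ := hne
  have h0 : (fun x : σ → ℂ => MvPolynomial.eval x p) =ᶠ[𝓝 a] 0 := by
    filter_upwards [hΩ.mem_nhds ha] with x hx using h x hx
  refine MvPolynomial.funext fun x => ?_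
  rw [map_zero]
  exact eqOn_zero_of_eventuallyEq_zero_of_convex isOpen_univ convex_univ
    (MvPolynomial.differentiable_eval p).differentiableOn (Set.mem_univ a) h0 x (Set.mem_univ x)

/-- The algebra of holomorphic functions on `Ω`. -/
def holAlgebra {E : Type*} [NormedAddCommGroup E] [NormedSpace ℂ E] (Ω : Set E) :
    Subalgebra ℂ (Ω → ℂ) where
  carrier := {h | ∃ g : E → ℂ, DifferentiableOn ℂ g Ω ∧ ∀ x : Ω, h x = g x}
  mul_mem' := by
    rintro _ _ ⟨g₁, h₁, e₁⟩ ⟨g₂, h₂, e₂⟩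
    exact ⟨_, h₁.fun_mul h₂, fun x => by simp [e₁, e₂]⟩
  add_mem' := by
    rintro _ _ ⟨g₁, h₁, e₁⟩ ⟨g₂, h₂, e₂⟩
    exact ⟨_, h₁.fun_add h₂, fun x => by simp [e₁, e₂]⟩
  algebraMap_mem' c := ⟨fun _ => c, differentiableOn_const c, fun _ => rfl⟩

theorem isDomain_holAlgebra {E : Type*} [NormedAddCommGroup E] [NormedSpace ℂ E] {Ω : Set E}
    (hΩ : IsOpen Ω) (hc : Convex ℝ Ω) (hne : Ω.Nonempty) : IsDomain (holAlgebra Ω) := by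
  have : Nonempty Ω := hne.to_subtype
  have : NoZeroDivisors (holAlgebra Ω) := by
    constructor
    rintro ⟨_, g₁, h₁, e₁⟩ ⟨_, g₂, h₂, e₂⟩ h
    have h' := fun x => congrFun (congrArg Subtype.val h) x
    refine (eqOn_zero_or_eqOn_zero_of_mul hΩ hc h₁ h₂ fun x hx => ?_).imp (fun H => ?_)
      fun H => ?_
    · rw [← e₁ ⟨x, hx⟩, ← e₂ ⟨x, hx⟩]
      exact h' ⟨x, hx⟩
    · exact Subtype.ext (funext fun x => (e₁ x).trans (H x x.2))
    · exact Subtype.ext (funext fun x => (e₂ x).trans (H x x.2))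
  exact NoZeroDivisors.to_isDomain _

theorem exists_generic_equations_holomorphic {n : ℕ} {κ : Type*} [Finite κ]
    {Ω : Set (Fin n → ℂ)} (hΩ : IsOpen Ω) (hc : Convex ℝ Ω) (hne : Ω.Nonempty)
    {f : (Fin n → ℂ) → κ → ℂ} (hf : ∀ j, DifferentiableOn ℂ (fun x => f x j) Ω) :
    ∃ P : κ → Polynomial (MvPolynomial (Fin n ⊕ κ) ℂ),
      (∀ j, ∀ x ∈ Ω, Polynomial.eval₂ (MvPolynomial.eval (Sum.elim x (f x))) (f x j) (P j) = 0) ∧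
      (∀ j, ¬ ∀ x ∈ Ω, Polynomial.eval₂ (MvPolynomial.eval (Sum.elim x (f x))) (f x j)
        (Polynomial.derivative (P j)) = 0) ∧
      ∀ Q : MvPolynomial (Fin n ⊕ κ) ℂ, ∃ (e : ℕ) (u : Polynomial (MvPolynomial (Fin n ⊕ κ) ℂ)),
        (¬ ∀ x ∈ Ω, MvPolynomial.eval (Sum.elim x (f x)) (u.coeff 0) = 0) ∧
        ∀ (x : Fin n → ℂ) (g y : κ → ℂ),
          (∀ j, Polynomial.eval₂ (MvPolynomial.eval (Sum.elim x g)) (y j) (P j) = 0) →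
          MvPolynomial.eval (Sum.elim x y) Q ^ e *
            Polynomial.eval₂ (MvPolynomial.eval (Sum.elim x g))
              (MvPolynomial.eval (Sum.elim x y) Q) u = 0 := by
  have := isDomain_holAlgebra hΩ hc hne
  let w : Fin n ⊕ κ → holAlgebra Ω := fun i => ⟨fun x => Sum.elim x.1 (f x) i, fun x =>
    Sum.elim x (f x) i, by
      rcases i with i | j
      · exact (differentiable_apply i).differentiableOn
      · exact hf j, fun x => rfl⟩
  let ev : Ω → (holAlgebra Ω →+* ℂ) := fun x =>
    (Pi.evalRingHom _ x).comp (holAlgebra Ω).val.toRingHom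
  have hev0 : ∀ h : holAlgebra Ω, (∀ x, ev x h = 0) → h = 0 := fun h hh =>
    Subtype.ext (funext fun x => hh x)
  have hevw : ∀ x : Ω, (ev x).comp (MvPolynomial.aeval w).toRingHom =
      MvPolynomial.eval (Sum.elim x.1 (f x)) := by
    intro x
    apply MvPolynomial.ringHom_ext
    · intro r
      simp only [RingHom.comp_apply, AlgHom.toRingHom_eq_coe, RingHom.coe_coe,
        MvPolynomial.eval_C, MvPolynomial.algHom_C]
      rfl
    · intro i
      simp only [RingHom.comp_apply, AlgHom.toRingHom_eq_coe, RingHom.coe_coe,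
        MvPolynomial.aeval_X, MvPolynomial.eval_X]
      rfl
  have hev : ∀ (x : Ω) i (p : Polynomial (MvPolynomial (Fin n ⊕ κ) ℂ)),
      ev x (Polynomial.eval₂ (MvPolynomial.aeval w).toRingHom (w i) p) =
      Polynomial.eval₂ (MvPolynomial.eval (Sum.elim x.1 (f x))) (Sum.elim x.1 (f x) i) p := by
    intro x i p
    rw [Polynomial.hom_eval₂, hevw]
    rfl
  have hJ : AlgebraicIndepOn ℂ w (Set.range Sum.inl) := by
    refine (algebraicIndependent_equiv (Equiv.ofInjective (Sum.inl : Fin n → Fin n ⊕ κ)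
      Sum.inl_injective)).1 ?_
    refine (injective_iff_map_eq_zero _).2 fun p hp => ?_
    refine MvPolynomial.eq_zero_of_eval_eq_zero_on_open hΩ hne fun x hx => ?_
    have h1 := congrArg (ev ⟨x, hx⟩) hp
    rw [map_zero] at h1
    rw [← h1]
    have : (ev ⟨x, hx⟩).comp (MvPolynomial.aeval (R := ℂ) ((fun i : Set.range
        (Sum.inl : Fin n → Fin n ⊕ κ) => w i) ∘ Equiv.ofInjective _ Sum.inl_injective)).toRingHom =
          MvPolynomial.eval x := by
      apply MvPolynomial.ringHom_ext
      · intro r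
        simp only [RingHom.comp_apply, AlgHom.toRingHom_eq_coe, RingHom.coe_coe,
          MvPolynomial.eval_C, MvPolynomial.algHom_C]
        rfl
      · intro i
        simp only [RingHom.comp_apply, AlgHom.toRingHom_eq_coe, RingHom.coe_coe,
          MvPolynomial.aeval_X, MvPolynomial.eval_X]
        rfl
    rw [← this]
    rfl
  obtain ⟨P, hP0, hP1, hP2, hP3⟩ := exists_generic_equations w _ hJ
  refine ⟨fun j => P (Sum.inr j), fun j x hx => ?_, fun j hj => ?_, fun Q => ?_⟩
  · have := hev ⟨x, hx⟩ (Sum.inr j) (P (Sum.inr j))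
    rw [hP1, map_zero] at this
    exact this.symm
  · exact hP2 (Sum.inr j) (hev0 _ fun x => (hev x _ _).trans (hj x x.2))
  · obtain ⟨e, u, hu, h⟩ := hP3 Q
    refine ⟨e, u, fun H => hu (hev0 _ fun x => ?_), fun x g y hy => ?_⟩
    · rw [← H x x.2, ← hevw x]
      rfl
    · refine h (Sum.elim x g) (Sum.elim x y) ?_
      rintro (i | j)
      · rw [hP0 _ ⟨i, rfl⟩]
        simp
      · exact hy j

theorem Polynomial.eval₂_eq_sum_fin {R : Type*} [CommRing R] (φ : R →+* ℂ) (t : ℂ) {N : ℕ}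
    {r : Polynomial R} (hr : r.degree < N) :
    Polynomial.eval₂ φ t r = ∑ s : Fin N, φ (r.coeff s) * t ^ (s : ℕ) := by
  rw [Fin.sum_univ_eq_sum_range (fun s => φ (r.coeff s) * t ^ s) N]
  by_cases h0 : r = 0
  · simp [h0]
  · exact Polynomial.eval₂_eq_sum_range' φ ((Polynomial.natDegree_lt_iff_degree_lt h0).2 hr) t

section GenericDivision

variable {m p : ℕ} {κ : Type*} [Fintype κ]

/-- The index set of the coefficients of the numerators and of the divisor. -/
abbrev DivIndex (κ : Type*) (p : ℕ) : Type _ := (κ × Fin (2 * p)) ⊕ Fin p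

theorem differentiable_eval₂_sumElim (r : Polynomial (MvPolynomial (Fin m ⊕ DivIndex κ p) ℂ)) :
    Differentiable ℂ fun z : ((Fin m → ℂ) × ℂ) × ((DivIndex κ p → ℂ) × (κ → ℂ)) =>
      Polynomial.eval₂ (MvPolynomial.eval (Sum.elim z.1.1 z.2.1)) z.1.2 r := by
  induction r using Polynomial.induction_on' with
  | add p q hp hq =>
    simp only [Polynomial.eval₂_add]
    exact hp.fun_add hq
  | monomial k c =>
    simp only [Polynomial.eval₂_monomial]
    refine Differentiable.fun_mul ((MvPolynomial.differentiable_eval c).comp ?_) ?_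
    · refine differentiable_pi.2 ?_
      rintro (i | j)
      · simp only [Sum.elim_inl]
        fun_prop
      · simp only [Sum.elim_inr]
        fun_prop
    · fun_prop

/-- The divisor with coefficients `b`. -/
def divisorVal (b : DivIndex κ p → ℂ) (t : ℂ) : ℂ :=
  t ^ p + ∑ s : Fin p, b (Sum.inr s) * t ^ (s : ℕ)

/-- The remainders with coefficients `b`. -/
def remainderVal (b : DivIndex κ p → ℂ) (t : ℂ) (j : κ) : ℂ :=
  ∑ s : Fin (2 * p), b (Sum.inl (j, s)) * t ^ (s : ℕ)

theorem differentiable_divisorVal :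
    Differentiable ℂ fun z : (DivIndex κ p → ℂ) × ℂ => divisorVal z.1 z.2 := by
  unfold divisorVal
  fun_prop

theorem differentiable_remainderVal (j : κ) :
    Differentiable ℂ fun z : (DivIndex κ p → ℂ) × ℂ => remainderVal z.1 z.2 j := by
  unfold remainderVal
  fun_prop

theorem exists_generic_substitution (L : ((Fin m → ℂ) × ℂ) →L[ℂ] (Fin (m + 1) → ℂ))
    (R : MvPolynomial (Fin (m + 1) ⊕ κ) ℂ) :
    ∃ (r : Polynomial (MvPolynomial (Fin m ⊕ DivIndex κ p) ℂ))
      (C : ((Fin m → ℂ) × ℂ) × ((DivIndex κ p → ℂ) × (κ → ℂ)) → ℂ), Differentiable ℂ C ∧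
      ∀ x t b h, MvPolynomial.eval (Sum.elim (L (x, t))
          fun j => remainderVal b t j + divisorVal b t ^ 2 * h j) R =
        Polynomial.eval₂ (MvPolynomial.eval (Sum.elim x b)) t r +
          divisorVal b t ^ 2 * C ((x, t), (b, h)) := by
  have hdiv : Differentiable ℂ fun z : ((Fin m → ℂ) × ℂ) × ((DivIndex κ p → ℂ) × (κ → ℂ)) =>
      divisorVal z.2.1 z.1.2 :=
    differentiable_divisorVal.comp (f := fun z : ((Fin m → ℂ) × ℂ) ×
      ((DivIndex κ p → ℂ) × (κ → ℂ)) => (z.2.1, z.1.2)) (by fun_prop)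
  have hrem : ∀ j, Differentiable ℂ fun z : ((Fin m → ℂ) × ℂ) ×
      ((DivIndex κ p → ℂ) × (κ → ℂ)) => remainderVal z.2.1 z.1.2 j := fun j =>
    (differentiable_remainderVal j).comp (f := fun z : ((Fin m → ℂ) × ℂ) ×
      ((DivIndex κ p → ℂ) × (κ → ℂ)) => (z.2.1, z.1.2)) (by fun_prop)
  induction R using MvPolynomial.induction_on with
  | C c =>
    refine ⟨Polynomial.C (MvPolynomial.C c), fun _ => 0, differentiable_const 0, ?_⟩
    intro x t b h
    simp
  | add R₁ R₂ h₁ h₂ =>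
    obtain ⟨r₁, C₁, d₁, e₁⟩ := h₁
    obtain ⟨r₂, C₂, d₂, e₂⟩ := h₂
    refine ⟨r₁ + r₂, fun z => C₁ z + C₂ z, d₁.fun_add d₂, fun x t b h => ?_⟩
    rw [map_add, e₁, e₂, Polynomial.eval₂_add]
    ring
  | mul_X R i h =>
    obtain ⟨r, C, d, e⟩ := h
    rcases i with i | j
    · refine ⟨r * (Polynomial.C (∑ l, MvPolynomial.C (L (Pi.single l 1, 0) i) *
          MvPolynomial.X (Sum.inl l)) +
          Polynomial.C (MvPolynomial.C (L (0, 1) i)) * Polynomial.X),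
        fun z => C z * L z.1 i, d.fun_mul ?_, fun x t b h => ?_⟩
      · fun_prop
      · have hL : L (x, t) i = ∑ l, L (Pi.single l 1, 0) i * x l + L (0, 1) i * t := by
          have h1 : ((x, t) : (Fin m → ℂ) × ℂ) =
              ∑ l, x l • ((Pi.single l 1, 0) : (Fin m → ℂ) × ℂ) + t • ((0, 1) :
                (Fin m → ℂ) × ℂ) := by
            refine Prod.ext ?_ ?_
            · simp only [Prod.fst_add, Prod.fst_sum, Prod.smul_fst, smul_zero, add_zero]
              exact pi_eq_sum_univ' x
            · simp [Prod.snd_sum]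
          conv_lhs => rw [h1]
          rw [map_add, map_sum]
          simp only [map_smul, Pi.add_apply, Finset.sum_apply, Pi.smul_apply, smul_eq_mul, mul_comm]
        have hl : Polynomial.eval₂ (MvPolynomial.eval (Sum.elim x b)) t
            (Polynomial.C (∑ l, MvPolynomial.C (L (Pi.single l 1, 0) i) *
              MvPolynomial.X (Sum.inl l)) +
              Polynomial.C (MvPolynomial.C (L (0, 1) i)) * Polynomial.X) = L (x, t) i := by
          rw [hL, Polynomial.eval₂_add, Polynomial.eval₂_C, map_sum]
          simp
        rw [map_mul, MvPolynomial.eval_X, e, Polynomial.eval₂_mul, Sum.elim_inl, hl]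
        ring
    · refine ⟨r * ∑ s : Fin (2 * p), Polynomial.C (MvPolynomial.X (Sum.inr (Sum.inl (j, s)))) *
          Polynomial.X ^ (s : ℕ),
        fun z => C z * (remainderVal z.2.1 z.1.2 j + divisorVal z.2.1 z.1.2 ^ 2 * z.2.2 j) +
          Polynomial.eval₂ (MvPolynomial.eval (Sum.elim z.1.1 z.2.1)) z.1.2 r * z.2.2 j,
        ?_, fun x t b h => ?_⟩
      · refine (d.fun_mul ((hrem j).fun_add ((hdiv.fun_pow 2).fun_mul ?_))).fun_add
          ((differentiable_eval₂_sumElim r).fun_mul ?_) <;> fun_prop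
      · rw [map_mul, MvPolynomial.eval_X, e, Polynomial.eval₂_mul, Sum.elim_inr]
        simp only [Polynomial.eval₂_finsetSum, Polynomial.eval₂_mul, Polynomial.eval₂_C,
          Polynomial.eval₂_X_pow, MvPolynomial.eval_X, Sum.elim_inr]
        rw [remainderVal]
        ring

theorem exists_generic_division (L : ((Fin m → ℂ) × ℂ) →L[ℂ] (Fin (m + 1) → ℂ)) {N : ℕ}
    (hN : N ≤ 2) (R : MvPolynomial (Fin (m + 1) ⊕ κ) ℂ) :
    ∃ (E : Fin (N * p) → MvPolynomial (Fin m ⊕ DivIndex κ p) ℂ)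
      (C : ((Fin m → ℂ) × ℂ) × ((DivIndex κ p → ℂ) × (κ → ℂ)) → ℂ), Differentiable ℂ C ∧
      ∀ x t b h, MvPolynomial.eval (Sum.elim (L (x, t))
          fun j => remainderVal b t j + divisorVal b t ^ 2 * h j) R =
        divisorVal b t ^ N * C ((x, t), (b, h)) +
          ∑ s, MvPolynomial.eval (Sum.elim x b) (E s) * t ^ (s : ℕ) := by
  obtain ⟨r, C, d, e⟩ := exists_generic_substitution (p := p) L R
  let A : Polynomial (MvPolynomial (Fin m ⊕ DivIndex κ p) ℂ) :=
    monicPoly fun s : Fin p => MvPolynomial.X (Sum.inr (Sum.inr s))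
  have hA : (A ^ N).Monic := (monic_monicPoly _).pow N
  have hAd : (A ^ N).degree = ((N * p : ℕ) : WithBot ℕ) := by
    rw [Polynomial.degree_eq_natDegree hA.ne_zero, (monic_monicPoly _).natDegree_pow,
      natDegree_monicPoly]
  have hAe : ∀ (x : Fin m → ℂ) (t : ℂ) (b : DivIndex κ p → ℂ),
      Polynomial.eval₂ (MvPolynomial.eval (Sum.elim x b)) t A = divisorVal b t := by
    intro x t b
    simp [A, monicPoly, divisorVal, Polynomial.eval₂_finsetSum]
  have hdiv : Differentiable ℂ fun z : ((Fin m → ℂ) × ℂ) × ((DivIndex κ p → ℂ) × (κ → ℂ)) =>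
      divisorVal z.2.1 z.1.2 :=
    differentiable_divisorVal.comp (f := fun z : ((Fin m → ℂ) × ℂ) ×
      ((DivIndex κ p → ℂ) × (κ → ℂ)) => (z.2.1, z.1.2)) (by fun_prop)
  refine ⟨fun s => (r %ₘ A ^ N).coeff s, fun z =>
    Polynomial.eval₂ (MvPolynomial.eval (Sum.elim z.1.1 z.2.1)) z.1.2 (r /ₘ A ^ N) +
      divisorVal z.2.1 z.1.2 ^ (2 - N) * C z,
    (differentiable_eval₂_sumElim _).fun_add ((hdiv.fun_pow _).fun_mul d), fun x t b h => ?_⟩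
  rw [e, ← Polynomial.eval₂_eq_sum_fin _ _ (hAd ▸ Polynomial.degree_modByMonic_lt r hA)]
  conv_lhs => rw [← Polynomial.modByMonic_add_div r (A ^ N)]
  rw [Polynomial.eval₂_add, Polynomial.eval₂_mul, Polynomial.eval₂_pow, hAe,
    ← Nat.add_sub_of_le hN, pow_add]
  simp only [Nat.add_sub_cancel_left]
  ring

end GenericDivision

theorem MvPolynomial.differentiable_eval₂ {σ : Type*} [Finite σ]
    (P : Polynomial (MvPolynomial σ ℂ)) :
    Differentiable ℂ fun z : (σ → ℂ) × ℂ => Polynomial.eval₂ (MvPolynomial.eval z.1) z.2 P := by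
  have := Fintype.ofFinite σ
  induction P using Polynomial.induction_on' with
  | add p q hp hq =>
    simp only [Polynomial.eval₂_add]
    exact hp.fun_add hq
  | monomial k c =>
    simp only [Polynomial.eval₂_monomial]
    refine Differentiable.fun_mul ((MvPolynomial.differentiable_eval c).comp ?_) ?_ <;> fun_prop

theorem Polynomial.eval₂_add_mul_eq_taylor {R : Type*} [CommRing R] (φ : R →+* ℂ)
    (P : Polynomial R) (a D w : ℂ) {N : ℕ} (hN : P.natDegree < N + 2) :
    Polynomial.eval₂ φ (a + D * w) P = Polynomial.eval₂ φ a P +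
      Polynomial.eval₂ φ a (Polynomial.derivative P) * (D * w) + (D * w) ^ 2 *
        ∑ i : Fin N, Polynomial.eval₂ φ a (Polynomial.hasseDeriv (i + 2) P) * D ^ (i : ℕ) *
          w ^ (i : ℕ) := by
  have hm : ∀ k, (Polynomial.hasseDeriv k P).map φ = Polynomial.hasseDeriv k (P.map φ) := by
    intro k
    ext i
    simp [Polynomial.hasseDeriv_coeff]
  have hd : ((Polynomial.taylor a (P.map φ)).natDegree) < N + 2 := by
    rw [Polynomial.natDegree_taylor]
    exact Polynomial.natDegree_map_le.trans_lt hN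
  have h := Polynomial.taylor_eval a (P.map φ) (D * w)
  rw [Polynomial.eval_eq_sum_range' hd, Finset.sum_range_succ', Finset.sum_range_succ'] at h
  simp only [Polynomial.taylor_coeff, ← hm, Polynomial.eval_map] at h
  rw [add_comm a, ← h, Finset.mul_sum,
    Fin.sum_univ_eq_sum_range (fun i => (D * w) ^ 2 * (Polynomial.eval₂ φ a
      (Polynomial.hasseDeriv (i + 2) P) * D ^ i * w ^ i)) N]
  simp only [zero_add, Polynomial.hasseDeriv_one, Polynomial.hasseDeriv_zero, LinearMap.id_apply,
    pow_one, pow_zero, mul_one]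
  rw [add_comm, add_comm (Finset.sum _ _), ← add_assoc]
  congr 1
  refine Finset.sum_congr rfl fun i _ => ?_
  ring

/-- Newton correction: a root modulo the square of the derivative can be corrected to a root. -/
theorem exists_newton_correction {σ Y : Type*} [Finite σ] [NormedAddCommGroup Y] [NormedSpace ℂ Y]
    {Θ : Y → σ → ℂ} (hΘ : Differentiable ℂ Θ) (P : Polynomial (MvPolynomial σ ℂ)) (j : σ)
    {c : Y → ℂ} {y₀ : Y} (hc : ∀ᶠ y in 𝓝 y₀, DifferentiableAt ℂ c y) (hc0 : c y₀ = 0) :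
    ∃ F : Y → ℂ, ∀ᶠ y in 𝓝 y₀, DifferentiableAt ℂ F y ∧
      (Polynomial.eval₂ (MvPolynomial.eval (Θ y)) (Θ y j) P =
        Polynomial.eval₂ (MvPolynomial.eval (Θ y)) (Θ y j) (Polynomial.derivative P) ^ 2 * c y →
        Polynomial.eval₂ (MvPolynomial.eval (Θ y)) (F y) P = 0) ∧
      (c y = 0 → F y = Θ y j) := by
  have := Fintype.ofFinite σ
  have hpoly : ∀ R : Polynomial (MvPolynomial σ ℂ), Differentiable ℂ fun y =>
      Polynomial.eval₂ (MvPolynomial.eval (Θ y)) (Θ y j) R := fun R =>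
    (MvPolynomial.differentiable_eval₂ R).comp (f := fun y => (Θ y, Θ y j)) (by fun_prop)
  set N := P.natDegree with hN
  set D : Y → ℂ := fun y => Polynomial.eval₂ (MvPolynomial.eval (Θ y)) (Θ y j)
    (Polynomial.derivative P) with hD
  have hDd : Differentiable ℂ D := hpoly _
  set b : Y → Fin N → ℂ := fun y i => Polynomial.eval₂ (MvPolynomial.eval (Θ y)) (Θ y j)
    (Polynomial.hasseDeriv (i + 2) P) * D y ^ (i : ℕ) with hb
  have hbd : Differentiable ℂ b := differentiable_pi.2 fun i => (hpoly _).fun_mul (hDd.fun_pow _)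
  obtain ⟨η, hη, φ, hφ, hφr⟩ := exists_small_root N (b y₀)
  have hcont : ContinuousAt (fun y => (c y, b y)) y₀ :=
    hc.self_of_nhds.continuousAt.prodMk hbd.continuous.continuousAt
  have hmem : ∀ᶠ y in 𝓝 y₀, (c y, b y) ∈ Metric.ball ((0 : ℂ), b y₀) η := by
    refine hcont.eventually_mem ?_
    rw [hc0]
    exact Metric.ball_mem_nhds _ hη
  refine ⟨fun y => Θ y j + D y * φ (c y, b y), ?_⟩
  filter_upwards [hmem, hc] with y hy hcy
  obtain ⟨h1, h2⟩ := hφr _ hy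
  refine ⟨?_, fun heq => ?_, fun h0 => ?_⟩
  · have h3 : DifferentiableAt ℂ φ (c y, b y) :=
      (hφ _ hy).differentiableAt (Metric.isOpen_ball.mem_nhds hy)
    have h4 : DifferentiableAt ℂ (fun y => φ (c y, b y)) y :=
      h3.comp y (f := fun y => (c y, b y)) (hcy.prodMk (hbd y))
    have h5 : DifferentiableAt ℂ (fun y => Θ y j) y := by fun_prop
    exact h5.fun_add ((hDd y).fun_mul h4)
  · rw [Polynomial.eval₂_add_mul_eq_taylor _ P _ _ _ (N := N) (by omega), heq]
    have h6 : D y ^ 2 * (c y + φ (c y, b y) + φ (c y, b y) ^ 2 *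
      ∑ i : Fin N, b y i * φ (c y, b y) ^ (i : ℕ)) = 0 := by rw [h1, mul_zero]
    rw [← h6]
    simp only [hb, hD]
    ring
  · rw [h0, norm_zero, mul_zero] at h2
    have h3 : φ (c y, b y) = 0 := by
      rw [h0]
      exact norm_le_zero_iff.1 h2
    simp only [h3, mul_zero, add_zero]

/-- `g` satisfies a nonzero polynomial equation on `Ω`. -/
def AlgOn {n : ℕ} (Ω : Set (Fin n → ℂ)) (g : (Fin n → ℂ) → ℂ) : Prop :=
  ∃ P : Polynomial (MvPolynomial (Fin n) ℂ), P ≠ 0 ∧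
    ∀ x ∈ Ω, Polynomial.eval₂ (MvPolynomial.eval x) (g x) P = 0

theorem AlgOn.mono {n : ℕ} {Ω Ω' : Set (Fin n → ℂ)} {g : (Fin n → ℂ) → ℂ} (h : AlgOn Ω g)
    (hs : Ω' ⊆ Ω) : AlgOn Ω' g :=
  h.imp fun _ hP => ⟨hP.1, fun x hx => hP.2 x (hs hx)⟩

theorem AlgOn.comp_eval {m n : ℕ} {Ω : Set (Fin m → ℂ)} {Ω' : Set (Fin n → ℂ)}
    {g : (Fin m → ℂ) → ℂ} (h : AlgOn Ω g) (l : Fin m → MvPolynomial (Fin n) ℂ)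
    (hl : Function.Surjective fun (x : Fin n → ℂ) i => MvPolynomial.eval x (l i))
    (hm : ∀ x ∈ Ω', (fun i => MvPolynomial.eval x (l i)) ∈ Ω) :
    AlgOn Ω' fun x => g fun i => MvPolynomial.eval x (l i) := by
  obtain ⟨P, hP, h⟩ := h
  have heval : ∀ x, (MvPolynomial.eval x).comp (MvPolynomial.aeval (R := ℂ) l).toRingHom =
      MvPolynomial.eval fun i => MvPolynomial.eval x (l i) := by
    intro x
    apply MvPolynomial.ringHom_ext
    · intro r
      simp
    · intro i
      simp
  have hinj : Function.Injective (MvPolynomial.aeval (R := ℂ) l).toRingHom := by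
    refine (injective_iff_map_eq_zero _).2 fun q hq => MvPolynomial.funext fun y => ?_
    obtain ⟨x, rfl⟩ := hl y
    dsimp only
    rw [← heval, RingHom.comp_apply, hq, map_zero, map_zero]
  refine ⟨P.map (MvPolynomial.aeval l).toRingHom, fun h0 => hP ?_, fun x hx => ?_⟩
  · exact Polynomial.map_injective _ hinj (h0.trans (Polynomial.map_zero _).symm)
  · rw [Polynomial.eval₂_map, heval]
    exact h _ (hm x hx)

theorem ContinuousLinearMap.exists_eval_eq {m n : ℕ} (l : (Fin n → ℂ) →L[ℂ] (Fin m → ℂ)) :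
    ∃ q : Fin m → MvPolynomial (Fin n) ℂ, ∀ x, (fun i => MvPolynomial.eval x (q i)) = l x := by
  refine ⟨fun i => ∑ k, MvPolynomial.C (l (Pi.single k 1) i) * MvPolynomial.X k, fun x => ?_⟩
  ext i
  conv_rhs => rw [pi_eq_sum_univ' x, map_sum]
  simp [mul_comm]

/-- The restriction of polynomials to `Ω`. -/
noncomputable def polyToHol {n : ℕ} (Ω : Set (Fin n → ℂ)) :
    MvPolynomial (Fin n) ℂ →ₐ[ℂ] holAlgebra Ω :=
  MvPolynomial.aeval fun i => ⟨fun x => x.1 i, fun x => x i,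
    (differentiable_apply i).differentiableOn, fun _ => rfl⟩

theorem polyToHol_apply {n : ℕ} (Ω : Set (Fin n → ℂ)) (p : MvPolynomial (Fin n) ℂ) (x : Ω) :
    (polyToHol Ω p).1 x = MvPolynomial.eval x.1 p := by
  let ev : holAlgebra Ω →+* ℂ := (Pi.evalRingHom _ x).comp (holAlgebra Ω).val.toRingHom
  have : ev.comp (polyToHol Ω).toRingHom = MvPolynomial.eval x.1 := by
    apply MvPolynomial.ringHom_ext
    · intro r
      simp only [RingHom.comp_apply, AlgHom.toRingHom_eq_coe, RingHom.coe_coe,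
        MvPolynomial.eval_C, MvPolynomial.algHom_C]
      rfl
    · intro i
      simp only [polyToHol, RingHom.comp_apply, AlgHom.toRingHom_eq_coe, RingHom.coe_coe,
        MvPolynomial.aeval_X, MvPolynomial.eval_X]
      rfl
  exact RingHom.congr_fun this p

theorem exists_algebraic_subalgebra {n : ℕ} {Ω : Set (Fin n → ℂ)} (hΩ : IsOpen Ω)
    (hc : Convex ℝ Ω) (hne : Ω.Nonempty) :
    ∃ A : Subalgebra ℂ (holAlgebra Ω),
      (∀ (h : holAlgebra Ω) (g : (Fin n → ℂ) → ℂ), (∀ x : Ω, h.1 x = g x) →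
        (h ∈ A ↔ AlgOn Ω g)) ∧ ∀ h : holAlgebra Ω, IsAlgebraic A h → h ∈ A := by
  have := isDomain_holAlgebra hΩ hc hne
  let R := MvPolynomial (Fin n) ℂ
  let : Algebra R (holAlgebra Ω) := (polyToHol Ω).toRingHom.toAlgebra
  have hinj : Function.Injective (polyToHol Ω) := by
    refine (injective_iff_map_eq_zero _).2 fun p hp => ?_
    refine MvPolynomial.eq_zero_of_eval_eq_zero_on_open hΩ hne fun x hx => ?_
    rw [← polyToHol_apply Ω p ⟨x, hx⟩, hp]
    rfl
  have : IsScalarTower ℂ R (holAlgebra Ω) := by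
    refine IsScalarTower.of_algebraMap_eq fun c => ?_
    exact ((polyToHol Ω).commutes c).symm
  refine ⟨(Subalgebra.algebraicClosure R (holAlgebra Ω)).restrictScalars ℂ, fun h g hg => ?_,
    fun h hh => ?_⟩
  · have hev : ∀ (x : Ω) (P : Polynomial R), (Polynomial.aeval h P).1 x =
        Polynomial.eval₂ (MvPolynomial.eval x.1) (g x) P := by
      intro x P
      let ev : holAlgebra Ω →+* ℂ := (Pi.evalRingHom _ x).comp (holAlgebra Ω).val.toRingHom
      change ev (Polynomial.aeval h P) = _
      rw [Polynomial.aeval_def, Polynomial.hom_eval₂]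
      have h1 : ev.comp (algebraMap R (holAlgebra Ω)) = MvPolynomial.eval x.1 :=
        RingHom.ext fun p => polyToHol_apply Ω p x
      rw [h1, ← hg x]
      rfl
    rw [Subalgebra.mem_restrictScalars, Subalgebra.mem_algebraicClosure]
    refine exists_congr fun P => and_congr Iff.rfl ⟨fun H x hx => ?_, fun H => ?_⟩
    · rw [← hev ⟨x, hx⟩, H]
      rfl
    · exact Subtype.ext (funext fun x => (hev x P).trans (H x x.2))
  · rw [Subalgebra.mem_restrictScalars, Subalgebra.mem_algebraicClosure]
    have : IsAlgebraic (Subalgebra.algebraicClosure R (holAlgebra Ω)) h := hh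
    have hA : Algebra.IsAlgebraic R (Subalgebra.algebraicClosure R (holAlgebra Ω)) := by
      infer_instance
    exact this.restrictScalars R

section HolAlg

variable {n : ℕ} {Ω : Set (Fin n → ℂ)}

/-- Restriction of a holomorphic function to an element of `holAlgebra Ω`. -/
def holRestrict {g : (Fin n → ℂ) → ℂ} (hg : DifferentiableOn ℂ g Ω) : holAlgebra Ω :=
  ⟨fun x => g x, g, hg, fun _ => rfl⟩

/-- The algebra of functions which are holomorphic and algebraic on `Ω`. -/
def algFun (hΩ : IsOpen Ω) (hc : Convex ℝ Ω) (hne : Ω.Nonempty) :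
    Subalgebra ℂ ((Fin n → ℂ) → ℂ) where
  carrier := {g | DifferentiableOn ℂ g Ω ∧ AlgOn Ω g}
  add_mem' := by
    rintro g₁ g₂ ⟨d₁, h₁⟩ ⟨d₂, h₂⟩
    obtain ⟨A, hA, -⟩ := exists_algebraic_subalgebra hΩ hc hne
    exact ⟨d₁.add d₂, (hA (holRestrict d₁ + holRestrict d₂) _ fun _ => rfl).1
      (add_mem ((hA (holRestrict d₁) _ fun _ => rfl).2 h₁)
        ((hA (holRestrict d₂) _ fun _ => rfl).2 h₂))⟩
  mul_mem' := by
    rintro g₁ g₂ ⟨d₁, h₁⟩ ⟨d₂, h₂⟩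
    obtain ⟨A, hA, -⟩ := exists_algebraic_subalgebra hΩ hc hne
    exact ⟨d₁.mul d₂, (hA (holRestrict d₁ * holRestrict d₂) _ fun _ => rfl).1
      (mul_mem ((hA (holRestrict d₁) _ fun _ => rfl).2 h₁)
        ((hA (holRestrict d₂) _ fun _ => rfl).2 h₂))⟩
  algebraMap_mem' c := by
    obtain ⟨A, hA, -⟩ := exists_algebraic_subalgebra hΩ hc hne
    exact ⟨differentiableOn_const c, (hA (algebraMap ℂ (holAlgebra Ω) c) _ fun _ => rfl).1
      (A.algebraMap_mem c)⟩

variable {hΩ : IsOpen Ω} {hc : Convex ℝ Ω} {hne : Ω.Nonempty}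

theorem polynomial_mem_algFun (q : MvPolynomial (Fin n) ℂ) :
    (fun x => MvPolynomial.eval x q) ∈ algFun hΩ hc hne :=
  ⟨(MvPolynomial.differentiable_eval q).differentiableOn,
    Polynomial.X - Polynomial.C q, Polynomial.X_sub_C_ne_zero _, fun x _ => by simp⟩

theorem clm_mem_algFun (l : (Fin n → ℂ) →L[ℂ] ℂ) : (fun x => l x) ∈ algFun hΩ hc hne := by
  obtain ⟨q, hq⟩ := (ContinuousLinearMap.pi fun _ : Fin 1 => l).exists_eval_eq
  have : (fun x => l x) = fun x => MvPolynomial.eval x (q 0) := by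
    funext x
    exact (congrFun (hq x) 0).symm
  rw [this]
  exact polynomial_mem_algFun _

theorem polyFun_comp_mem_algFun {V : Type*} [NormedAddCommGroup V] [NormedSpace ℂ V]
    {P : C(V, ℂ)} (hP : P ∈ polyFun V) (l : (Fin n → ℂ) →L[ℂ] V) :
    (fun x => P (l x)) ∈ algFun hΩ hc hne := by
  have hP' := comp_clm_mem_polyFun hP l
  suffices h : ∀ Q ∈ polyFun (Fin n → ℂ), (fun x => Q x) ∈ algFun hΩ hc hne from h _ hP'
  intro Q hQ
  induction hQ using Algebra.adjoin_induction with
  | mem x hx =>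
    obtain ⟨l, rfl⟩ := hx
    exact clm_mem_algFun l
  | algebraMap c => exact (algFun hΩ hc hne).algebraMap_mem c
  | add x y _ _ hx hy => exact add_mem hx hy
  | mul x y _ _ hx hy => exact mul_mem hx hy

theorem algOn_of_root {σ : Type*} {θ : (Fin n → ℂ) → σ → ℂ}
    (hθ : ∀ i, (fun x => θ x i) ∈ algFun hΩ hc hne) (P : Polynomial (MvPolynomial σ ℂ))
    {F : (Fin n → ℂ) → ℂ} (hF : DifferentiableOn ℂ F Ω)
    (hroot : ∀ x ∈ Ω, Polynomial.eval₂ (MvPolynomial.eval (θ x)) (F x) P = 0)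
    {a : Fin n → ℂ} (ha : a ∈ Ω) {t : ℂ}
    (hat : Polynomial.eval₂ (MvPolynomial.eval (θ a)) t P ≠ 0) : AlgOn Ω F := by
  obtain ⟨A, hA, hroots⟩ := exists_algebraic_subalgebra hΩ hc hne
  let ϑ : σ → A := fun i => ⟨holRestrict (hθ i).1, (hA (holRestrict (hθ i).1) _ fun _ => rfl).2
    (hθ i).2⟩
  let ev : Ω → (holAlgebra Ω →+* ℂ) := fun x =>
    (Pi.evalRingHom _ x).comp (holAlgebra Ω).val.toRingHom
  have hev : ∀ x : Ω, ((ev x).comp (algebraMap A (holAlgebra Ω))).comp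
      (MvPolynomial.aeval (R := ℂ) ϑ).toRingHom = MvPolynomial.eval (θ x) := by
    intro x
    apply MvPolynomial.ringHom_ext
    · intro r
      simp only [RingHom.comp_apply, AlgHom.toRingHom_eq_coe, RingHom.coe_coe,
        MvPolynomial.eval_C, MvPolynomial.algHom_C]
      rfl
    · intro i
      simp only [RingHom.comp_apply, AlgHom.toRingHom_eq_coe, RingHom.coe_coe,
        MvPolynomial.aeval_X, MvPolynomial.eval_X]
      rfl
  refine (hA (holRestrict hF) F fun _ => rfl).1 (hroots _ ?_)
  refine ⟨P.map (MvPolynomial.aeval (R := ℂ) ϑ).toRingHom, fun h0 => hat ?_, ?_⟩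
  · rw [← hev ⟨a, ha⟩, ← Polynomial.eval₂_map, h0, Polynomial.eval₂_zero]
  · refine Subtype.ext (funext fun x => ?_)
    change ev x _ = 0
    rw [Polynomial.aeval_def, Polynomial.hom_eval₂, Polynomial.eval₂_map, hev]
    exact hroot x x.2

end HolAlg

section Setup

variable {m p : ℕ} {κ : Type*}

/-- The space of points together with coefficients of remainders and quotients. -/
abbrev LiftSpace (m p : ℕ) (κ : Type*) : Type _ :=
  ((Fin m → ℂ) × ℂ) × ((DivIndex κ p → ℂ) × (κ → ℂ))

/-- The point of affine space determined by coefficients of remainders and quotients. -/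
noncomputable def liftPoint (L : ((Fin m → ℂ) × ℂ) →L[ℂ] (Fin (m + 1) → ℂ)) (y : LiftSpace m p κ) :
    Fin (m + 1) ⊕ κ → ℂ :=
  Sum.elim (L y.1) fun j => remainderVal y.2.1 y.1.2 j + divisorVal y.2.1 y.1.2 ^ 2 * y.2.2 j

theorem differentiable_liftPoint [Fintype κ]
    (L : ((Fin m → ℂ) × ℂ) →L[ℂ] (Fin (m + 1) → ℂ)) :
    Differentiable ℂ (liftPoint L : LiftSpace m p κ → _) := by
  refine differentiable_pi.2 ?_
  rintro (i | j)
  · simp only [liftPoint, Sum.elim_inl]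
    fun_prop
  · simp only [liftPoint, Sum.elim_inr]
    have h1 : Differentiable ℂ fun y : LiftSpace m p κ => remainderVal y.2.1 y.1.2 j :=
      (differentiable_remainderVal j).comp
        (f := fun y : LiftSpace m p κ => (y.2.1, y.1.2)) (by fun_prop)
    have h2 : Differentiable ℂ fun y : LiftSpace m p κ => divisorVal y.2.1 y.1.2 :=
      differentiable_divisorVal.comp
        (f := fun y : LiftSpace m p κ => (y.2.1, y.1.2)) (by fun_prop)
    exact h1.fun_add ((h2.fun_pow 2).fun_mul (by fun_prop))

/-- Coordinates in which the last axis points in a direction `a` transversal to `x₀ = 0`. -/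
theorem exists_coordinates (a : Fin (m + 1) → ℂ) (ha : a 0 ≠ 0) :
    ∃ L : ((Fin m → ℂ) × ℂ) ≃L[ℂ] (Fin (m + 1) → ℂ), ∀ t : ℂ, L (0, t) = t • a := by
  let L : ((Fin m → ℂ) × ℂ) ≃ₗ[ℂ] (Fin (m + 1) → ℂ) :=
    { toFun := fun z => Fin.cons 0 z.1 + z.2 • a
      invFun := fun x => (Fin.tail x - (x 0 / a 0) • Fin.tail a, x 0 / a 0)
      map_add' := fun y z => by
        ext i
        refine Fin.cases ?_ (fun i => ?_) i
        · simp [add_mul]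
        · simp [add_mul]
          ring
      map_smul' := fun c z => by
        ext i
        refine Fin.cases ?_ (fun i => ?_) i
        · simp [mul_assoc]
        · simp [mul_add, mul_assoc]
      left_inv := fun z => by
        have h : z.2 * a 0 / a 0 = z.2 := by field_simp
        refine Prod.ext ?_ ?_
        · ext i
          simp [Fin.tail, h]
        · simp [h]
      right_inv := fun x => by
        ext i
        refine Fin.cases ?_ (fun i => ?_) i
        · simp
          field_simp
        · simp [Fin.tail] }
  refine ⟨L.toContinuousLinearEquiv, fun t => ?_⟩
  change Fin.cons 0 (0 : Fin m → ℂ) + t • a = t • a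
  have : (Fin.cons 0 (0 : Fin m → ℂ) : Fin (m + 1) → ℂ) = 0 := by
    ext i
    refine Fin.cases ?_ (fun i => ?_) i <;> simp
  rw [this, zero_add]

/-- Weierstrass data reducing a system of equations to one in fewer variables. -/
structure WeierstrassData (m : ℕ) (κ : Type) [Fintype κ]
    (f : (Fin (m + 1) → ℂ) → κ → ℂ) (R : ℝ) (δ : MvPolynomial (Fin (m + 1) ⊕ κ) ℂ)
    (P : κ → MvPolynomial (Fin (m + 1) ⊕ κ) ℂ) where
  p : ℕ
  L : ((Fin m → ℂ) × ℂ) ≃L[ℂ] (Fin (m + 1) → ℂ)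
  B : (Fin m → ℂ) → DivIndex κ p → ℂ
  H : (Fin m → ℂ) × ℂ → κ → ℂ
  ρ : ℝ
  r : ℝ
  ρ_pos : 0 < ρ
  r_pos : 0 < r
  ι : Type
  fintype_ι : Fintype ι
  Q : ι → MvPolynomial (Fin m ⊕ DivIndex κ p) ℂ
  Cδ : LiftSpace m p κ → ℂ
  C : κ → LiftSpace m p κ → ℂ
  L_mem : ∀ z ∈ Metric.ball (0 : Fin m → ℂ) ρ ×ˢ Metric.ball (0 : ℂ) r, L z ∈ Metric.ball 0 R
  B_diff : ∀ i, DifferentiableOn ℂ (fun x => B x i) (Metric.ball 0 ρ)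
  H_diff : ∀ j, DifferentiableOn ℂ (fun z => H z j) (Metric.ball 0 ρ ×ˢ Metric.ball 0 r)
  Cδ_diff : Differentiable ℂ Cδ
  C_diff : ∀ j, Differentiable ℂ (C j)
  f_eq : ∀ z ∈ Metric.ball (0 : Fin m → ℂ) ρ ×ˢ Metric.ball (0 : ℂ) r,
    Sum.elim (L z) (f (L z)) = liftPoint L.toContinuousLinearMap (z, (B z.1, H z))
  Q_eq : ∀ x ∈ Metric.ball (0 : Fin m → ℂ) ρ, ∀ i, MvPolynomial.eval (Sum.elim x (B x)) (Q i) = 0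
  δ_eq : ∀ y : LiftSpace m p κ, (∀ i, MvPolynomial.eval (Sum.elim y.1.1 y.2.1) (Q i) = 0) →
    MvPolynomial.eval (liftPoint L.toContinuousLinearMap y) δ = divisorVal y.2.1 y.1.2 * Cδ y
  P_eq : ∀ j, ∀ y : LiftSpace m p κ,
    (∀ i, MvPolynomial.eval (Sum.elim y.1.1 y.2.1) (Q i) = 0) →
    MvPolynomial.eval (liftPoint L.toContinuousLinearMap y) (P j) =
      divisorVal y.2.1 y.1.2 ^ 2 * C j y
  Cδ_ne : ∀ z ∈ Metric.ball (0 : Fin m → ℂ) ρ ×ˢ Metric.ball (0 : ℂ) r, Cδ (z, (B z.1, H z)) ≠ 0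
  C_eq : ∀ j, ∀ z ∈ Metric.ball (0 : Fin m → ℂ) ρ ×ˢ Metric.ball (0 : ℂ) r,
    C j (z, (B z.1, H z)) = 0

theorem nonempty_weierstrassData {m : ℕ} {κ : Type} [Fintype κ]
    {f : (Fin (m + 1) → ℂ) → κ → ℂ} {R : ℝ} (hR : 0 < R)
    (hf : ∀ j, DifferentiableOn ℂ (fun x => f x j) (Metric.ball 0 R))
    (δ : MvPolynomial (Fin (m + 1) ⊕ κ) ℂ) (P : κ → MvPolynomial (Fin (m + 1) ⊕ κ) ℂ)
    (hδ : ¬ ∀ x ∈ Metric.ball (0 : Fin (m + 1) → ℂ) R,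
      MvPolynomial.eval (Sum.elim x (f x)) δ = 0)
    (hP : ∀ j, ∀ x ∈ Metric.ball (0 : Fin (m + 1) → ℂ) R,
      MvPolynomial.eval (Sum.elim x (f x)) (P j) = 0) :
    Nonempty (WeierstrassData m κ f R δ P) := by
  have hconv : Convex ℝ (Metric.ball (0 : Fin (m + 1) → ℂ) R) := convex_ball _ _
  have hgf : DifferentiableOn ℂ (fun x => (Sum.elim x (f x) : Fin (m + 1) ⊕ κ → ℂ))
      (Metric.ball 0 R) := by
    refine differentiableOn_pi.2 ?_
    rintro (i | j)
    · exact (differentiable_apply i).differentiableOn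
    · exact hf j
  have hgd : DifferentiableOn ℂ (fun x => MvPolynomial.eval (Sum.elim x (f x)) δ)
      (Metric.ball 0 R) := (MvPolynomial.differentiable_eval δ).comp_differentiableOn hgf
  obtain ⟨a, haR, ha⟩ : ∃ a ∈ Metric.ball (0 : Fin (m + 1) → ℂ) R,
      MvPolynomial.eval (Sum.elim a (f a)) δ * a 0 ≠ 0 := by
    by_contra! hall
    rcases eqOn_zero_or_eqOn_zero_of_mul Metric.isOpen_ball hconv hgd
      (differentiable_apply (0 : Fin (m + 1))).differentiableOn hall with h | h
    · exact hδ h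
    · have h1 := h (fun _ => ((R / 2 : ℝ) : ℂ)) (by
        rw [mem_ball_zero_iff, pi_norm_const, Complex.norm_real, Real.norm_eq_abs, abs_of_pos]
          <;> linarith)
      simp only [Complex.ofReal_eq_zero] at h1
      linarith
  obtain ⟨L, hL⟩ := exists_coordinates a (right_ne_zero_of_mul ha)
  obtain ⟨R', hR', hLR⟩ : ∃ R' > 0, ∀ z ∈ Metric.ball (0 : (Fin m → ℂ) × ℂ) R',
      L z ∈ Metric.ball 0 R := by
    have h1 : L ⁻¹' Metric.ball 0 R ∈ 𝓝 0 := L.continuous.continuousAt.preimage_mem_nhds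
      (by rw [map_zero]; exact Metric.ball_mem_nhds _ hR)
    exact Metric.mem_nhds_iff.1 h1
  have hLd : DifferentiableOn ℂ (fun z => L z) (Metric.ball 0 R') :=
    L.differentiable.differentiableOn
  have hdd := hgd.comp hLd hLR
  have hd0 : ¬ ∀ᶠ t in 𝓝 (0 : ℂ), ((fun x => MvPolynomial.eval (Sum.elim x (f x)) δ) ∘
      fun z => L z) ((0 : Fin m → ℂ), t) = 0 := by
    intro hev
    simp only [Function.comp_apply, hL] at hev
    let l : ℂ →L[ℂ] (Fin (m + 1) → ℂ) := (ContinuousLinearMap.id ℂ ℂ).smulRight a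
    have hl : ∀ t, l t = t • a := fun t => rfl
    have hmaps : Set.MapsTo l (l ⁻¹' Metric.ball 0 R) (Metric.ball 0 R) := fun x hx => hx
    have := eqOn_zero_of_eventuallyEq_zero_of_convex (Metric.isOpen_ball.preimage l.continuous)
      (hconv.linear_preimage (l.toLinearMap.restrictScalars ℝ))
      (hgd.comp l.differentiable.differentiableOn hmaps) (a := 0)
      (by
        rw [Set.mem_preimage, map_zero]
        exact Metric.mem_ball_self hR) hev 1
      (by
        rw [Set.mem_preimage, hl, one_smul]
        exact haR)
    simp only [Function.comp_apply, hl, one_smul] at this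
    exact left_ne_zero_of_mul ha this
  obtain ⟨p, α, e, ρ, r, hρ, hr, hsub, hα, he, hde, hroot, hdivf⟩ :=
    weierstrass_preparation hR' hdd hd0
  have hdivj := fun j => hdivf _ ((hf j).comp hLd hLR)
  choose v H hv hH hfeq using hdivj
  set B : (Fin m → ℂ) → DivIndex κ p → ℂ := fun x =>
    Sum.elim (fun js => v js.1 js.2 x) fun s => α s x with hB
  have hBd : ∀ i, DifferentiableOn ℂ (fun x => B x i) (Metric.ball 0 ρ) := by
    rintro (⟨j, s⟩ | s)
    · exact hv j s
    · exact hα s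
  obtain ⟨Eδ, Cδ, hCδ, hEδ⟩ := exists_generic_division (p := p) L.toContinuousLinearMap
    one_le_two δ
  have hdivP := fun j => exists_generic_division (p := p) L.toContinuousLinearMap le_rfl (P j)
  choose E C hC hE using hdivP
  set Z := Metric.ball (0 : Fin m → ℂ) ρ ×ˢ Metric.ball (0 : ℂ) r with hZ
  have hZo : IsOpen Z := Metric.isOpen_ball.prod Metric.isOpen_ball
  have hZc : Convex ℝ Z := (convex_ball _ _).prod (convex_ball _ _)
  have hSd : DifferentiableOn ℂ (fun z : (Fin m → ℂ) × ℂ =>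
      ((z, (B z.1, fun j => H j z)) : LiftSpace m p κ)) Z := by
    refine differentiableOn_id.prodMk (DifferentiableOn.prodMk ?_ ?_)
    · refine differentiableOn_pi.2 fun i => ?_
      exact (hBd i).comp differentiableOn_fst fun z hz => hz.1
    · exact differentiableOn_pi.2 fun j => hH j
  have hlift : ∀ z ∈ Z, Sum.elim (L z) (f (L z)) =
      liftPoint L.toContinuousLinearMap ((z, (B z.1, fun j => H j z)) : LiftSpace m p κ) := by
    intro z hz
    ext (i | j)
    · rfl
    · refine (hfeq j z hz).trans ?_
      rw [add_comm]
      rfl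
  have hδz : ∀ z ∈ Z, MvPolynomial.eval (Sum.elim (L z) (f (L z))) δ =
      divisorVal (B z.1) z.2 * e z := fun z hz => (hde z hz).2
  have hline : ∀ x ∈ Metric.ball (0 : Fin m → ℂ) ρ, Set.MapsTo (fun t : ℂ => (x, t))
      (Metric.ball 0 r) Z := fun x hx t ht => ⟨hx, ht⟩
  have hQδ : ∀ x ∈ Metric.ball (0 : Fin m → ℂ) ρ, ∀ s,
      MvPolynomial.eval (Sum.elim x (B x)) (Eδ s) = 0 := by
    intro x hx s
    refine congrFun (eq_zero_of_sum_eq_monicPoly_pow_mul (N := 1)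
      (c := fun s => MvPolynomial.eval (Sum.elim x (B x)) (Eδ s)) (hroot x hx)
      (h := fun t => e (x, t) - Cδ ((x, t), (B x, fun j => H j (x, t)))) ?_ fun t ht => ?_) s
    · refine ContinuousOn.sub (he.continuousOn.comp (by fun_prop) (hline x hx)) ?_
      exact hCδ.continuous.comp_continuousOn
        (hSd.continuousOn.comp (by fun_prop) (hline x hx))
    · have h1 := hEδ x t (B x) fun j => H j (x, t)
      have h2 := hδz (x, t) ⟨hx, ht⟩
      rw [hlift (x, t) ⟨hx, ht⟩] at h2
      have h3 := h1.symm.trans h2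
      change divisorVal (B x) t ^ 1 * _ + _ = divisorVal (B x) t * _ at h3
      change _ = divisorVal (B x) t ^ 1 * _
      linear_combination h3
  have hQP : ∀ j, ∀ x ∈ Metric.ball (0 : Fin m → ℂ) ρ, ∀ s,
      MvPolynomial.eval (Sum.elim x (B x)) (E j s) = 0 := by
    intro j x hx s
    refine congrFun (eq_zero_of_sum_eq_monicPoly_pow_mul (N := 2)
      (c := fun s => MvPolynomial.eval (Sum.elim x (B x)) (E j s)) (hroot x hx)
      (h := fun t => - C j ((x, t), (B x, fun j => H j (x, t)))) ?_ fun t ht => ?_) s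
    · exact ((hC j).continuous.comp_continuousOn
        (hSd.continuousOn.comp (by fun_prop) (hline x hx))).neg
    · have h1 := hE j x t (B x) fun j => H j (x, t)
      have h2 := hP j (L (x, t)) (hLR _ (hsub ⟨hx, ht⟩))
      rw [hlift (x, t) ⟨hx, ht⟩] at h2
      have h3 := h1.symm.trans h2
      change divisorVal (B x) t ^ 2 * _ + _ = 0 at h3
      change _ = divisorVal (B x) t ^ 2 * _
      linear_combination h3
  have hWd : DifferentiableOn ℂ (fun z : (Fin m → ℂ) × ℂ => divisorVal (B z.1) z.2) Z := by
    refine differentiable_divisorVal.comp_differentiableOn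
      (f := fun z : (Fin m → ℂ) × ℂ => (B z.1, z.2)) (DifferentiableOn.prodMk ?_ ?_)
    · refine differentiableOn_pi.2 fun i => ?_
      exact (hBd i).comp differentiableOn_fst fun z hz => hz.1
    · exact differentiableOn_snd
  have hW0 : ¬ ∀ z ∈ Z, divisorVal (B z.1) z.2 = 0 := by
    intro hall
    apply hd0
    filter_upwards [Metric.ball_mem_nhds (0 : ℂ) hr] with t ht
    have hz : ((0 : Fin m → ℂ), t) ∈ Z := ⟨Metric.mem_ball_self hρ, ht⟩
    exact (hδz _ hz).trans (by rw [hall _ hz, zero_mul])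
  have hdq : ∀ y : LiftSpace m p κ,
      (∀ s, MvPolynomial.eval (Sum.elim y.1.1 y.2.1) (Eδ s) = 0) →
      MvPolynomial.eval (liftPoint L.toContinuousLinearMap y) δ =
        divisorVal y.2.1 y.1.2 * Cδ y := by
    rintro ⟨⟨x, t⟩, b, h⟩ hy
    refine (hEδ x t b h).trans ?_
    rw [pow_one, Finset.sum_eq_zero fun s _ => by rw [hy s, zero_mul], add_zero]
  have hPq : ∀ j, ∀ y : LiftSpace m p κ,
      (∀ s, MvPolynomial.eval (Sum.elim y.1.1 y.2.1) (E j s) = 0) →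
      MvPolynomial.eval (liftPoint L.toContinuousLinearMap y) (P j) =
        divisorVal y.2.1 y.1.2 ^ 2 * C j y := by
    rintro j ⟨⟨x, t⟩, b, h⟩ hy
    refine (hE j x t b h).trans ?_
    rw [Finset.sum_eq_zero fun s _ => by rw [hy s, zero_mul], add_zero]
  have hC0 : ∀ j, ∀ z ∈ Z, C j (z, (B z.1, fun j => H j z)) = 0 := by
    intro j
    have hCd : DifferentiableOn ℂ (fun z => C j (z, (B z.1, fun j => H j z))) Z :=
      (hC j).comp_differentiableOn hSd
    have h1 : ∀ z ∈ Z, divisorVal (B z.1) z.2 *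
        (divisorVal (B z.1) z.2 * C j (z, (B z.1, fun j => H j z))) = 0 := by
      intro z hz
      have h2 := hP j (L z) (hLR z (hsub hz))
      have h3 := hPq j (z, (B z.1, fun j => H j z)) (hQP j z.1 hz.1)
      rw [hlift z hz, h3] at h2
      rw [← mul_assoc, ← pow_two]
      exact h2
    have h2 := (eqOn_zero_or_eqOn_zero_of_mul hZo hZc hWd (hWd.fun_mul hCd) h1).resolve_left hW0
    exact (eqOn_zero_or_eqOn_zero_of_mul hZo hZc hWd hCd h2).resolve_left hW0
  have hCδ0 : ∀ z ∈ Z, Cδ (z, (B z.1, fun j => H j z)) ≠ 0 := by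
    have hCd : DifferentiableOn ℂ (fun z => Cδ (z, (B z.1, fun j => H j z))) Z :=
      hCδ.comp_differentiableOn hSd
    have h1 : ∀ z ∈ Z, divisorVal (B z.1) z.2 *
        (Cδ (z, (B z.1, fun j => H j z)) - e z) = 0 := by
      intro z hz
      have h2 := hδz z hz
      have h3 := hdq (z, (B z.1, fun j => H j z)) (hQδ z.1 hz.1)
      rw [hlift z hz, h3] at h2
      rw [mul_sub, sub_eq_zero]
      exact h2
    have h3 := (eqOn_zero_or_eqOn_zero_of_mul hZo hZc hWd
      (hCd.fun_sub he) h1).resolve_left hW0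
    intro z hz
    have h4 : Cδ (z, (B z.1, fun j => H j z)) = e z := sub_eq_zero.1 (h3 z hz)
    rw [h4]
    exact (hde z hz).1
  refine ⟨{
    p := p
    L := L
    B := B
    H := fun z j => H j z
    ρ := ρ
    r := r
    ρ_pos := hρ
    r_pos := hr
    ι := Fin (1 * p) ⊕ κ × Fin (2 * p)
    fintype_ι := inferInstance
    Q := Sum.elim Eδ fun js => E js.1 js.2
    Cδ := Cδ
    C := C
    L_mem := fun z hz => hLR z (hsub hz)
    B_diff := hBd
    H_diff := hH
    Cδ_diff := hCδ
    C_diff := hC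
    f_eq := hlift
    Q_eq := ?_
    δ_eq := fun y hy => hdq y fun s => hy (Sum.inl s)
    P_eq := fun j y hy => hPq j y fun s => hy (Sum.inr (j, s))
    Cδ_ne := ?_
    C_eq := ?_ }⟩
  · rintro x hx (s | ⟨j, s⟩)
    · exact hQδ x hx s
    · exact hQP j x hx s
  · exact hCδ0
  · exact hC0

end Setup

section Correction

variable {m : ℕ} {κ : Type} [Fintype κ] [DecidableEq κ] {f : (Fin (m + 1) → ℂ) → κ → ℂ} {R : ℝ}

theorem Polynomial.eval₂_eval_eq {σ : Type*} (v : σ → ℂ) (s : σ)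
    (P : Polynomial (MvPolynomial σ ℂ)) :
    Polynomial.eval₂ (MvPolynomial.eval v) (v s) P =
      MvPolynomial.eval v (P.eval (MvPolynomial.X s)) := by
  rw [← Polynomial.eval₂_at_apply, MvPolynomial.eval_X]

theorem WeierstrassData.exists_correction {P : κ → Polynomial (MvPolynomial (Fin (m + 1) ⊕ κ) ℂ)}
    {D E : κ → MvPolynomial (Fin (m + 1) ⊕ κ) ℂ}
    {δ : MvPolynomial (Fin (m + 1) ⊕ κ) ℂ} (W : WeierstrassData m κ f R δ E)
    (hδ : ∏ j, D j = δ)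
    (hD : ∀ j, D j = (Polynomial.derivative (P j)).eval (MvPolynomial.X (Sum.inr j)))
    (hE : ∀ j, E j = (P j).eval (MvPolynomial.X (Sum.inr j))) :
    ∃ F : LiftSpace m W.p κ → κ → ℂ, ∀ᶠ y in 𝓝 (0, (W.B 0, W.H 0)), DifferentiableAt ℂ F y ∧
      ((∀ i, MvPolynomial.eval (Sum.elim y.1.1 y.2.1) (W.Q i) = 0) → ∀ j,
        Polynomial.eval₂ (MvPolynomial.eval (liftPoint W.L.toContinuousLinearMap y)) (F y j)
          (P j) = 0) ∧
      ((∀ j, W.C j y = 0) → ∀ j, F y j = liftPoint W.L.toContinuousLinearMap y (Sum.inr j)) := by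
  set Θ : LiftSpace m W.p κ → Fin (m + 1) ⊕ κ → ℂ := liftPoint W.L.toContinuousLinearMap with hΘ
  have hΘd : Differentiable ℂ Θ := differentiable_liftPoint _
  set y₀ : LiftSpace m W.p κ := (0, (W.B 0, W.H 0)) with hy₀
  have h0 : (0 : (Fin m → ℂ) × ℂ) ∈ Metric.ball (0 : Fin m → ℂ) W.ρ ×ˢ Metric.ball (0 : ℂ) W.r :=
    ⟨Metric.mem_ball_self W.ρ_pos, Metric.mem_ball_self W.r_pos⟩
  have hCδ0 : W.Cδ y₀ ≠ 0 := W.Cδ_ne 0 h0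
  have hC0 : ∀ j, W.C j y₀ = 0 := fun j => W.C_eq j 0 h0
  have hCδne : ∀ᶠ y in 𝓝 y₀, W.Cδ y ≠ 0 :=
    W.Cδ_diff.continuous.continuousAt.eventually_ne hCδ0
  have hpoly : ∀ q : MvPolynomial (Fin (m + 1) ⊕ κ) ℂ,
      Differentiable ℂ fun y => MvPolynomial.eval (Θ y) q := fun q =>
    (MvPolynomial.differentiable_eval q).comp hΘd
  set c : κ → LiftSpace m W.p κ → ℂ := fun j y =>
    MvPolynomial.eval (Θ y) (∏ i ∈ Finset.univ.erase j, D i) ^ 2 * W.C j y / W.Cδ y ^ 2 with hc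
  have hcd : ∀ j, ∀ᶠ y in 𝓝 y₀, DifferentiableAt ℂ (c j) y := by
    intro j
    filter_upwards [hCδne] with y hy
    simp only [hc, div_eq_mul_inv]
    exact ((((hpoly _).fun_pow 2).fun_mul (W.C_diff j)) y).fun_mul
      (((W.Cδ_diff.fun_pow 2) y).fun_inv (pow_ne_zero 2 hy))
  have hc0 : ∀ j y, W.C j y = 0 → c j y = 0 := fun j y h => by
    simp only [hc, h, mul_zero, zero_div]
  have hN := fun j => exists_newton_correction hΘd (P j) (Sum.inr j) (hcd j) (hc0 j y₀ (hC0 j))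
  choose F hF using hN
  refine ⟨fun y j => F j y, ?_⟩
  filter_upwards [hCδne, eventually_all.2 hF] with y hy hFy
  refine ⟨differentiableAt_pi.2 fun j => (hFy j).1, fun hQ j => (hFy j).2.1 ?_,
    fun h j => (hFy j).2.2 (hc0 j y (h j))⟩
  rw [Polynomial.eval₂_eval_eq, Polynomial.eval₂_eval_eq, ← hD, ← hE, W.P_eq j y hQ]
  have h1 : MvPolynomial.eval (Θ y) (D j) *
      MvPolynomial.eval (Θ y) (∏ i ∈ Finset.univ.erase j, D i) =
      divisorVal y.2.1 y.1.2 * W.Cδ y := by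
    rw [← map_mul, Finset.mul_prod_erase _ _ (Finset.mem_univ j)]
    exact (congrArg _ hδ).trans (W.δ_eq y hQ)
  change _ = MvPolynomial.eval (Θ y) (D j) ^ 2 * c j y
  rw [hc]
  dsimp only
  rw [mul_div_assoc', eq_div_iff (pow_ne_zero 2 hy), ← mul_assoc, ← mul_pow, h1]
  ring

end Correction

theorem eventually_algOn_of_roots {n : ℕ} {κ ι : Type*} [Finite κ] [Finite ι]
    {Ω : Set (Fin n → ℂ)} (hΩ : IsOpen Ω) (hc : Convex ℝ Ω) (hne : Ω.Nonempty)
    {f : (Fin n → ℂ) → κ → ℂ}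
    {P : κ → Polynomial (MvPolynomial (Fin n ⊕ κ) ℂ)} {Q : ι → MvPolynomial (Fin n ⊕ κ) ℂ}
    (hQ : ∀ x ∈ Ω, ∀ i, MvPolynomial.eval (Sum.elim x (f x)) (Q i) = 0)
    (hP : ∀ j, ∃ x ∈ Ω, Polynomial.eval₂ (MvPolynomial.eval (Sum.elim x (f x))) (f x j)
      (Polynomial.derivative (P j)) ≠ 0)
    (hQP : ∀ i, ∃ (e : ℕ) (u : Polynomial (MvPolynomial (Fin n ⊕ κ) ℂ)),
      (∃ x ∈ Ω, MvPolynomial.eval (Sum.elim x (f x)) (u.coeff 0) ≠ 0) ∧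
      ∀ (x : Fin n → ℂ) (g y : κ → ℂ),
        (∀ j, Polynomial.eval₂ (MvPolynomial.eval (Sum.elim x g)) (y j) (P j) = 0) →
        MvPolynomial.eval (Sum.elim x y) (Q i) ^ e *
          Polynomial.eval₂ (MvPolynomial.eval (Sum.elim x g))
            (MvPolynomial.eval (Sum.elim x y) (Q i)) u = 0)
    {G F : ℕ → (Fin n → ℂ) → κ → ℂ}
    (hG : ∀ᶠ ν in atTop, ∀ j, (fun x => G ν x j) ∈ algFun hΩ hc hne)
    (hF : ∀ᶠ ν in atTop, ∀ j, DifferentiableOn ℂ (fun x => F ν x j) Ω)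
    (hGf : ∀ x ∈ Ω, Tendsto (fun ν => G ν x) atTop (𝓝 (f x)))
    (hFf : ∀ x ∈ Ω, Tendsto (fun ν => F ν x) atTop (𝓝 (f x)))
    (hroot : ∀ᶠ ν in atTop, ∀ x ∈ Ω, ∀ j,
      Polynomial.eval₂ (MvPolynomial.eval (Sum.elim x (G ν x))) (F ν x j) (P j) = 0) :
    ∀ᶠ ν in atTop, (∀ j, AlgOn Ω fun x => F ν x j) ∧
      ∀ x ∈ Ω, ∀ i, MvPolynomial.eval (Sum.elim x (F ν x)) (Q i) = 0 := by
  have := Fintype.ofFinite κ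
  have helim : ∀ x, Continuous fun y : κ → ℂ => (Sum.elim x y : Fin n ⊕ κ → ℂ) := by
    intro x
    refine continuous_pi ?_
    rintro (i | j)
    · exact continuous_const
    · exact continuous_apply j
  have hev : ∀ (x : Fin n → ℂ) (q : MvPolynomial (Fin n ⊕ κ) ℂ),
      Continuous fun y : κ → ℂ => MvPolynomial.eval (Sum.elim x y) q := fun x q =>
    (MvPolynomial.differentiable_eval q).continuous.comp (helim x)
  have hev₂ : ∀ (x : Fin n → ℂ) (q : Polynomial (MvPolynomial (Fin n ⊕ κ) ℂ)),
      Continuous fun y : (κ → ℂ) × ℂ =>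
        Polynomial.eval₂ (MvPolynomial.eval (Sum.elim x y.1)) y.2 q := fun x q =>
    (MvPolynomial.differentiable_eval₂ q).continuous.comp
      (f := fun y : (κ → ℂ) × ℂ => ((Sum.elim x y.1 : Fin n ⊕ κ → ℂ), y.2))
      (((helim x).comp continuous_fst).prodMk continuous_snd)
  have hA : ∀ᶠ ν in atTop, ∀ j, ∃ x ∈ Ω, ∃ t : ℂ,
      Polynomial.eval₂ (MvPolynomial.eval (Sum.elim x (G ν x))) t (P j) ≠ 0 := by
    refine eventually_all.2 fun j => ?_
    obtain ⟨x, hx, hne⟩ := hP j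
    have hpair : Tendsto (fun ν => (G ν x, G ν x j)) atTop (𝓝 (f x, f x j)) :=
      (hGf x hx).prodMk_nhds (tendsto_pi_nhds.1 (hGf x hx) j)
    have hlim := ((hev₂ x (Polynomial.derivative (P j))).tendsto (f x, f x j)).comp hpair
    filter_upwards [hlim.eventually_ne hne] with ν hν
    refine ⟨x, hx, ?_⟩
    by_contra! hall
    apply hν
    have h0 : (P j).map (MvPolynomial.eval (Sum.elim x (G ν x))) = 0 :=
      Polynomial.funext fun t => by
        rw [Polynomial.eval_map, hall t, Polynomial.eval_zero]
    dsimp only [Function.comp_apply]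
    rw [Polynomial.eval₂_eq_eval_map, ← Polynomial.derivative_map, h0, Polynomial.derivative_zero,
      Polynomial.eval_zero]
  have hB : ∀ᶠ ν in atTop, ∀ i, ∀ x ∈ Ω, MvPolynomial.eval (Sum.elim x (F ν x)) (Q i) = 0 := by
    refine eventually_all.2 fun i => ?_
    obtain ⟨e, u, ⟨x, hx, hu⟩, h⟩ := hQP i
    have hlimQ : Tendsto (fun ν => MvPolynomial.eval (Sum.elim x (F ν x)) (Q i)) atTop (𝓝 0) := by
      have h0 := ((hev x (Q i)).tendsto (f x)).comp (hFf x hx)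
      rwa [hQ x hx i] at h0
    have hlim := ((hev₂ x u).tendsto (f x, 0)).comp ((hGf x hx).prodMk_nhds hlimQ)
    dsimp only at hlim
    rw [Polynomial.eval₂_at_zero] at hlim
    filter_upwards [hlim.eventually_ne hu, hG, hF, hroot] with ν hν hGν hFν hr
    have hFd : DifferentiableOn ℂ (fun x => (Sum.elim x (F ν x) : Fin n ⊕ κ → ℂ)) Ω := by
      refine differentiableOn_pi.2 ?_
      rintro (i | j)
      · exact (differentiable_apply i).differentiableOn
      · exact hFν j
    have hGd : DifferentiableOn ℂ (fun x => (Sum.elim x (G ν x) : Fin n ⊕ κ → ℂ)) Ω := by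
      refine differentiableOn_pi.2 ?_
      rintro (i | j)
      · exact (differentiable_apply i).differentiableOn
      · exact (hGν j).1
    have hQd : DifferentiableOn ℂ (fun x => MvPolynomial.eval (Sum.elim x (F ν x)) (Q i)) Ω :=
      (MvPolynomial.differentiable_eval (Q i)).comp_differentiableOn
        (f := fun x => (Sum.elim x (F ν x) : Fin n ⊕ κ → ℂ)) hFd
    have hud : DifferentiableOn ℂ (fun x => Polynomial.eval₂
        (MvPolynomial.eval (Sum.elim x (G ν x)))
        (MvPolynomial.eval (Sum.elim x (F ν x)) (Q i)) u) Ω :=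
      (MvPolynomial.differentiable_eval₂ u).comp_differentiableOn
        (f := fun x => ((Sum.elim x (G ν x) : Fin n ⊕ κ → ℂ),
          MvPolynomial.eval (Sum.elim x (F ν x)) (Q i))) (hGd.prodMk hQd)
    have hmul : ∀ x ∈ Ω, MvPolynomial.eval (Sum.elim x (F ν x)) (Q i) ^ e *
        Polynomial.eval₂ (MvPolynomial.eval (Sum.elim x (G ν x)))
          (MvPolynomial.eval (Sum.elim x (F ν x)) (Q i)) u = 0 := fun x hx =>
      h x (G ν x) (F ν x) (hr x hx)
    have hz := (eqOn_zero_or_eqOn_zero_of_mul hΩ hc (hQd.fun_pow e) hud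
      hmul).resolve_right fun hall => hν (hall x hx)
    exact fun x hx => eq_zero_of_pow_eq_zero (hz x hx)
  filter_upwards [hA, hB, hG, hF, hroot] with ν hAν hBν hGν hFν hr
  refine ⟨fun j => ?_, fun x hx i => hBν i x hx⟩
  obtain ⟨a, ha, t, ht⟩ := hAν j
  refine algOn_of_root (hΩ := hΩ) (hc := hc) (hne := hne)
    (θ := fun x => Sum.elim x (G ν x)) (F := fun x => F ν x j) (a := a) (t := t) ?_ (P j) (hFν j)
    (fun x hx => hr x hx j) ha ht
  rintro (i | j)
  · exact clm_mem_algFun (ContinuousLinearMap.proj i)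
  · exact hGν j

/-- Holomorphic solutions of polynomial systems in `n` variables are locally uniform limits of
algebraic ones. -/
def HasAlgApprox (n : ℕ) : Prop :=
  ∀ (κ ι : Type) [Fintype κ] [Fintype ι] (f : (Fin n → ℂ) → κ → ℂ)
    (Q : ι → MvPolynomial (Fin n ⊕ κ) ℂ) (R : ℝ), 0 < R →
    (∀ j, DifferentiableOn ℂ (fun x => f x j) (Metric.ball 0 R)) →
    (∀ x ∈ Metric.ball (0 : Fin n → ℂ) R, ∀ i, MvPolynomial.eval (Sum.elim x (f x)) (Q i) = 0) →
    ∃ ρ > 0, ρ ≤ R ∧ ∃ F : ℕ → (Fin n → ℂ) → κ → ℂ,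
      (∀ ν j, DifferentiableOn ℂ (fun x => F ν x j) (Metric.ball 0 ρ)) ∧
      (∀ ν j, AlgOn (Metric.ball 0 ρ) fun x => F ν x j) ∧
      TendstoUniformlyOn F f atTop (Metric.ball 0 ρ) ∧
      ∀ ν, ∀ x ∈ Metric.ball (0 : Fin n → ℂ) ρ, ∀ i,
        MvPolynomial.eval (Sum.elim x (F ν x)) (Q i) = 0

theorem hasAlgApprox_zero : HasAlgApprox 0 := by
  intro κ ι _ _ f Q R hR hf hQ
  refine ⟨R, hR, le_rfl, fun _ => f, fun _ => hf, fun _ j => ?_, ?_, fun _ => hQ⟩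
  · refine ⟨Polynomial.X - Polynomial.C (MvPolynomial.C (f 0 j)), Polynomial.X_sub_C_ne_zero _,
      fun x _ => ?_⟩
    rw [Subsingleton.elim x 0]
    simp
  · exact Metric.tendstoUniformlyOn_iff.2 fun ε hε => Eventually.of_forall fun _ x _ => by
      rwa [dist_self]

section Approx

variable {m : ℕ} {κ : Type} [Fintype κ] {f : (Fin (m + 1) → ℂ) → κ → ℂ} {R : ℝ}
  {δ : MvPolynomial (Fin (m + 1) ⊕ κ) ℂ} {E : κ → MvPolynomial (Fin (m + 1) ⊕ κ) ℂ}

omit [Fintype κ] in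
theorem divisorVal_mem_algFun {n p : ℕ} {Ω : Set (Fin n → ℂ)} {hΩ : IsOpen Ω} {hc : Convex ℝ Ω}
    {hne : Ω.Nonempty} {b : (Fin n → ℂ) → DivIndex κ p → ℂ} {t : (Fin n → ℂ) → ℂ}
    (hb : ∀ i, (fun x => b x i) ∈ algFun hΩ hc hne) (ht : t ∈ algFun hΩ hc hne) :
    (fun x => divisorVal (b x) (t x)) ∈ algFun hΩ hc hne := by
  have : (fun x => divisorVal (b x) (t x)) =
      t ^ p + ∑ s : Fin p, (fun x => b x (Sum.inr s)) * t ^ (s : ℕ) := by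
    ext x
    simp [divisorVal]
  rw [this]
  exact add_mem (pow_mem ht _) (sum_mem fun s _ => mul_mem (hb _) (pow_mem ht _))

omit [Fintype κ] in
theorem remainderVal_mem_algFun {n p : ℕ} {Ω : Set (Fin n → ℂ)} {hΩ : IsOpen Ω} {hc : Convex ℝ Ω}
    {hne : Ω.Nonempty} {b : (Fin n → ℂ) → DivIndex κ p → ℂ} {t : (Fin n → ℂ) → ℂ}
    (hb : ∀ i, (fun x => b x i) ∈ algFun hΩ hc hne) (ht : t ∈ algFun hΩ hc hne) (j : κ) :
    (fun x => remainderVal (b x) (t x) j) ∈ algFun hΩ hc hne := by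
  have : (fun x => remainderVal (b x) (t x) j) =
      ∑ s : Fin (2 * p), (fun x => b x (Sum.inl (j, s))) * t ^ (s : ℕ) := by
    ext x
    simp [remainderVal]
  rw [this]
  exact sum_mem fun s _ => mul_mem (hb _) (pow_mem ht _)

theorem WeierstrassData.exists_approx (W : WeierstrassData m κ f R δ E) (hm : HasAlgApprox m) :
    ∃ ρ > 0, ρ ≤ W.ρ ∧ ρ ≤ W.r ∧ ∃ Y : ℕ → (Fin m → ℂ) × ℂ → LiftSpace m W.p κ,
      (∀ ν z, (Y ν z).1 = z) ∧
      (∀ ν, DifferentiableOn ℂ (Y ν) (Metric.ball 0 ρ)) ∧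
      (∀ ν, ∀ z ∈ Metric.ball (0 : (Fin m → ℂ) × ℂ) ρ, ∀ i,
        MvPolynomial.eval (Sum.elim (Y ν z).1.1 (Y ν z).2.1) (W.Q i) = 0) ∧
      TendstoUniformlyOn Y (fun z => (z, (W.B z.1, W.H z))) atTop (Metric.ball 0 ρ) ∧
      ∀ ν (Ω : Set (Fin (m + 1) → ℂ)) (hΩ : IsOpen Ω) (hc : Convex ℝ Ω) (hne : Ω.Nonempty),
        (∀ x ∈ Ω, W.L.symm x ∈ Metric.ball 0 ρ) → ∀ j,
        (fun x => liftPoint W.L.toContinuousLinearMap (Y ν (W.L.symm x)) (Sum.inr j)) ∈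
          algFun hΩ hc hne := by
  have := W.fintype_ι
  obtain ⟨ρ₁, hρ₁, hρ₁W, B, hBd, hBa, hBlim, hBQ⟩ :=
    hm (DivIndex κ W.p) W.ι W.B W.Q W.ρ W.ρ_pos W.B_diff W.Q_eq
  have hR : 0 < min W.ρ W.r := lt_min W.ρ_pos W.r_pos
  obtain ⟨ρ₂, hρ₂, happ⟩ := hasPolyApprox ((Fin m → ℂ) × ℂ) _ hR
  have hH : ∀ (ν : ℕ) (j : κ), ∃ P ∈ polyFun ((Fin m → ℂ) × ℂ),
      ∀ z ∈ Metric.closedBall (0 : (Fin m → ℂ) × ℂ) ρ₂, ‖W.H z j - P z‖ ≤ 1 / ((ν : ℝ) + 1) := by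
    intro ν j
    refine happ (fun z => W.H z j) ((W.H_diff j).mono ?_) _ Nat.one_div_pos_of_nat
    intro z hz
    rw [← Prod.mk_zero_zero, ← ball_prod_same] at hz
    exact ⟨Metric.ball_subset_ball (min_le_left _ _) hz.1,
      Metric.ball_subset_ball (min_le_right _ _) hz.2⟩
  choose H hH hHlim using hH
  set ρ := min (min ρ₁ ρ₂) W.r with hρ
  have hfst : ∀ z ∈ Metric.ball (0 : (Fin m → ℂ) × ℂ) ρ, z.1 ∈ Metric.ball (0 : Fin m → ℂ) ρ₁ := by
    intro z hz
    rw [← Prod.mk_zero_zero, ← ball_prod_same] at hz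
    exact Metric.ball_subset_ball ((min_le_left _ _).trans (min_le_left _ _)) hz.1
  refine ⟨ρ, lt_min (lt_min hρ₁ hρ₂) W.r_pos,
    ((min_le_left _ _).trans (min_le_left _ _)).trans hρ₁W, min_le_right _ _,
    fun ν z => (z, (B ν z.1, fun j => H ν j z)), fun ν z => rfl, fun ν => ?_, fun ν z hz i => ?_,
    ?_, fun ν Ω hΩ hc hne hL j => ?_⟩
  · refine differentiableOn_id.prodMk (DifferentiableOn.prodMk ?_ ?_)
    · exact differentiableOn_pi.2 fun i => (hBd ν i).comp differentiableOn_fst hfst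
    · exact differentiableOn_pi.2 fun j => (differentiable_of_mem_polyFun (hH ν j)).differentiableOn
  · exact hBQ ν z.1 (hfst z hz) i
  · refine Metric.tendstoUniformlyOn_iff.2 fun ε hε => ?_
    have h1 := tendsto_one_div_add_atTop_nhds_zero_nat (𝕜 := ℝ)
    filter_upwards [Metric.tendstoUniformlyOn_iff.1 hBlim ε hε, h1.eventually_lt_const hε]
      with ν hν hν' z hz
    rw [Prod.dist_eq]
    refine max_lt (by rwa [dist_self]) ?_
    rw [Prod.dist_eq]
    refine max_lt (hν z.1 (hfst z hz)) ((dist_pi_lt_iff hε).2 fun j => ?_)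
    rw [dist_eq_norm]
    exact (hHlim ν j z (Metric.ball_subset_closedBall (Metric.ball_subset_ball
      ((min_le_left _ _).trans (min_le_right _ _)) hz))).trans_lt hν'
  · set l₁ : (Fin (m + 1) → ℂ) →L[ℂ] (Fin m → ℂ) :=
      (ContinuousLinearMap.fst ℂ _ _).comp W.L.symm.toContinuousLinearMap with hl₁
    set l₂ : (Fin (m + 1) → ℂ) →L[ℂ] ℂ :=
      (ContinuousLinearMap.snd ℂ _ _).comp W.L.symm.toContinuousLinearMap with hl₂
    have ht : (fun x => l₂ x) ∈ algFun hΩ hc hne := clm_mem_algFun l₂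
    have hsurj : Function.Surjective l₁ := Prod.fst_surjective.comp W.L.symm.surjective
    have hmem : ∀ x ∈ Ω, l₁ x ∈ Metric.ball (0 : Fin m → ℂ) ρ₁ := fun x hx => hfst _ (hL x hx)
    have hb : ∀ i, (fun x => B ν (l₁ x) i) ∈ algFun hΩ hc hne := by
      intro i
      refine ⟨(hBd ν i).comp l₁.differentiable.differentiableOn hmem, ?_⟩
      obtain ⟨q, hq⟩ := l₁.exists_eval_eq
      have := (hBa ν i).comp_eval q (Ω' := Ω) ((funext hq : _ = ⇑l₁) ▸ hsurj)
        (by simpa only [hq] using hmem)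
      simpa only [hq] using this
    have hh : (fun x => H ν j (W.L.symm x)) ∈ algFun hΩ hc hne :=
      polyFun_comp_mem_algFun (hH ν j) W.L.symm.toContinuousLinearMap
    exact add_mem (remainderVal_mem_algFun hb ht j)
      (mul_mem (pow_mem (divisorVal_mem_algFun hb ht) 2) hh)

end Approx

theorem not_forall_eval_prod_eq_zero {n : ℕ} {σ κ : Type*} {Ω : Set (Fin n → ℂ)}
    [Finite σ] (hΩ : IsOpen Ω) (hc : Convex ℝ Ω) (hne : Ω.Nonempty) {θ : (Fin n → ℂ) → σ → ℂ}
    (hθ : DifferentiableOn ℂ θ Ω) {D : κ → MvPolynomial σ ℂ} (s : Finset κ)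
    (hD : ∀ j, ¬ ∀ x ∈ Ω, MvPolynomial.eval (θ x) (D j) = 0) :
    ¬ ∀ x ∈ Ω, MvPolynomial.eval (θ x) (∏ j ∈ s, D j) = 0 := by
  classical
  have := Fintype.ofFinite σ
  have hd : ∀ q : MvPolynomial σ ℂ, DifferentiableOn ℂ (fun x => MvPolynomial.eval (θ x) q) Ω :=
    fun q => (MvPolynomial.differentiable_eval q).comp_differentiableOn (f := θ) hθ
  induction s using Finset.induction_on with
  | empty =>
    intro h
    obtain ⟨x, hx⟩ := hne
    simpa using h x hx
  | insert j s hj ih =>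
    intro h
    have hmul : ∀ x ∈ Ω, MvPolynomial.eval (θ x) (D j) *
        MvPolynomial.eval (θ x) (∏ j ∈ s, D j) = 0 := by
      intro x hx
      rw [← map_mul, ← Finset.prod_insert hj]
      exact h x hx
    rcases eqOn_zero_or_eqOn_zero_of_mul hΩ hc (hd _) (hd _) hmul with h | h
    · exact hD j h
    · exact ih h

theorem exists_mem_ball_ne_zero {V : Type*} [NormedAddCommGroup V] [NormedSpace ℂ V]
    {g : V → ℂ} {R ρ : ℝ} (hg : DifferentiableOn ℂ g (Metric.ball 0 R)) (hR : 0 < R) (hρ : 0 < ρ)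
    (h : ¬ ∀ x ∈ Metric.ball 0 R, g x = 0) : ∃ x ∈ Metric.ball 0 ρ, g x ≠ 0 := by
  by_contra! hall
  exact h (eqOn_zero_of_eventuallyEq_zero_of_convex Metric.isOpen_ball (convex_ball _ _) hg
    (Metric.mem_ball_self hR) (by
      filter_upwards [Metric.ball_mem_nhds _ hρ] with x hx
      exact hall x hx))

theorem HasAlgApprox.succ {m : ℕ} (hm : HasAlgApprox m) : HasAlgApprox (m + 1) := by
  intro κ ι _ _ f Q R hR hf hQ
  classical
  have hgf : DifferentiableOn ℂ (fun x => (Sum.elim x (f x) : Fin (m + 1) ⊕ κ → ℂ))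
      (Metric.ball 0 R) := by
    refine differentiableOn_pi.2 ?_
    rintro (i | j)
    · exact (differentiable_apply i).differentiableOn
    · exact hf j
  have hevd : ∀ q : MvPolynomial (Fin (m + 1) ⊕ κ) ℂ,
      DifferentiableOn ℂ (fun x => MvPolynomial.eval (Sum.elim x (f x)) q) (Metric.ball 0 R) :=
    fun q => (MvPolynomial.differentiable_eval q).comp_differentiableOn
      (f := fun x => (Sum.elim x (f x) : Fin (m + 1) ⊕ κ → ℂ)) hgf
  obtain ⟨P, hP, hP', hPQ⟩ := exists_generic_equations_holomorphic Metric.isOpen_ball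
    (convex_ball _ _) (Metric.nonempty_ball.2 hR) hf
  set D : κ → MvPolynomial (Fin (m + 1) ⊕ κ) ℂ := fun j =>
    (Polynomial.derivative (P j)).eval (MvPolynomial.X (Sum.inr j)) with hD
  set E : κ → MvPolynomial (Fin (m + 1) ⊕ κ) ℂ := fun j =>
    (P j).eval (MvPolynomial.X (Sum.inr j)) with hE
  have heval : ∀ (x : Fin (m + 1) → ℂ) (y : κ → ℂ) (j : κ)
      (q : Polynomial (MvPolynomial (Fin (m + 1) ⊕ κ) ℂ)),
      Polynomial.eval₂ (MvPolynomial.eval (Sum.elim x y)) (y j) q =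
        MvPolynomial.eval (Sum.elim x y) (q.eval (MvPolynomial.X (Sum.inr j))) := fun x y j q =>
    Polynomial.eval₂_eval_eq (Sum.elim x y) (Sum.inr j) q
  have hDne : ∀ j, ¬ ∀ x ∈ Metric.ball (0 : Fin (m + 1) → ℂ) R,
      MvPolynomial.eval (Sum.elim x (f x)) (D j) = 0 := fun j h =>
    hP' j fun x hx => (heval x (f x) j _).trans (h x hx)
  have hδ := not_forall_eval_prod_eq_zero Metric.isOpen_ball (convex_ball _ _)
    (Metric.nonempty_ball.2 hR) hgf Finset.univ hDne
  obtain ⟨W⟩ := nonempty_weierstrassData hR hf (∏ j, D j) E hδ fun j x hx =>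
    (heval x (f x) j _).symm.trans (hP j x hx)
  obtain ⟨F, hF⟩ := W.exists_correction (P := P) (D := D) rfl (fun _ => rfl) fun _ => rfl
  obtain ⟨ρ, hρ, hρW, hρr, Y, hY1, hYd, hYQ, hYlim, hYa⟩ := W.exists_approx hm
  set S : (Fin m → ℂ) × ℂ → LiftSpace m W.p κ := fun z => (z, (W.B z.1, W.H z)) with hS
  have hball : ∀ z ∈ Metric.ball (0 : (Fin m → ℂ) × ℂ) ρ,
      z ∈ Metric.ball (0 : Fin m → ℂ) W.ρ ×ˢ Metric.ball (0 : ℂ) W.r := by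
    intro z hz
    rw [← Prod.mk_zero_zero, ← ball_prod_same] at hz
    exact ⟨Metric.ball_subset_ball hρW hz.1, Metric.ball_subset_ball hρr hz.2⟩
  have hSd : ContinuousOn S (Metric.ball 0 ρ) := by
    refine continuousOn_id.prodMk (ContinuousOn.prodMk ?_ ?_)
    · exact continuousOn_pi.2 fun i => (W.B_diff i).continuousOn.comp continuousOn_fst
        fun z hz => (hball z hz).1
    · exact continuousOn_pi.2 fun j => (W.H_diff j).continuousOn.mono hball
  obtain ⟨η, hη, hFη⟩ := Metric.eventually_nhds_iff_ball.1 hF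
  obtain ⟨ρ₂, hρ₂, hρ₂S⟩ : ∃ ρ₂ > 0, ∀ z ∈ Metric.ball (0 : (Fin m → ℂ) × ℂ) ρ₂,
      z ∈ Metric.ball (0 : (Fin m → ℂ) × ℂ) ρ ∧ S z ∈ Metric.ball (S 0) (η / 3) := by
    have h0 : Metric.ball (0 : (Fin m → ℂ) × ℂ) ρ ∈ 𝓝 0 := Metric.ball_mem_nhds _ hρ
    exact Metric.eventually_nhds_iff_ball.1 ((eventually_mem_set.2 h0).and
      ((hSd.continuousAt h0).eventually (Metric.ball_mem_nhds _ (by positivity))))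
  obtain ⟨ρ₃, hρ₃, hρ₃L⟩ : ∃ ρ₃ > 0, ∀ x ∈ Metric.ball (0 : Fin (m + 1) → ℂ) ρ₃,
      W.L.symm x ∈ Metric.ball 0 ρ₂ ∧ x ∈ Metric.ball 0 R :=
    Metric.eventually_nhds_iff_ball.1 (((W.L.symm.continuous.continuousAt (x := 0)).eventually
      (by rw [map_zero]; exact Metric.ball_mem_nhds _ hρ₂)).and (Metric.ball_mem_nhds _ hR))
  set Ω := Metric.ball (0 : Fin (m + 1) → ℂ) ρ₃ with hΩ
  have hΩo : IsOpen Ω := Metric.isOpen_ball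
  have hΩc : Convex ℝ Ω := convex_ball _ _
  have hΩn : Ω.Nonempty := Metric.nonempty_ball.2 hρ₃
  have hLΩ : ∀ x ∈ Ω, W.L.symm x ∈ Metric.ball 0 ρ := fun x hx => (hρ₂S _ (hρ₃L x hx).1).1
  set K := Metric.closedBall (S 0) (2 * η / 3) with hK
  have hKη : ∀ y ∈ K, y ∈ Metric.ball (S 0) η := fun y hy =>
    (Metric.mem_closedBall.1 hy).trans_lt (by linarith)
  have hFu : UniformContinuousOn F K := by
    refine (isCompact_closedBall _ _).uniformContinuousOn_of_continuous fun y hy => ?_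
    exact (hFη y (hKη y hy)).1.continuousAt.continuousWithinAt
  have hSK : ∀ x ∈ Ω, S (W.L.symm x) ∈ K := fun x hx =>
    Metric.ball_subset_closedBall (Metric.ball_subset_ball (by linarith)
      (hρ₂S _ (hρ₃L x hx).1).2)
  have hYΩ : TendstoUniformlyOn (fun ν x => Y ν (W.L.symm x)) (fun x => S (W.L.symm x)) atTop Ω :=
    (hYlim.comp W.L.symm).mono hLΩ
  have hYK : ∀ᶠ ν in atTop, ∀ x ∈ Ω, Y ν (W.L.symm x) ∈ K := by
    filter_upwards [Metric.tendstoUniformlyOn_iff.1 hYΩ (η / 3) (by positivity)] with ν hν x hx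
    have h1 := hν x hx
    have h2 := Metric.mem_ball.1 (hρ₂S _ (hρ₃L x hx).1).2
    rw [dist_comm] at h1
    refine Metric.mem_closedBall.2 ((dist_triangle _ (S (W.L.symm x)) _).trans ?_)
    linarith
  have hSf : ∀ x ∈ Ω, liftPoint W.L.toContinuousLinearMap (S (W.L.symm x)) = Sum.elim x (f x) := by
    intro x hx
    have := W.f_eq _ (hball _ (hLΩ x hx))
    rw [W.L.apply_symm_apply] at this
    exact this.symm
  have hFS : ∀ x ∈ Ω, F (S (W.L.symm x)) = f x := by
    intro x hx
    ext j
    refine ((hFη _ (hKη _ (hSK x hx))).2.2 (fun j => W.C_eq j _ (hball _ (hLΩ x hx))) j).trans ?_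
    exact congrFun (hSf x hx) (Sum.inr j)
  have hFlim : TendstoUniformlyOn (fun ν x => F (Y ν (W.L.symm x))) f atTop Ω :=
    (UniformContinuousOn.comp_tendstoUniformlyOn_eventually hYK hSK hFu hYΩ).congr_right hFS
  set G : ℕ → (Fin (m + 1) → ℂ) → κ → ℂ := fun ν x j =>
    liftPoint W.L.toContinuousLinearMap (Y ν (W.L.symm x)) (Sum.inr j) with hG
  have hYG : ∀ ν x, liftPoint W.L.toContinuousLinearMap (Y ν (W.L.symm x)) =
      Sum.elim x (G ν x) := by
    intro ν x
    ext (i | j)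
    · change W.L (Y ν (W.L.symm x)).1 i = x i
      rw [hY1, W.L.apply_symm_apply]
    · rfl
  have hGlim : ∀ x ∈ Ω, Tendsto (fun ν => G ν x) atTop (𝓝 (f x)) := by
    intro x hx
    refine tendsto_pi_nhds.2 fun j => ?_
    have h1 := ((differentiable_liftPoint W.L.toContinuousLinearMap).continuous.tendsto _).comp
      (hYΩ.tendsto_at hx)
    have h2 := tendsto_pi_nhds.1 h1 (Sum.inr j)
    rw [hSf x hx] at h2
    exact h2
  have hFd : ∀ᶠ ν in atTop, ∀ j, DifferentiableOn ℂ (fun x => F (Y ν (W.L.symm x)) j) Ω := by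
    filter_upwards [hYK] with ν hν
    refine differentiableOn_pi.1 fun x hx => ?_
    have h1 := (hFη _ (hKη _ (hν x hx))).1
    have h2 : DifferentiableAt ℂ (Y ν) (W.L.symm x) :=
      (hYd ν).differentiableAt (Metric.isOpen_ball.mem_nhds (hLΩ x hx))
    exact ((h1.comp (W.L.symm x) h2).comp x W.L.symm.differentiableAt).differentiableWithinAt
  have hroot : ∀ᶠ ν in atTop, ∀ x ∈ Ω, ∀ j, Polynomial.eval₂
      (MvPolynomial.eval (Sum.elim x (G ν x))) (F (Y ν (W.L.symm x)) j) (P j) = 0 := by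
    filter_upwards [hYK] with ν hν x hx j
    have h1 := (hFη _ (hKη _ (hν x hx))).2.1 (hYQ ν _ (hLΩ x hx)) j
    rwa [hYG] at h1
  have hfin := eventually_algOn_of_roots hΩo hΩc hΩn
    (fun x hx => hQ x (hρ₃L x hx).2)
    (fun j => by
      obtain ⟨x, hx, hne⟩ := exists_mem_ball_ne_zero (hevd (D j)) hR hρ₃ (hDne j)
      exact ⟨x, hx, (heval x (f x) j _).trans_ne hne⟩)
    (fun i => by
      obtain ⟨e, u, hu, h⟩ := hPQ (Q i)
      exact ⟨e, u, exists_mem_ball_ne_zero (hevd _) hR hρ₃ hu, h⟩)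
    (Eventually.of_forall fun ν j => hYa ν Ω hΩo hΩc hΩn hLΩ j) hFd hGlim
    (fun x hx => hFlim.tendsto_at hx) hroot
  obtain ⟨N, hN⟩ := eventually_atTop.1 (hfin.and hFd)
  refine ⟨min ρ₃ R, lt_min hρ₃ hR, min_le_right _ _,
    fun ν x => F (Y (ν + N) (W.L.symm x)), fun ν j => ?_, fun ν j => ?_, ?_, fun ν x hx i => ?_⟩
  · exact ((hN (ν + N) (Nat.le_add_left _ _)).2 j).mono
      (Metric.ball_subset_ball (min_le_left _ _))
  · exact ((hN (ν + N) (Nat.le_add_left _ _)).1.1 j).mono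
      (Metric.ball_subset_ball (min_le_left _ _))
  · exact fun u hu => (tendsto_add_atTop_nat N).eventually
      ((hFlim.mono (Metric.ball_subset_ball (min_le_left _ _))) u hu)
  · exact (hN (ν + N) (Nat.le_add_left _ _)).1.2 x
      (Metric.ball_subset_ball (min_le_left _ _) hx) i

theorem hasAlgApprox : ∀ n, HasAlgApprox n
  | 0 => hasAlgApprox_zero
  | n + 1 => (hasAlgApprox n).succ

theorem stmt_0 (n k q : ℕ) (U : Set (Fin n → ℂ)) (hU : IsOpen U)
    (f : (Fin n → ℂ) → (Fin k → ℂ)) (hf : DifferentiableOn ℂ f U)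
    (Q : Fin q → MvPolynomial ((Fin n) ⊕ (Fin k)) ℂ)
    (hQ : ∀ x ∈ U, ∀ i, MvPolynomial.eval (Sum.elim x (f x)) (Q i) = 0)
    (x₀ : Fin n → ℂ) (hx₀ : x₀ ∈ U) :
    ∃ U₀ : Set (Fin n → ℂ), IsOpen U₀ ∧ x₀ ∈ U₀ ∧ U₀ ⊆ U ∧
      ∃ F : ℕ → (Fin n → ℂ) → (Fin k → ℂ),
        (∀ ν i, NashFn n U₀ (fun x => F ν x i)) ∧
        TendstoUniformlyOn F f atTop U₀ ∧
        (∀ ν, ∀ x ∈ U₀, ∀ i, MvPolynomial.eval (Sum.elim x (F ν x)) (Q i) = 0) := by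
  obtain ⟨R, hR, hRU⟩ := Metric.isOpen_iff.1 hU x₀ hx₀
  have hshift : ∀ x ∈ Metric.ball (0 : Fin n → ℂ) R, x + x₀ ∈ U := fun x hx => hRU (by
    rwa [mem_ball_iff_norm, add_sub_cancel_right, ← mem_ball_zero_iff])
  let τ : Fin n ⊕ Fin k → MvPolynomial (Fin n ⊕ Fin k) ℂ :=
    Sum.elim (fun i => MvPolynomial.X (Sum.inl i) + MvPolynomial.C (x₀ i))
      fun j => MvPolynomial.X (Sum.inr j)
  have hτ : ∀ (x : Fin n → ℂ) (y : Fin k → ℂ) (p : MvPolynomial (Fin n ⊕ Fin k) ℂ),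
      MvPolynomial.eval (Sum.elim x y) (MvPolynomial.bind₁ τ p) =
        MvPolynomial.eval (Sum.elim (x + x₀) y) p := by
    intro x y p
    rw [← MvPolynomial.coe_aeval_eq_eval, RingHom.coe_coe, MvPolynomial.aeval_bind₁,
      ← MvPolynomial.coe_aeval_eq_eval, RingHom.coe_coe]
    congr 2
    ext (i | j) <;> simp [τ]
  obtain ⟨ρ, hρ, hρR, F, hFd, hFa, hFlim, hFQ⟩ := hasAlgApprox n (Fin k) (Fin q)
    (fun x => f (x + x₀)) (fun i => MvPolynomial.bind₁ τ (Q i)) R hR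
    (fun j => by
      have h1 : DifferentiableOn ℂ (fun x => f (x + x₀)) (Metric.ball 0 R) :=
        hf.comp (differentiable_id.add_const x₀).differentiableOn hshift
      exact differentiableOn_pi.1 h1 j)
    (fun x hx i => by
      rw [hτ]
      exact hQ _ (hshift x hx) i)
  have hmem : ∀ x ∈ Metric.ball x₀ ρ, x - x₀ ∈ Metric.ball (0 : Fin n → ℂ) ρ := fun x hx => by
    rwa [mem_ball_zero_iff, ← mem_ball_iff_norm]
  refine ⟨Metric.ball x₀ ρ, Metric.isOpen_ball, Metric.mem_ball_self hρ,
    (Metric.ball_subset_ball hρR).trans hRU, fun ν x => F ν (x - x₀), fun ν i => ⟨?_, fun a ha =>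
      ⟨Metric.ball x₀ ρ, Metric.isOpen_ball, ha, ?_⟩⟩, ?_, fun ν x hx i => ?_⟩
  · exact (hFd ν i).comp (differentiable_id.sub_const x₀).differentiableOn hmem
  · have heval : ∀ x : Fin n → ℂ, (fun i => MvPolynomial.eval x
        (MvPolynomial.X i - MvPolynomial.C (x₀ i) : MvPolynomial (Fin n) ℂ)) = x - x₀ := by
      intro x
      ext i
      simp
    obtain ⟨P, hP0, hP⟩ := (hFa ν i).comp_eval (Ω' := Metric.ball x₀ ρ)
      (fun i => MvPolynomial.X i - MvPolynomial.C (x₀ i))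
      (fun y => ⟨y + x₀, by
        dsimp only
        rw [heval, add_sub_cancel_right]⟩)
      (fun x hx => by
        rw [heval]
        exact hmem x hx)
    refine ⟨P, hP0, fun x hx => ?_⟩
    have := hP x hx.1
    dsimp only at this
    rw [heval] at this
    exact this
  · have h1 := (hFlim.comp fun x => x - x₀).mono hmem
    refine h1.congr_right fun x _ => ?_
    simp
  · have h1 := hFQ ν _ (hmem x hx) i
    rwa [hτ, sub_add_cancel] at h1
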